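/- (Mean invasion speed, further control.) Assume V satisfies (H_coerc) and (H_gen), and let u be a radially symmetric solution satisfying (H_hom) with m = 0 and (H_inv), together with the escape-point setup below. Then c̲ = c̄; that is, all four limit mean speeds c_esc⁻, c_esc⁺, c̄ and c̲ coincide (their common value is denoted c_esc). -/

import Mathlib

open Filter Topology Set MeasureTheory

noncomputable section

local notation "⟪" x ", " y "⟫" => @inner ℝ _ _ x y

abbrev Euc (n : ℕ) : Type := EuclideanSpace ℝ (Fin n)

variable {n : ℕ}

/-- Spatial partial derivative `u_r`. -/
def ur (u : ℝ → ℝ → Euc n) (r t : ℝ) : Euc n := deriv (fun s => u s t) r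

/-- Second spatial partial derivative `u_rr`. -/
def urr (u : ℝ → ℝ → Euc n) (r t : ℝ) : Euc n := deriv (fun s => ur u s t) r

/-- Time partial derivative `u_t`. -/
def ut (u : ℝ → ℝ → Euc n) (r t : ℝ) : Euc n := deriv (fun s => u r s) t

/-- Hessian (second differential) of the potential. -/
def hess (V : Euc n → ℝ) (x : Euc n) : Euc n →L[ℝ] Euc n := fderiv ℝ (gradient V) x

/-- Coercivity hypothesis. -/
def HCoerc (V : Euc n → ℝ) : Prop :=
  ∃ ε > (0:ℝ), ∃ R : ℝ, ∀ x : Euc n, R ≤ ‖x‖ → ε * ‖x‖ ^ 2 ≤ ⟪x, gradient V x⟫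

/-- The set of nondegenerate minimum points of `V`. -/
def MinSet (V : Euc n → ℝ) : Set (Euc n) :=
  {m | gradient V m = 0 ∧ ∀ v : Euc n, v ≠ 0 → 0 < ⟪v, hess V m v⟫}

/-- Data of the constants `λ_min`, `λ_max`, `d_Esc` from the paper, together with their
spectral characterizations. -/
structure EscData (n : ℕ) (V : Euc n → ℝ) where
  lmin : ℝ
  lmax : ℝ
  dEsc : ℝ
  lmin_pos : 0 < lmin
  dEsc_pos : 0 < dEsc
  lower : ∀ m ∈ MinSet V, ∀ v : Euc n, lmin * ‖v‖ ^ 2 ≤ ⟪v, hess V m v⟫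
  upper : ∀ m ∈ MinSet V, ∀ v : Euc n, ⟪v, hess V m v⟫ ≤ lmax * ‖v‖ ^ 2
  esc_lower : ∀ m ∈ MinSet V, ∀ x : Euc n, ‖x - m‖ ≤ dEsc →
    ∀ v : Euc n, lmin / 2 * ‖v‖ ^ 2 ≤ ⟪v, hess V x v⟫
  esc_upper : ∀ m ∈ MinSet V, ∀ x : Euc n, ‖x - m‖ ≤ dEsc →
    ∀ v : Euc n, ⟪v, hess V x v⟫ ≤ 2 * lmax * ‖v‖ ^ 2

/-- Radially symmetric solution of `u_t = -∇V(u) + ((d-1)/r) u_r + u_rr` with Neumann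
boundary condition at the origin. -/
structure IsRadialSolution (d : ℕ) (V : Euc n → ℝ) (u : ℝ → ℝ → Euc n) : Prop where
  diff_r : ∀ t > (0:ℝ), ∀ r : ℝ, DifferentiableAt ℝ (fun s => u s t) r
  diff_rr : ∀ t > (0:ℝ), ∀ r : ℝ, DifferentiableAt ℝ (fun s => ur u s t) r
  cont_rr : ∀ t > (0:ℝ), Continuous fun r => urr u r t
  diff_t : ∀ t > (0:ℝ), ∀ r : ℝ, DifferentiableAt ℝ (fun s => u r s) t
  cont_t : ∀ r : ℝ, ContinuousOn (fun s => ut u r s) (Ioi 0)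
  bounded : ∃ C : ℝ, ∀ r t : ℝ, 0 ≤ r → 0 < t →
    ‖u r t‖ + ‖ur u r t‖ + ‖urr u r t‖ + ‖ut u r t‖ ≤ C
  pde : ∀ r > (0:ℝ), ∀ t > (0:ℝ),
    ut u r t = -gradient V (u r t) + (((d : ℝ) - 1) / r) • ur u r t + urr u r t
  neumann : ∀ t > (0:ℝ), ur u 0 t = 0

/-- Profiles of fronts travelling at speed `c` connecting `um` to `up`
(nonconstant solutions of `φ'' = -cφ' + ∇V(φ)`). -/
def Phi (V : Euc n → ℝ) (c : ℝ) (um up : Euc n) : Set (ℝ → Euc n) :=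
  {φ | (∃ ξ₁ ξ₂ : ℝ, φ ξ₁ ≠ φ ξ₂) ∧
    (∀ ξ : ℝ, DifferentiableAt ℝ φ ξ) ∧ (∀ ξ : ℝ, DifferentiableAt ℝ (deriv φ) ξ) ∧
    (∀ ξ : ℝ, deriv (deriv φ) ξ = -(c • deriv φ ξ) + gradient V (φ ξ)) ∧
    Tendsto φ atBot (𝓝 um) ∧ Tendsto φ atTop (𝓝 up)}

/-- Fronts travelling at speed `c` invading the equilibrium `mp`. -/
def PhiInv (V : Euc n → ℝ) (c : ℝ) (mp : Euc n) : Set (ℝ → Euc n) :=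
  ⋃ mm ∈ MinSet V, Phi V c mm mp

/-- Normalized front profiles. -/
def PhiNorm (V : Euc n → ℝ) (dEsc c : ℝ) (mm mp : Euc n) : Set (ℝ → Euc n) :=
  {φ | φ ∈ Phi V c mm mp ∧ ‖φ 0 - mp‖ = dEsc ∧ ∀ ξ > (0:ℝ), ‖φ ξ - mp‖ < dEsc}

/-- Normalized front profiles invading `mp`. -/
def PhiNormInv (V : Euc n → ℝ) (dEsc c : ℝ) (mp : Euc n) : Set (ℝ → Euc n) :=
  ⋃ mm ∈ MinSet V, PhiNorm V dEsc c mm mp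

/-- Every critical point of `V` is nondegenerate. -/
def HNonDeg (V : Euc n → ℝ) : Prop :=
  ∀ x : Euc n, gradient V x = 0 → ∀ v : Euc n, hess V x v = 0 → v = 0

/-- Every front travelling at a positive speed and invading a minimum point is bistable. -/
def HOnlyBist (V : Euc n → ℝ) : Prop :=
  ∀ mp ∈ MinSet V, ∀ um : Euc n, gradient V um = 0 →
    ∀ c > (0:ℝ), (Phi V c um mp).Nonempty → um ∈ MinSet V

/-- The set of invading speeds has empty interior. -/
def HDiscVel (V : Euc n → ℝ) : Prop :=
  ∀ mp ∈ MinSet V, interior {c : ℝ | 0 ≤ c ∧ (PhiInv V c mp).Nonempty} = ∅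

/-- The set of initial values of normalized invading fronts is totally disconnected. -/
def HDiscFront (V : Euc n → ℝ) (dEsc : ℝ) : Prop :=
  ∀ mp ∈ MinSet V, ∀ c > (0:ℝ),
    IsTotallyDisconnected
      {p : Euc n × Euc n | ∃ φ ∈ PhiNormInv V dEsc c mp, p = (φ 0, deriv φ 0)}

/-- The generic hypotheses on the potential. -/
def HGen (V : Euc n → ℝ) (dEsc : ℝ) : Prop :=
  HNonDeg V ∧ HOnlyBist V ∧ HDiscVel V ∧ HDiscFront V dEsc

/-- The solution is stable at infinity, close to the minimum point `m`. -/
def StableAtInfinity (V : Euc n → ℝ) (u : ℝ → ℝ → Euc n) (m : Euc n) : Prop :=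
  m ∈ MinSet V ∧
    Tendsto (fun t => limsup (fun r => ‖u r t - m‖) atTop) atTop (𝓝 0)

/-- Propagating terrace of bistable fronts connecting `mLoc` to `mFar`. -/
def IsTerrace (V : Euc n → ℝ) (mLoc mFar : Euc n) (T : ℝ → ℝ → Euc n) : Prop :=
  ∃ (q : ℕ) (ms : ℕ → Euc n) (cs : ℕ → ℝ) (φs : ℕ → ℝ → Euc n) (rs : ℕ → ℝ → ℝ),
    ms 0 = mFar ∧ ms q = mLoc ∧ (∀ i, i ≤ q → ms i ∈ MinSet V) ∧
    (∀ i, i < q → V (ms (i + 1)) < V (ms i)) ∧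
    (∀ i, 1 ≤ i → i ≤ q → 0 < cs i) ∧
    (∀ i, 1 ≤ i → i + 1 ≤ q → cs (i + 1) ≤ cs i) ∧
    (∀ i, 1 ≤ i → i ≤ q → φs i ∈ Phi V (cs i) (ms i) (ms (i - 1))) ∧
    (∀ i, 1 ≤ i → i ≤ q →
      (∀ t : ℝ, 0 ≤ t → 0 ≤ rs i t) ∧ (∀ t : ℝ, DifferentiableAt ℝ (rs i) t) ∧
        Tendsto (deriv (rs i)) atTop (𝓝 (cs i))) ∧
    (∀ i, 1 ≤ i → i + 1 ≤ q → Tendsto (fun t => rs (i + 1) t - rs i t) atTop atTop) ∧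
    (∀ r t : ℝ, 0 ≤ r → 0 ≤ t →
      T r t = ms 0 + ∑ i ∈ Finset.Icc 1 q, (φs i (r - rs i t) - ms (i - 1)))

/-- Hypothesis `(H_hom)` unbundled: `u` is close to `m` on a growing interval around
`rHom t`, travelling at asymptotic speed `cHom`; closeness is measured in `H¹` norm. -/
def HHomWith (u : ℝ → ℝ → Euc n) (m : Euc n) (cHom : ℝ) (rHom : ℝ → ℝ) : Prop :=
  0 < cHom ∧ (∀ t : ℝ, DifferentiableAt ℝ rHom t) ∧
    Tendsto (deriv rHom) atTop (𝓝 cHom) ∧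
    ∀ L > (0:ℝ),
      Tendsto
        (fun t => ∫ r in (-L)..L,
          (‖u (rHom t + r) t - m‖ ^ 2 + ‖ur u (rHom t + r) t‖ ^ 2))
        atTop (𝓝 0)

/-- The set whose supremum defines the Escape point `r_Esc(t)`. -/
def rEscSet (u : ℝ → ℝ → Euc n) (m : Euc n) (dEsc : ℝ) (rHom : ℝ → ℝ) (t : ℝ) : Set ℝ :=
  {r | r ∈ Icc 0 (rHom t) ∧ ‖u r t - m‖ = dEsc}

/-- The Escape point `r_Esc(t)`. -/
def rEscF (u : ℝ → ℝ → Euc n) (m : Euc n) (dEsc : ℝ) (rHom : ℝ → ℝ) (t : ℝ) : ℝ :=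
  sSup (rEscSet u m dEsc rHom t)

/-- The upper limit mean speed `c_Esc` of the Escape point. -/
def cEscV (u : ℝ → ℝ → Euc n) (m : Euc n) (dEsc : ℝ) (rHom : ℝ → ℝ) : ℝ :=
  limsup (fun t => rEscF u m dEsc rHom t / t) atTop

/-- `q_hull`: minimal convexity of the lower quadratic hulls of `V` at minimum points. -/
def qHull (V : Euc n → ℝ) : ℝ :=
  sInf {q : ℝ | ∃ m ∈ MinSet V, ∃ x : Euc n, x ≠ m ∧ q = (V x - V m) / ‖x - m‖ ^ 2}

/-- The weight `w` of the energy in the firewall functionals. -/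
def wV (V : Euc n → ℝ) : ℝ := 1 / max 1 (-(4 * qHull V))

/-- The decay rate `κ₀`. -/
def kappa0 (lmin : ℝ) : ℝ := min (1 / 2) (lmin / 8)

/-- The "small curvature" radius `r_sc`. -/
def rsc (d : ℕ) (lmin : ℝ) : ℝ := max (2 * ((d : ℝ) - 1)) (8 * ((d : ℝ) - 1) / lmin)

/-- The weight function `T_ρ ψ₀`. -/
def Tpsi (d : ℕ) (lmin : ℝ) (ρ r : ℝ) : ℝ :=
  if r ≤ rsc d lmin then Real.exp (-(kappa0 lmin) * |r - ρ|) * (r / rsc d lmin) ^ (d - 1)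
  else Real.exp (-(kappa0 lmin) * |r - ρ|)

/-- The firewall functional `F₀` in the laboratory frame. -/
def F0 (V : Euc n → ℝ) (d : ℕ) (lmin : ℝ) (u : ℝ → ℝ → Euc n) (ρ t : ℝ) : ℝ :=
  ∫ r in Ioi (0:ℝ),
    Tpsi d lmin ρ r * (wV V * (‖ur u r t‖ ^ 2 / 2 + V (u r t)) + ‖u r t‖ ^ 2 / 2)

/-- The set `Σ₀(t)` where the solution Escapes at distance `dEsc` from the origin. -/
def Sigma0 (u : ℝ → ℝ → Euc n) (dEsc t : ℝ) : Set ℝ := {r | 0 ≤ r ∧ dEsc < ‖u r t‖}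

/-- The firewall differential inequality in the laboratory frame. -/
def FireIneq (V : Euc n → ℝ) (d : ℕ) (lmin dEsc : ℝ) (u : ℝ → ℝ → Euc n) (ν K : ℝ) : Prop :=
  ∀ ρ ≥ rsc d lmin, ∀ t > (0:ℝ),
    DifferentiableAt ℝ (fun s => F0 V d lmin u ρ s) t ∧
    deriv (fun s => F0 V d lmin u ρ s) t ≤
      -ν * F0 V d lmin u ρ t + K * ∫ r in Sigma0 u dEsc t, Tpsi d lmin ρ r

/-- The quantity `δ = d_Esc √(min(w/2,1/4)/(κ₀+1))`. -/
def deltaEsc (dEsc w κ₀ : ℝ) : ℝ := dEsc * Real.sqrt (min (w / 2) (1 / 4) / (κ₀ + 1))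

/-- The length `L₀`. -/
def L0c (κ₀ ν K δ : ℝ) : ℝ := κ₀⁻¹ * Real.log (16 * K / (ν * δ ^ 2 * κ₀))

/-- The no-escape speed `c_noesc`. -/
def cNoEsc (κ₀ K L₀ δ : ℝ) : ℝ := 8 * K * L₀ / (κ₀ * δ ^ 2)

/-- The no-escape hull `h`. -/
def hull (δ L₀ : ℝ) (x : ℝ) : EReal :=
  if x < 0 then ⊤
  else if x ≤ L₀ then ((δ ^ 2 / 2 * (1 - x / (2 * L₀)) : ℝ) : EReal)
  else ((δ ^ 2 / 4 : ℝ) : EReal)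

/-- The standing hypothesis that the firewall is below the two mirror hulls positioned
around `rHom t`. -/
def HullBound (V : Euc n → ℝ) (d : ℕ) (lmin : ℝ) (u : ℝ → ℝ → Euc n) (δ L₀ : ℝ)
    (rHom : ℝ → ℝ) : Prop :=
  ∀ t ≥ (0:ℝ), rsc d lmin ≤ rHom t - 1 ∧
    ∀ r ≥ rsc d lmin, ((F0 V d lmin u r t : ℝ) : EReal) ≤
      max (hull δ L₀ (r - (rHom t - 1))) (hull δ L₀ (rHom t - r))

/-- The set whose infimum defines the escape point `r_esc(t)`. -/
def rescSet (V : Euc n → ℝ) (d : ℕ) (lmin : ℝ) (u : ℝ → ℝ → Euc n) (δ L₀ : ℝ)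
    (rHom : ℝ → ℝ) (t : ℝ) : Set ℝ :=
  {rl | rl ∈ Icc (rsc d lmin) (rHom t) ∧
    ∀ r ≥ rsc d lmin, ((F0 V d lmin u r t : ℝ) : EReal) ≤
      max (hull δ L₀ (r - rl)) (hull δ L₀ (rHom t - r))}

/-- The escape point `r_esc(t)`. -/
def rescF (V : Euc n → ℝ) (d : ℕ) (lmin : ℝ) (u : ℝ → ℝ → Euc n) (δ L₀ : ℝ)
    (rHom : ℝ → ℝ) (t : ℝ) : ℝ :=
  sInf (rescSet V d lmin u δ L₀ rHom t)

/-- `c̄`: upper limit of mean variations of a function over time intervals of length `s`. -/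
def cbarF (f : ℝ → ℝ) : ℝ :=
  limsup (fun s => sSup {x : ℝ | ∃ t ≥ (0:ℝ), x = f (t + s) - f t} / s) atTop

/-- `c̲`: lower limit of mean variations of a function over time intervals of length `s`. -/
def cunderF (f : ℝ → ℝ) : ℝ :=
  liminf (fun s => sInf {x : ℝ | ∃ t ≥ (0:ℝ), x = f (t + s) - f t} / s) atTop

/-- The decay rate `κ` in the travelling frame. -/
def kappaTF (lmin cno : ℝ) : ℝ := min (1 / 4) (lmin / (16 * (cno + 1)))

/-- The cut-off speed `c_cut` in the travelling frame. -/
def ccutTF (lmin lmax cno : ℝ) : ℝ := min (lmin / (8 * lmax)) (lmin / (8 * (cno + 1)))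

/-- The energy weight `w'` in the travelling frame. -/
def wTF (V : Euc n → ℝ) (cno : ℝ) : ℝ := min (wV V) (1 / (cno + 1) ^ 2)

/-- The weight function `χ` of the localized energy in the travelling frame. -/
def chiTF (d : ℕ) (lmin lmax cno c xcut r0 : ℝ) (ρ s : ℝ) : ℝ :=
  if ρ ≤ -r0 - c * s + rsc d lmin then
    Real.exp (c * ρ) * ((r0 + c * s + ρ) / rsc d lmin) ^ (d - 1)
  else if ρ ≤ xcut + ccutTF lmin lmax cno * s then Real.exp (c * ρ)
  else
    Real.exp ((c + kappaTF lmin cno) * (xcut + ccutTF lmin lmax cno * s) -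
      kappaTF lmin cno * ρ)

/-- The weight function `ψ` of the firewall in the travelling frame. -/
def psiTF (d : ℕ) (lmin lmax cno c xcut r0 : ℝ) (ρ s : ℝ) : ℝ :=
  if ρ ≤ -r0 - c * s + rsc d lmin then
    Real.exp ((c + kappaTF lmin cno) * ρ -
        kappaTF lmin cno * (xcut + ccutTF lmin lmax cno * s)) *
      ((r0 + c * s + ρ) / rsc d lmin) ^ (d - 1)
  else if ρ ≤ xcut + ccutTF lmin lmax cno * s then
    Real.exp ((c + kappaTF lmin cno) * ρ -
      kappaTF lmin cno * (xcut + ccutTF lmin lmax cno * s))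
  else
    Real.exp ((c + kappaTF lmin cno) * (xcut + ccutTF lmin lmax cno * s) -
      kappaTF lmin cno * ρ)

/-- The firewall functional `F(s)` in the travelling frame. -/
def FTF (V : Euc n → ℝ) (d : ℕ) (lmin lmax cno : ℝ) (u : ℝ → ℝ → Euc n)
    (t0 c xcut r0 : ℝ) (s : ℝ) : ℝ :=
  ∫ ρ in Ioi (-r0 - c * s),
    psiTF d lmin lmax cno c xcut r0 ρ s *
      (wTF V cno *
          (‖ur u (r0 + c * s + ρ) (t0 + s)‖ ^ 2 / 2 + V (u (r0 + c * s + ρ) (t0 + s))) +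
        ‖u (r0 + c * s + ρ) (t0 + s)‖ ^ 2 / 2)

/-- The set `Σ(s)` where the solution Escapes, in the travelling frame. -/
def SigmaTF (u : ℝ → ℝ → Euc n) (d : ℕ) (lmin dEsc : ℝ) (t0 c r0 : ℝ) (s : ℝ) : Set ℝ :=
  {ρ | -r0 - c * s + rsc d lmin ≤ ρ ∧ dEsc < ‖u (r0 + c * s + ρ) (t0 + s)‖}

/-- The weight function `ψ̃` in the standing frame. -/
def psiSF (d : ℕ) (κ cm cp : ℝ) (r t : ℝ) : ℝ :=
  if r ≤ cm * t then r ^ (d - 1) * Real.exp (-κ * (cm * t - r))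
  else if r ≤ cp * t then r ^ (d - 1)
  else r ^ (d - 1) * Real.exp (-κ * (r - cp * t))

/-- The firewall functional `F̃` in the standing frame. -/
def FSF (V : Euc n → ℝ) (d : ℕ) (κ cm cp : ℝ) (u : ℝ → ℝ → Euc n) (t : ℝ) : ℝ :=
  ∫ r in Ioi (0:ℝ),
    psiSF d κ cm cp r t * (wV V * (‖ur u r t‖ ^ 2 / 2 + V (u r t)) + ‖u r t‖ ^ 2 / 2)

/-- The quantity `δ_dissip(t)` measuring the dissipation around the escape point. -/
def deltaDissip (u : ℝ → ℝ → Euc n) (re : ℝ → ℝ) (cesc : ℝ) (t : ℝ) : ℝ :=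
  sInf {ε : ℝ | 0 < ε ∧
    (∫ τ in (-1:ℝ)..1, ∫ ρ in (-(1/ε))..(1/ε),
      ‖ut u (re (t + τ) + ρ) (t + τ) + cesc • ur u (re (t + τ) + ρ) (t + τ)‖ ^ 2) ≤ ε}

/-- `u` solves the radially symmetric system with initial datum `u₀`, in the sense of the
semi-flow on bounded continuous functions (classical for positive times). -/
def SolvesWithInit (d : ℕ) (V : Euc n → ℝ) (u : ℝ → ℝ → Euc n) (u₀ : ℝ → Euc n) : Prop :=
  (∀ r : ℝ, 0 ≤ r → u r 0 = u₀ r) ∧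
  (∀ t : ℝ, 0 ≤ t → ContinuousOn (fun r => u r t) (Ici 0) ∧ ∃ C, ∀ r : ℝ, 0 ≤ r → ‖u r t‖ ≤ C) ∧
  (∀ t : ℝ, 0 ≤ t → ∀ ε > (0:ℝ), ∃ δ > (0:ℝ), ∀ t' : ℝ, 0 ≤ t' → |t' - t| ≤ δ →
    ∀ r : ℝ, 0 ≤ r → ‖u r t' - u r t‖ ≤ ε) ∧
  (∀ t > (0:ℝ), ∀ r > (0:ℝ),
    DifferentiableAt ℝ (fun s => u s t) r ∧ DifferentiableAt ℝ (fun s => ur u s t) r) ∧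
  (∀ t > (0:ℝ), ∀ r : ℝ, 0 ≤ r → DifferentiableAt ℝ (fun s => u r s) t) ∧
  (∀ t > (0:ℝ), ∀ r > (0:ℝ),
    ut u r t = -gradient V (u r t) + (((d : ℝ) - 1) / r) • ur u r t + urr u r t) ∧
  (∀ t > (0:ℝ), DifferentiableAt ℝ (fun s => u s t) 0 ∧ ur u 0 t = 0)

section Potential

variable {V : Euc n → ℝ}

lemma hasGradientAt_of_contDiff (hV : ContDiff ℝ 2 V) (x : Euc n) :
    HasGradientAt V (gradient V x) x :=
  ((hV.differentiable (by norm_num)) x).hasGradientAt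

lemma contDiff_gradient (hV : ContDiff ℝ 2 V) : ContDiff ℝ 1 (gradient V) := by
  have h : ContDiff ℝ 1 (fderiv ℝ V) := hV.fderiv_right (by norm_num)
  exact (InnerProductSpace.toDual ℝ (Euc n)).symm.contDiff.comp h

lemma hasFDerivAt_gradient (hV : ContDiff ℝ 2 V) (x : Euc n) :
    HasFDerivAt (gradient V) (hess V x) x :=
  ((contDiff_gradient hV).differentiable (by norm_num) x).hasFDerivAt

lemma hasDerivAt_comp_potential (hV : ContDiff ℝ 2 V) {f : ℝ → Euc n} {f' : Euc n} {t : ℝ}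
    (hf : HasDerivAt f f' t) : HasDerivAt (fun s => V (f s)) ⟪gradient V (f t), f'⟫ t := by
  have h := (hasGradientAt_of_contDiff hV (f t)).hasFDerivAt.comp_hasDerivAt t hf
  rw [InnerProductSpace.toDual_apply_apply] at h
  exact h

/-- Along a ray issued from a critical point, a lower bound on the Hessian can be integrated. -/
lemma inner_gradient_ge_of_hess_ge (hV : ContDiff ℝ 2 V) {m x : Euc n} {a : ℝ}
    (hm : gradient V m = 0)
    (h : ∀ y, ‖y - m‖ ≤ ‖x - m‖ → ∀ v, a * ‖v‖ ^ 2 ≤ ⟪v, hess V y v⟫) :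
    a * ‖x - m‖ ^ 2 ≤ ⟪x - m, gradient V x⟫ := by
  set v := x - m with hv
  have hd : ∀ s : ℝ, HasDerivAt (fun s : ℝ => ⟪v, gradient V (m + s • v)⟫)
      ⟪v, hess V (m + s • v) v⟫ s := by
    intro s
    have h1 : HasDerivAt (fun s : ℝ => m + s • v) v s := by
      simpa using ((hasDerivAt_id s).smul_const v).const_add m
    have h2 := (hasFDerivAt_gradient hV (m + s • v)).comp_hasDerivAt s h1
    simpa using (hasDerivAt_const s v).inner ℝ h2
  obtain ⟨s, hs, hs'⟩ := exists_hasDerivAt_eq_slope (fun s : ℝ => ⟪v, gradient V (m + s • v)⟫)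
    (fun s => ⟪v, hess V (m + s • v) v⟫) (zero_lt_one)
    (fun s _ => (hd s).continuousAt.continuousWithinAt) (fun s _ => hd s)
  have hb := h (m + s • v) (by
    simp only [add_sub_cancel_left, norm_smul, Real.norm_eq_abs, abs_of_pos hs.1]
    exact mul_le_of_le_one_left (norm_nonneg _) hs.2.le) v
  rw [hs'] at hb
  have e : m + v = x := by simp [hv]
  simpa [hm, e] using hb

lemma potential_ge_of_inner_gradient_nonneg (hV : ContDiff ℝ 2 V) {m x : Euc n}
    (h : ∀ s ∈ Ioo (0 : ℝ) 1, 0 ≤ ⟪x - m, gradient V (m + s • (x - m))⟫) : V m ≤ V x := by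
  set v := x - m with hv
  have hd : ∀ s : ℝ, HasDerivAt (fun s : ℝ => V (m + s • v)) ⟪gradient V (m + s • v), v⟫ s := by
    intro s
    have h1 : HasDerivAt (fun s : ℝ => m + s • v) v s := by
      simpa using ((hasDerivAt_id s).smul_const v).const_add m
    exact hasDerivAt_comp_potential hV h1
  obtain ⟨s, hs, hs'⟩ := exists_hasDerivAt_eq_slope (fun s : ℝ => V (m + s • v))
    (fun s => ⟪gradient V (m + s • v), v⟫) (zero_lt_one)
    (fun s _ => (hd s).continuousAt.continuousWithinAt) (fun s _ => hd s)
  have hb := h s hs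
  rw [real_inner_comm, hs'] at hb
  have e : m + v = x := by simp [hv]
  simp [e] at hb
  linarith

lemma EscData.inner_gradient_ge (D : EscData n V) (hV : ContDiff ℝ 2 V) {m x : Euc n}
    (hm : m ∈ MinSet V) (hx : ‖x - m‖ ≤ D.dEsc) :
    D.lmin / 2 * ‖x - m‖ ^ 2 ≤ ⟪x - m, gradient V x⟫ :=
  inner_gradient_ge_of_hess_ge hV hm.1
    fun y hy => D.esc_lower m hm y (hy.trans hx)

lemma EscData.potential_ge (D : EscData n V) (hV : ContDiff ℝ 2 V) {m x : Euc n}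
    (hm : m ∈ MinSet V) (hx : ‖x - m‖ ≤ D.dEsc) : V m ≤ V x := by
  refine potential_ge_of_inner_gradient_nonneg hV fun s hs => ?_
  have h1 : ‖m + s • (x - m) - m‖ ≤ D.dEsc := by
    simp only [add_sub_cancel_left, norm_smul, Real.norm_eq_abs, abs_of_pos hs.1]
    exact (mul_le_of_le_one_left (norm_nonneg _) hs.2.le).trans hx
  have h2 := D.inner_gradient_ge hV hm h1
  have h3 : 0 ≤ D.lmin / 2 * ‖m + s • (x - m) - m‖ ^ 2 := by
    have := D.lmin_pos; positivity
  have h4 := h3.trans h2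
  rw [add_sub_cancel_left, real_inner_smul_left] at h4
  exact nonneg_of_mul_nonneg_right h4 hs.1

/-- Quadratic control of the potential on balls, at a critical point of zero value. -/
lemma exists_quadratic_bounds (hV : ContDiff ℝ 2 V) (h0 : gradient V 0 = 0) (hV0 : V 0 = 0)
    (C : ℝ) : ∃ Λ : ℝ, 0 ≤ Λ ∧
      (∀ x y : Euc n, ‖x‖ ≤ C → ‖y‖ ≤ C → ‖gradient V x - gradient V y‖ ≤ Λ * ‖x - y‖) ∧
      (∀ x : Euc n, ‖x‖ ≤ C → ‖gradient V x‖ ≤ Λ * ‖x‖) ∧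
      (∀ x : Euc n, ‖x‖ ≤ C → |V x| ≤ Λ * ‖x‖ ^ 2) := by
  have hc : IsCompact (Metric.closedBall (0 : Euc n) C) := isCompact_closedBall 0 C
  have hcont : Continuous (hess V) := (contDiff_gradient hV).continuous_fderiv (by norm_num)
  obtain ⟨B, hB⟩ := hc.exists_bound_of_continuousOn hcont.continuousOn
  have hlip : ∀ x y : Euc n, ‖x‖ ≤ C → ‖y‖ ≤ C →
      ‖gradient V x - gradient V y‖ ≤ max B 0 * ‖x - y‖ := by
    intro x y hx hy
    exact (convex_closedBall (0 : Euc n) C).norm_image_sub_le_of_norm_hasFDerivWithin_le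
      (fun z _ => (hasFDerivAt_gradient hV z).hasFDerivWithinAt)
      (fun z hz => (hB z hz).trans (le_max_left _ _)) (by simpa using hy) (by simpa using hx)
  have hgrad : ∀ x : Euc n, ‖x‖ ≤ C → ‖gradient V x‖ ≤ max B 0 * ‖x‖ := by
    intro x hx
    have := hlip x 0 hx (by simpa using (norm_nonneg x).trans hx)
    simpa [h0] using this
  refine ⟨max B 0, le_max_right _ _, hlip, hgrad, fun x hx => ?_⟩
  have := (convex_closedBall (0 : Euc n) ‖x‖).norm_image_sub_le_of_norm_hasFDerivWithin_le
    (f := V) (C := max B 0 * ‖x‖) (x := 0) (y := x)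
    (fun z _ => (hasGradientAt_of_contDiff hV z).hasFDerivAt.hasFDerivWithinAt)
    (fun z hz => by
      rw [LinearIsometryEquiv.norm_map]
      rw [mem_closedBall_zero_iff] at hz
      exact (hgrad z (hz.trans hx)).trans (by gcongr)) (by simp) (by simp)
  simp only [hV0, sub_zero, Real.norm_eq_abs] at this
  calc |V x| ≤ _ := this
    _ = _ := by ring

lemma exists_potential_lower_bound (hV : ContDiff ℝ 2 V) (hco : HCoerc V) :
    ∃ B : ℝ, ∀ x, -B ≤ V x := by
  obtain ⟨ε, hε, R, hR⟩ := hco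
  set R' := max R 0
  have hc : IsCompact (Metric.closedBall (0 : Euc n) R') := isCompact_closedBall 0 R'
  obtain ⟨B, hB⟩ := hc.exists_bound_of_continuousOn hV.continuous.continuousOn
  have hball : ∀ x : Euc n, ‖x‖ ≤ R' → -B ≤ V x := fun x hx =>
    (abs_le.1 (hB x (by simpa using hx))).1
  refine ⟨B, fun x => ?_⟩
  rcases le_or_gt ‖x‖ R' with hx | hx
  · exact hball x hx
  have hxpos : 0 < ‖x‖ := (le_max_right R 0).trans_lt hx
  set m : Euc n := (R' / ‖x‖) • x
  have hθ1 : R' / ‖x‖ < 1 := (div_lt_one hxpos).2 hx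
  have hθ0 : 0 ≤ R' / ‖x‖ := div_nonneg (le_max_right _ _) hxpos.le
  refine (hball m ?_).trans (potential_ge_of_inner_gradient_nonneg hV fun s hs => ?_)
  · simp only [m, norm_smul, Real.norm_eq_abs, abs_of_nonneg hθ0]
    exact (div_mul_cancel₀ _ hxpos.ne').le
  · set θ := R' / ‖x‖
    have e1 : x - m = (1 - θ) • x := by rw [sub_smul, one_smul]
    have e2 : m + s • (x - m) = (θ + s * (1 - θ)) • x := by
      rw [e1]; change θ • x + s • ((1 - θ) • x) = _; module
    have hpos : 0 ≤ θ + s * (1 - θ) := by nlinarith [hs.1]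
    have hpos' : 0 < θ + s * (1 - θ) := by nlinarith [hs.1]
    have h1 := hR ((θ + s * (1 - θ)) • x) (by
      rw [norm_smul, Real.norm_eq_abs, abs_of_nonneg hpos]
      have : θ * ‖x‖ = R' := div_mul_cancel₀ _ hxpos.ne'
      have h2 : R ≤ R' := le_max_left _ _
      have h3 : 0 ≤ s * (1 - θ) * ‖x‖ := by
        have := hs.1.le
        have : 0 ≤ 1 - θ := by linarith
        positivity
      nlinarith)
    have h2 : 0 ≤ ⟪(θ + s * (1 - θ)) • x, gradient V ((θ + s * (1 - θ)) • x)⟫ :=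
      le_trans (by positivity) h1
    rw [e2, e1, real_inner_smul_left]
    rw [real_inner_smul_left] at h2
    exact mul_nonneg (by linarith) (nonneg_of_mul_nonneg_right h2 hpos')

lemma qHull_mul_le (hV : ContDiff ℝ 2 V) (hco : HCoerc V) (D : EscData n V)
    (h0 : (0 : Euc n) ∈ MinSet V) (hV0 : V 0 = 0) (x : Euc n) :
    qHull V * ‖x‖ ^ 2 ≤ V x := by
  rcases eq_or_ne x 0 with rfl | hx
  · simp [hV0]
  obtain ⟨B, hB⟩ := exists_potential_lower_bound hV hco
  obtain ⟨ε, hε, R, hR⟩ := hco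
  have hc : IsCompact (Metric.closedBall (0 : Euc n) (max R 0)) := isCompact_closedBall 0 _
  obtain ⟨B', hB'⟩ := hc.exists_bound_of_continuousOn hV.continuous.continuousOn
  have hmin : ∀ m ∈ MinSet V, V m ≤ B' := by
    intro m hm
    refine (abs_le.1 (hB' m ?_)).2
    rw [mem_closedBall_zero_iff]
    by_contra! hlt
    have h1 := hR m ((le_max_left _ _).trans hlt.le)
    rw [hm.1, inner_zero_right] at h1
    have h2 : 0 < ‖m‖ := (le_max_right _ _).trans_lt hlt
    have : 0 < ε * ‖m‖ ^ 2 := by positivity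
    linarith
  have hBB : 0 ≤ B + B' := by
    have h1 := hB 0
    have h2 := hmin 0 h0
    linarith
  have hbdd : BddBelow {q : ℝ | ∃ m ∈ MinSet V, ∃ x : Euc n, x ≠ m ∧
      q = (V x - V m) / ‖x - m‖ ^ 2} := by
    refine ⟨-((B + B') / D.dEsc ^ 2), ?_⟩
    rintro q ⟨m, hm, z, hz, rfl⟩
    have hd := D.dEsc_pos
    have hp : 0 < ‖z - m‖ := norm_pos_iff.2 (sub_ne_zero.2 hz)
    rcases le_or_gt ‖z - m‖ D.dEsc with h | h
    · have := D.potential_ge hV hm h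
      have h1 : 0 ≤ (V z - V m) / ‖z - m‖ ^ 2 := by
        apply div_nonneg <;> [linarith; positivity]
      have h2 : 0 ≤ (B + B') / D.dEsc ^ 2 := by positivity
      linarith
    · have h1 : -(B + B') ≤ V z - V m := by linarith [hB z, hmin m hm]
      calc -((B + B') / D.dEsc ^ 2) ≤ -((B + B') / ‖z - m‖ ^ 2) := by
            gcongr
        _ = -(B + B') / ‖z - m‖ ^ 2 := by ring
        _ ≤ _ := by gcongr
  have hle : qHull V ≤ V x / ‖x‖ ^ 2 :=
    csInf_le hbdd ⟨0, h0, x, hx, by simp [hV0]⟩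
  have hp : 0 < ‖x‖ ^ 2 := by positivity
  exact (le_div_iff₀ hp).1 hle

lemma wV_pos (V : Euc n → ℝ) : 0 < wV V := by
  unfold wV; positivity

lemma wV_le_one (V : Euc n → ℝ) : wV V ≤ 1 := by
  unfold wV
  rw [div_le_one (by positivity)]
  exact le_max_left _ _

/-- Coercivity of the integrand of the firewall functional. -/
lemma firewall_integrand_ge {V : Euc n → ℝ} (hV : ContDiff ℝ 2 V) (hco : HCoerc V)
    (D : EscData n V) (h0 : (0 : Euc n) ∈ MinSet V) (hV0 : V 0 = 0) (x p : Euc n) :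
    min (wV V / 2) (1 / 4) * (‖x‖ ^ 2 + ‖p‖ ^ 2) ≤
      wV V * (‖p‖ ^ 2 / 2 + V x) + ‖x‖ ^ 2 / 2 := by
  have hq := qHull_mul_le hV hco D h0 hV0 x
  have hw := wV_pos V
  have h1 : -(1 / 4) ≤ wV V * qHull V := by
    have h2 : wV V * max 1 (-(4 * qHull V)) = 1 := by
      unfold wV; rw [one_div_mul_cancel]; positivity
    have h3 := mul_le_mul_of_nonneg_left (le_max_right 1 (-(4 * qHull V))) hw.le
    rw [h2] at h3
    linarith
  have h2 : -(1 / 4) * ‖x‖ ^ 2 ≤ wV V * V x := by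
    calc -(1 / 4) * ‖x‖ ^ 2 ≤ wV V * qHull V * ‖x‖ ^ 2 := by gcongr
      _ = wV V * (qHull V * ‖x‖ ^ 2) := by ring
      _ ≤ _ := by gcongr
  have h3 : min (wV V / 2) (1 / 4) * ‖x‖ ^ 2 ≤ 1 / 4 * ‖x‖ ^ 2 := by
    gcongr; exact min_le_right _ _
  have h4 : min (wV V / 2) (1 / 4) * ‖p‖ ^ 2 ≤ wV V / 2 * ‖p‖ ^ 2 := by
    gcongr; exact min_le_left _ _
  linarith

end Potential

section Regularity

variable {d : ℕ} {V : Euc n → ℝ} {u : ℝ → ℝ → Euc n} {C : ℝ}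

/-- A common bound for a function of `(r, t)` and its partial derivatives. -/
def UniformlyBounded (u : ℝ → ℝ → Euc n) (C : ℝ) : Prop :=
  ∀ r t : ℝ, 0 ≤ r → 0 < t → ‖u r t‖ + ‖ur u r t‖ + ‖urr u r t‖ + ‖ut u r t‖ ≤ C

namespace UniformlyBounded

lemma norm_le (hC : UniformlyBounded u C) {r t : ℝ} (hr : 0 ≤ r) (ht : 0 < t) : ‖u r t‖ ≤ C := by
  linarith [hC r t hr ht, norm_nonneg (ur u r t), norm_nonneg (urr u r t), norm_nonneg (ut u r t)]

lemma ur_le (hC : UniformlyBounded u C) {r t : ℝ} (hr : 0 ≤ r) (ht : 0 < t) :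
    ‖ur u r t‖ ≤ C := by
  linarith [hC r t hr ht, norm_nonneg (u r t), norm_nonneg (urr u r t), norm_nonneg (ut u r t)]

lemma urr_le (hC : UniformlyBounded u C) {r t : ℝ} (hr : 0 ≤ r) (ht : 0 < t) :
    ‖urr u r t‖ ≤ C := by
  linarith [hC r t hr ht, norm_nonneg (ur u r t), norm_nonneg (u r t), norm_nonneg (ut u r t)]

lemma ut_le (hC : UniformlyBounded u C) {r t : ℝ} (hr : 0 ≤ r) (ht : 0 < t) :
    ‖ut u r t‖ ≤ C := by
  linarith [hC r t hr ht, norm_nonneg (ur u r t), norm_nonneg (urr u r t), norm_nonneg (u r t)]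

lemma nonneg (hC : UniformlyBounded u C) : 0 ≤ C :=
  (norm_nonneg _).trans (hC.norm_le le_rfl one_pos)

end UniformlyBounded

namespace IsRadialSolution

lemma hasDerivAt_r (hu : IsRadialSolution d V u) {t : ℝ} (ht : 0 < t) (r : ℝ) :
    HasDerivAt (fun s => u s t) (ur u r t) r := (hu.diff_r t ht r).hasDerivAt

lemma hasDerivAt_rr (hu : IsRadialSolution d V u) {t : ℝ} (ht : 0 < t) (r : ℝ) :
    HasDerivAt (fun s => ur u s t) (urr u r t) r := (hu.diff_rr t ht r).hasDerivAt

lemma hasDerivAt_t (hu : IsRadialSolution d V u) {t : ℝ} (ht : 0 < t) (r : ℝ) :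
    HasDerivAt (fun s => u r s) (ut u r t) t := (hu.diff_t t ht r).hasDerivAt

lemma continuous_r (hu : IsRadialSolution d V u) {t : ℝ} (ht : 0 < t) :
    Continuous fun r => u r t :=
  continuous_iff_continuousAt.2 fun r => (hu.hasDerivAt_r ht r).continuousAt

lemma continuous_ur (hu : IsRadialSolution d V u) {t : ℝ} (ht : 0 < t) :
    Continuous fun r => ur u r t :=
  continuous_iff_continuousAt.2 fun r => (hu.hasDerivAt_rr ht r).continuousAt

lemma lipschitz_r (hu : IsRadialSolution d V u) (hC : UniformlyBounded u C) {t r s : ℝ}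
    (ht : 0 < t) (hr : 0 ≤ r) (hs : 0 ≤ s) : ‖u r t - u s t‖ ≤ C * |r - s| :=
  (convex_Ici (0 : ℝ)).norm_image_sub_le_of_norm_hasDerivWithin_le
    (fun x _ => (hu.hasDerivAt_r ht x).hasDerivWithinAt) (fun _ hx => hC.ur_le hx ht) hs hr

lemma lipschitz_ur (hu : IsRadialSolution d V u) (hC : UniformlyBounded u C) {t r s : ℝ}
    (ht : 0 < t) (hr : 0 ≤ r) (hs : 0 ≤ s) : ‖ur u r t - ur u s t‖ ≤ C * |r - s| :=
  (convex_Ici (0 : ℝ)).norm_image_sub_le_of_norm_hasDerivWithin_le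
    (fun x _ => (hu.hasDerivAt_rr ht x).hasDerivWithinAt) (fun _ hx => hC.urr_le hx ht) hs hr

lemma lipschitz_t (hu : IsRadialSolution d V u) (hC : UniformlyBounded u C) {r t s : ℝ}
    (hr : 0 ≤ r) (ht : 0 < t) (hs : 0 < s) : ‖u r t - u r s‖ ≤ C * |t - s| :=
  (convex_Ioi (0 : ℝ)).norm_image_sub_le_of_norm_hasDerivWithin_le
    (fun _ hx => (hu.hasDerivAt_t hx r).hasDerivWithinAt) (fun _ hx => hC.ut_le hr hx) hs ht

lemma ur_le_mul (hu : IsRadialSolution d V u) (hC : UniformlyBounded u C) {t r : ℝ}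
    (ht : 0 < t) (hr : 0 ≤ r) : ‖ur u r t‖ ≤ C * r := by
  have := hu.lipschitz_ur hC ht hr le_rfl
  rwa [hu.neumann t ht, sub_zero, sub_zero, abs_of_nonneg hr] at this

/-- The curvature term is bounded, and small far from the origin. -/
lemma curvature_le (hu : IsRadialSolution d V u) (hC : UniformlyBounded u C) {t r : ℝ}
    (ht : 0 < t) (hr : 0 < r) :
    ‖(((d : ℝ) - 1) / r) • ur u r t‖ ≤ 2 * |(d : ℝ) - 1| * C / (1 + r) := by
  have h0 := hC.nonneg
  have key : ‖ur u r t‖ * (1 + r) ≤ 2 * C * r := by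
    have h1 := hC.ur_le hr.le ht
    have h2 := hu.ur_le_mul hC ht hr.le
    nlinarith [norm_nonneg (ur u r t)]
  rw [norm_smul, Real.norm_eq_abs, abs_div, abs_of_pos hr, div_mul_eq_mul_div,
    div_le_div_iff₀ hr (by linarith)]
  nlinarith [mul_le_mul_of_nonneg_left key (abs_nonneg ((d : ℝ) - 1))]

lemma taylor_r (hu : IsRadialSolution d V u) (hC : UniformlyBounded u C) {t r h : ℝ}
    (ht : 0 < t) (hr : 0 ≤ r) (hh : 0 ≤ h) :
    ‖u (r + h) t - u r t - h • ur u r t‖ ≤ C * h * h := by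
  have hd : ∀ x : ℝ, HasDerivAt (fun s => u s t - s • ur u r t) (ur u x t - ur u r t) x := by
    intro x
    have h1 : HasDerivAt (fun s : ℝ => s • ur u r t) (ur u r t) x := by
      simpa using (hasDerivAt_id x).smul_const (ur u r t)
    exact (hu.hasDerivAt_r ht x).fun_sub h1
  have := (convex_Icc r (r + h)).norm_image_sub_le_of_norm_hasDerivWithin_le
    (f := fun s => u s t - s • ur u r t) (C := C * h)
    (fun x _ => (hd x).hasDerivWithinAt) (fun x hx => by
      refine (hu.lipschitz_ur hC ht (hr.trans hx.1) hr).trans ?_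
      rw [abs_of_nonneg (by linarith [hx.1])]
      exact mul_le_mul_of_nonneg_left (by linarith [hx.2]) hC.nonneg)
    (left_mem_Icc.2 (by linarith)) (right_mem_Icc.2 (by linarith))
  have e : u (r + h) t - (r + h) • ur u r t - (u r t - r • ur u r t) =
      u (r + h) t - u r t - h • ur u r t := by module
  simpa only [e, add_sub_cancel_left, Real.norm_eq_abs, abs_of_nonneg hh] using this

/-- The space derivative is Hölder continuous in time. -/
lemma holder_ur_t (hu : IsRadialSolution d V u) (hC : UniformlyBounded u C) {r t s : ℝ}
    (hr : 0 ≤ r) (ht : 0 < t) (hs : 0 < s) :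
    ‖ur u r t - ur u r s‖ ≤ 4 * C * Real.sqrt |t - s| := by
  rcases eq_or_ne t s with rfl | hne
  · simp
  set h := Real.sqrt |t - s| with hh
  have hpos : 0 < h := Real.sqrt_pos.2 (abs_pos.2 (sub_ne_zero.2 hne))
  have hsq : |t - s| = h * h := (Real.mul_self_sqrt (abs_nonneg _)).symm
  have h1 := hu.taylor_r hC ht hr hpos.le
  have h2 := hu.taylor_r hC hs hr hpos.le
  have h3 := hu.lipschitz_t hC (by linarith : (0 : ℝ) ≤ r + h) ht hs
  have h4 := hu.lipschitz_t hC hr ht hs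
  rw [hsq] at h3 h4
  have e : h • (ur u r t - ur u r s) = (u (r + h) t - u (r + h) s) - (u r t - u r s)
      - (u (r + h) t - u r t - h • ur u r t) + (u (r + h) s - u r s - h • ur u r s) := by module
  have h5 : ‖h • (ur u r t - ur u r s)‖ ≤
      C * (h * h) + C * (h * h) + C * h * h + C * h * h := by
    rw [e]
    refine (norm_add_le _ _).trans (add_le_add ((norm_sub_le _ _).trans
      (add_le_add ((norm_sub_le _ _).trans (add_le_add h3 h4)) h1)) h2)
  rw [norm_smul, Real.norm_eq_abs, abs_of_pos hpos] at h5
  exact le_of_mul_le_mul_left (by linarith) hpos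

lemma continuousAt_ur_t (hu : IsRadialSolution d V u) (hC : UniformlyBounded u C) {r t : ℝ}
    (hr : 0 ≤ r) (ht : 0 < t) : ContinuousAt (fun s => ur u r s) t := by
  have h1 : Tendsto (fun s => 4 * C * Real.sqrt |s - t|) (𝓝 t) (𝓝 0) := by
    have : Continuous fun s => 4 * C * Real.sqrt |s - t| := by fun_prop
    simpa using this.tendsto t
  refine tendsto_iff_norm_sub_tendsto_zero.2 (squeeze_zero' ?_ ?_ h1)
  · exact Eventually.of_forall fun s => norm_nonneg _
  · filter_upwards [lt_mem_nhds ht] with s hs using hu.holder_ur_t hC hr hs ht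

lemma urr_eq (hu : IsRadialSolution d V u) {r t : ℝ} (hr : 0 < r) (ht : 0 < t) :
    urr u r t = ut u r t + gradient V (u r t) - (((d : ℝ) - 1) / r) • ur u r t := by
  rw [hu.pde r hr t ht]; abel

lemma continuousAt_ut_t (hu : IsRadialSolution d V u) {t : ℝ} (r : ℝ) (ht : 0 < t) :
    ContinuousAt (fun s => ut u r s) t :=
  (hu.cont_t r).continuousAt (Ioi_mem_nhds ht)

lemma continuousAt_urr_t (hu : IsRadialSolution d V u) (hV : ContDiff ℝ 2 V)
    (hC : UniformlyBounded u C) {r t : ℝ} (hr : 0 < r) (ht : 0 < t) :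
    ContinuousAt (fun s => urr u r s) t := by
  have hc : ContinuousAt (fun s => (((d : ℝ) - 1) / r) • ur u r s) t :=
    (continuousAt_const (y := ((d : ℝ) - 1) / r)).smul (hu.continuousAt_ur_t hC hr.le ht)
  have h : ContinuousAt (fun s => ut u r s + gradient V (u r s)
      - (((d : ℝ) - 1) / r) • ur u r s) t :=
    ((hu.continuousAt_ut_t r ht).add ((contDiff_gradient hV).continuous.continuousAt.comp
      (hu.hasDerivAt_t ht r).continuousAt)).sub hc
  refine h.congr ?_
  filter_upwards [lt_mem_nhds ht] with s hs using (hu.urr_eq hr hs).symm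

lemma continuousOn_ut_r (hu : IsRadialSolution d V u) (hV : ContDiff ℝ 2 V) {t : ℝ}
    (ht : 0 < t) : ContinuousOn (fun r => ut u r t) (Ioi 0) := by
  have h : ContinuousOn (fun r => -gradient V (u r t) + (((d : ℝ) - 1) / r) • ur u r t
      + urr u r t) (Ioi 0) := by
    refine ContinuousOn.add (ContinuousOn.add ?_ ?_) (hu.cont_rr t ht).continuousOn
    · exact ((contDiff_gradient hV).continuous.comp (hu.continuous_r ht)).neg.continuousOn
    · have h1 : ContinuousOn (fun r : ℝ => ((d : ℝ) - 1) / r) (Ioi 0) :=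
        continuousOn_const.div continuousOn_id fun x hx => ne_of_gt hx
      exact h1.smul (hu.continuous_ur ht).continuousOn
  exact h.congr fun r hr => hu.pde r hr t ht

lemma measurableSet_Sigma0 (hu : IsRadialSolution d V u) {t : ℝ} (ht : 0 < t) (R : ℝ) :
    MeasurableSet (Sigma0 u R t) := by
  have h1 : IsOpen {r | R < ‖u r t‖} := isOpen_lt continuous_const (hu.continuous_r ht).norm
  exact measurableSet_Ici.inter h1.measurableSet

end IsRadialSolution

end Regularity

section Weight

/-- The logistic function of rate `κ`. -/
def logistic (κ z : ℝ) : ℝ := Real.exp (κ * z) / (1 + Real.exp (κ * z))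

/-- A smooth weight, equivalent to `exp (a z)` at `-∞` and to `exp (-κ z)` at `+∞`. -/
def weight (a κ z : ℝ) : ℝ :=
  Real.exp (a * z - (a + κ) / κ * Real.log (1 + Real.exp (κ * z)))

/-- The derivative of `weight`. -/
def weightDeriv (a κ z : ℝ) : ℝ := (a - (a + κ) * logistic κ z) * weight a κ z

/-- The second derivative of `weight`. -/
def weightDeriv₂ (a κ z : ℝ) : ℝ :=
  ((a - (a + κ) * logistic κ z) ^ 2 - (a + κ) * κ * (logistic κ z * (1 - logistic κ z))) *
    weight a κ z

variable {a κ z : ℝ}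

lemma logistic_nonneg (κ z : ℝ) : 0 ≤ logistic κ z := by unfold logistic; positivity

lemma logistic_le_one (κ z : ℝ) : logistic κ z ≤ 1 := by
  unfold logistic; rw [div_le_one (by positivity)]; linarith

lemma hasDerivAt_logistic (κ z : ℝ) :
    HasDerivAt (logistic κ) (κ * (logistic κ z * (1 - logistic κ z))) z := by
  have h1 : HasDerivAt (fun z => Real.exp (κ * z)) (Real.exp (κ * z) * κ) z := by
    simpa using ((hasDerivAt_id z).const_mul κ).exp
  have hne : 1 + Real.exp (κ * z) ≠ 0 := by positivity
  refine (h1.fun_div (h1.const_add 1) hne).congr_deriv ?_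
  unfold logistic
  field_simp

lemma weight_pos (a κ z : ℝ) : 0 < weight a κ z := Real.exp_pos _

lemma hasDerivAt_weight (hκ : 0 < κ) (a z : ℝ) :
    HasDerivAt (weight a κ) (weightDeriv a κ z) z := by
  have h1 : HasDerivAt (fun z => Real.exp (κ * z)) (Real.exp (κ * z) * κ) z := by
    simpa using ((hasDerivAt_id z).const_mul κ).exp
  have hne : 1 + Real.exp (κ * z) ≠ 0 := by positivity
  have h2 := ((h1.const_add 1).log hne).const_mul ((a + κ) / κ)
  have h3 : HasDerivAt (fun z => a * z) a z := by simpa using (hasDerivAt_id z).const_mul a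
  refine (h3.fun_sub h2).exp.congr_deriv ?_
  unfold weightDeriv weight logistic
  rw [mul_comm]
  congr 1
  field_simp

lemma hasDerivAt_weightDeriv (hκ : 0 < κ) (a z : ℝ) :
    HasDerivAt (weightDeriv a κ) (weightDeriv₂ a κ z) z := by
  have h1 := ((hasDerivAt_logistic κ z).const_mul (a + κ)).const_sub a
  refine (h1.fun_mul (hasDerivAt_weight hκ a z)).congr_deriv ?_
  unfold weightDeriv₂ weightDeriv
  ring

lemma continuous_weight (hκ : 0 < κ) (a : ℝ) : Continuous (weight a κ) :=
  continuous_iff_continuousAt.2 fun z => (hasDerivAt_weight hκ a z).continuousAt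

lemma continuous_weightDeriv (hκ : 0 < κ) (a : ℝ) : Continuous (weightDeriv a κ) :=
  continuous_iff_continuousAt.2 fun z => (hasDerivAt_weightDeriv hκ a z).continuousAt

lemma continuous_weightDeriv₂ (hκ : 0 < κ) (a : ℝ) : Continuous (weightDeriv₂ a κ) := by
  have h1 : Continuous (logistic κ) :=
    continuous_iff_continuousAt.2 fun z => (hasDerivAt_logistic κ z).continuousAt
  have h2 := continuous_weight hκ a
  unfold weightDeriv₂
  fun_prop

lemma abs_weightDeriv_le (ha : 0 < a) (hκ : 0 < κ) (z : ℝ) :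
    |weightDeriv a κ z| ≤ (a + κ) * weight a κ z := by
  unfold weightDeriv
  rw [abs_mul, abs_of_pos (weight_pos a κ z)]
  refine mul_le_mul_of_nonneg_right (abs_le.2 ⟨?_, ?_⟩) (weight_pos a κ z).le <;>
  nlinarith [logistic_nonneg κ z, logistic_le_one κ z]

lemma abs_weightDeriv₂_le (ha : 0 < a) (hκ : 0 < κ) (z : ℝ) :
    |weightDeriv₂ a κ z| ≤ 2 * (a + κ) ^ 2 * weight a κ z := by
  unfold weightDeriv₂
  rw [abs_mul, abs_of_pos (weight_pos a κ z)]
  refine mul_le_mul_of_nonneg_right ?_ (weight_pos a κ z).le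
  have h0 := logistic_nonneg κ z
  have h1 := logistic_le_one κ z
  have h2 : (a - (a + κ) * logistic κ z) ^ 2 ≤ (a + κ) ^ 2 := by
    apply sq_le_sq' <;> nlinarith
  have h3 : logistic κ z * (1 - logistic κ z) ≤ 1 := by nlinarith
  have h3' : 0 ≤ logistic κ z * (1 - logistic κ z) := mul_nonneg h0 (by linarith)
  have h4 : (a + κ) * κ ≤ (a + κ) ^ 2 := by nlinarith
  have h5 : 0 ≤ (a + κ) * κ := by positivity
  rw [abs_le]
  constructor <;> nlinarith [sq_nonneg (a - (a + κ) * logistic κ z), mul_nonneg h5 h3',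
    mul_le_mul_of_nonneg_left h3 h5]

/-- Defect of `weight` with respect to the formal adjoint of the drift operator. -/
lemma weightDeriv₂_sub_le {c : ℝ} (hc : 0 < c) (hκ : 0 < κ) (ha : a = c ∨ a = c + κ) (z : ℝ) :
    weightDeriv₂ a κ z - c * weightDeriv a κ z ≤ κ * (c + κ) * weight a κ z := by
  have h0 := logistic_nonneg κ z
  have h1 := logistic_le_one κ z
  unfold weightDeriv₂ weightDeriv
  set s := logistic κ z
  have key : (a - (a + κ) * s) ^ 2 - (a + κ) * κ * (s * (1 - s)) - c * (a - (a + κ) * s) ≤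
      κ * (c + κ) := by
    have h2 : 0 ≤ s * (1 - s) := mul_nonneg h0 (by linarith)
    rcases ha with rfl | rfl
    · have h3 : 0 ≤ (a + κ) * κ * (1 - s) :=
        mul_nonneg (by positivity) (by linarith)
      have h4 : 0 ≤ (a + κ) * (a + 2 * κ) * (s * (1 - s)) := by positivity
      nlinarith
    · have h4 : 0 ≤ (c + 2 * κ) * (c + 2 * κ) * (s * (1 - s)) := by positivity
      have h5 : 0 ≤ (c + 2 * κ) * κ * (s * (1 - s)) := by positivity
      nlinarith
  nlinarith [mul_le_mul_of_nonneg_right key (weight_pos a κ z).le]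

lemma weight_add_kappa (hκ : 0 < κ) (a z : ℝ) :
    weight (a + κ) κ z = logistic κ z * weight a κ z := by
  unfold weight logistic
  have h : 0 < 1 + Real.exp (κ * z) := by positivity
  have e : Real.exp (κ * z) / (1 + Real.exp (κ * z)) =
      Real.exp (κ * z - Real.log (1 + Real.exp (κ * z))) := by
    rw [Real.exp_sub, Real.exp_log h]
  rw [e, ← Real.exp_add]
  congr 1
  field_simp
  ring

lemma mul_weight_sub_weightDeriv (hκ : 0 < κ) (c z : ℝ) :
    c * weight c κ z - weightDeriv c κ z = (c + κ) * weight (c + κ) κ z := by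
  rw [weight_add_kappa hκ]; unfold weightDeriv; ring

lemma weight_le_exp_mul (ha : 0 < a) (hκ : 0 < κ) (z : ℝ) : weight a κ z ≤ Real.exp (a * z) := by
  unfold weight
  rw [Real.exp_le_exp]
  have h : 0 ≤ Real.log (1 + Real.exp (κ * z)) :=
    Real.log_nonneg (by linarith [Real.exp_pos (κ * z)])
  have : 0 ≤ (a + κ) / κ * Real.log (1 + Real.exp (κ * z)) := by positivity
  linarith

lemma weight_le_exp_neg (ha : 0 < a) (hκ : 0 < κ) (z : ℝ) :
    weight a κ z ≤ Real.exp (-κ * z) := by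
  unfold weight
  rw [Real.exp_le_exp]
  have h : κ * z ≤ Real.log (1 + Real.exp (κ * z)) := by
    rw [Real.le_log_iff_exp_le (by positivity)]; linarith
  have h2 := mul_le_mul_of_nonneg_left h (by positivity : 0 ≤ (a + κ) / κ)
  have h3 : (a + κ) / κ * (κ * z) = (a + κ) * z := by field_simp
  linarith

lemma exp_mul_le_weight (ha : 0 < a) (hκ : 0 < κ) (hz : z ≤ 0) :
    Real.exp (-((a + κ) / κ * Real.log 2)) * Real.exp (a * z) ≤ weight a κ z := by
  unfold weight
  rw [← Real.exp_add, Real.exp_le_exp]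
  have h : Real.log (1 + Real.exp (κ * z)) ≤ Real.log 2 := by
    apply Real.log_le_log (by positivity)
    have : Real.exp (κ * z) ≤ 1 := Real.exp_le_one_iff.2 (by nlinarith)
    linarith
  have h2 := mul_le_mul_of_nonneg_left h (by positivity : 0 ≤ (a + κ) / κ)
  linarith

lemma weight_add_le (ha : 0 < a) (hκ : 0 < κ) (z x : ℝ) :
    weight a κ (z + x) ≤ Real.exp ((a + κ) * |x|) * weight a κ z := by
  have hlog : Real.log (1 + Real.exp (κ * z)) - κ * max (-x) 0 ≤
      Real.log (1 + Real.exp (κ * (z + x))) := by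
    rw [Real.le_log_iff_exp_le (by positivity), Real.exp_sub, Real.exp_log (by positivity),
      div_le_iff₀ (Real.exp_pos _)]
    have h1 : 1 ≤ Real.exp (κ * max (-x) 0) := Real.one_le_exp (by positivity)
    have h2 : Real.exp (κ * z) ≤ Real.exp (κ * (z + x)) * Real.exp (κ * max (-x) 0) := by
      rw [← Real.exp_add, Real.exp_le_exp]
      nlinarith [le_max_left (-x) 0]
    nlinarith [Real.exp_pos (κ * (z + x))]
  unfold weight
  rw [← Real.exp_add, Real.exp_le_exp]
  have h2 := mul_le_mul_of_nonneg_left hlog (by positivity : 0 ≤ (a + κ) / κ)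
  have h3 : (a + κ) / κ * (κ * max (-x) 0) = (a + κ) * max (-x) 0 := by field_simp
  rcases le_total x 0 with hx | hx
  · rw [max_eq_left (by linarith)] at h2 h3
    rw [abs_of_nonpos hx]
    nlinarith
  · rw [max_eq_right (by linarith)] at h2 h3
    rw [abs_of_nonneg hx]
    nlinarith

lemma integral_exp_mul_sub_Iic (ha : 0 < a) (β x : ℝ) :
    IntegrableOn (fun r => Real.exp (a * (r - β))) (Iic x) ∧
      ∫ r in Iic x, Real.exp (a * (r - β)) = Real.exp (a * (x - β)) / a := by
  have e : (fun r => Real.exp (a * (r - β))) =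
      fun r => Real.exp (-(a * β)) * Real.exp (a * r) := by
    ext r; rw [← Real.exp_add]; ring_nf
  rw [e]
  refine ⟨(integrableOn_exp_mul_Iic ha x).const_mul _, ?_⟩
  rw [integral_const_mul, integral_exp_mul_Iic ha, ← mul_div_assoc, ← Real.exp_add]
  ring_nf

lemma integral_exp_neg_sub_Ioi (hκ : 0 < κ) (β x : ℝ) :
    IntegrableOn (fun r => Real.exp (-κ * (r - β))) (Ioi x) ∧
      ∫ r in Ioi x, Real.exp (-κ * (r - β)) = Real.exp (-κ * (x - β)) / κ := by
  have e : (fun r => Real.exp (-κ * (r - β))) =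
      fun r => Real.exp (κ * β) * Real.exp (-κ * r) := by
    ext r; rw [← Real.exp_add]; ring_nf
  rw [e]
  refine ⟨(integrableOn_exp_mul_Ioi (by linarith) x).const_mul _, ?_⟩
  rw [integral_const_mul, integral_exp_mul_Ioi (by linarith), neg_div_neg_eq, ← mul_div_assoc,
    ← Real.exp_add]
  ring_nf

lemma continuous_weight_sub (hκ : 0 < κ) (a β : ℝ) : Continuous fun r => weight a κ (r - β) :=
  (continuous_weight hκ a).comp (by fun_prop)

lemma integral_weight_Iic (ha : 0 < a) (hκ : 0 < κ) (β x : ℝ) :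
    IntegrableOn (fun r => weight a κ (r - β)) (Iic x) ∧
      ∫ r in Iic x, weight a κ (r - β) ≤ Real.exp (a * (x - β)) / a := by
  obtain ⟨h1, h2⟩ := integral_exp_mul_sub_Iic ha β x
  have h3 : IntegrableOn (fun r => weight a κ (r - β)) (Iic x) :=
    h1.mono' (continuous_weight_sub hκ a β).aestronglyMeasurable
      (Eventually.of_forall fun r => by
        rw [Real.norm_eq_abs, abs_of_pos (weight_pos _ _ _)]
        exact weight_le_exp_mul ha hκ _)
  exact ⟨h3, h2 ▸ integral_mono h3 h1 fun r => weight_le_exp_mul ha hκ _⟩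

lemma integral_weight_Ioi (ha : 0 < a) (hκ : 0 < κ) (β x : ℝ) :
    IntegrableOn (fun r => weight a κ (r - β)) (Ioi x) ∧
      ∫ r in Ioi x, weight a κ (r - β) ≤ Real.exp (-κ * (x - β)) / κ := by
  obtain ⟨h1, h2⟩ := integral_exp_neg_sub_Ioi hκ β x
  have h3 : IntegrableOn (fun r => weight a κ (r - β)) (Ioi x) :=
    h1.mono' (continuous_weight_sub hκ a β).aestronglyMeasurable
      (Eventually.of_forall fun r => by
        rw [Real.norm_eq_abs, abs_of_pos (weight_pos _ _ _)]
        exact weight_le_exp_neg ha hκ _)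
  exact ⟨h3, h2 ▸ integral_mono h3 h1 fun r => weight_le_exp_neg ha hκ _⟩

lemma integrable_weight (ha : 0 < a) (hκ : 0 < κ) (β : ℝ) :
    Integrable fun r => weight a κ (r - β) := by
  rw [← integrableOn_univ, ← Iic_union_Ioi (a := (0 : ℝ))]
  exact (integral_weight_Iic ha hκ β 0).1.union (integral_weight_Ioi ha hκ β 0).1

lemma integral_weight_le (ha : 0 < a) (hκ : 0 < κ) (β : ℝ) (s : Set ℝ) :
    ∫ r in s, weight a κ (r - β) ≤ 1 / a + 1 / κ := by
  have hint := integrable_weight ha hκ β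
  have h0 : 0 ≤ᵐ[volume] fun r => weight a κ (r - β) :=
    Eventually.of_forall fun r => (weight_pos a κ _).le
  calc ∫ r in s, weight a κ (r - β) ≤ ∫ r, weight a κ (r - β) :=
        setIntegral_le_integral hint h0
    _ = (∫ r in Iic β, weight a κ (r - β)) + ∫ r in Ioi β, weight a κ (r - β) :=
        (intervalIntegral.integral_Iic_add_Ioi hint.integrableOn hint.integrableOn).symm
    _ ≤ _ := by
      have h1 := (integral_weight_Iic ha hκ β β).2
      have h2 := (integral_weight_Ioi ha hκ β β).2
      simp only [sub_self, mul_zero, Real.exp_zero] at h1 h2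
      exact add_le_add h1 h2

/-- Mass of the weight far from the centre. -/
lemma integral_weight_of_subset (ha : 0 < a) (hκ : 0 < κ) {β x y : ℝ} {s : Set ℝ}
    (hs : s ⊆ Iic x ∪ Ioi y) :
    ∫ r in s, weight a κ (r - β) ≤ Real.exp (a * (x - β)) / a + Real.exp (-κ * (y - β)) / κ := by
  have hint := integrable_weight ha hκ β
  have h0 : ∀ t : Set ℝ, 0 ≤ᵐ[volume.restrict t] fun r => weight a κ (r - β) :=
    fun t => Eventually.of_forall fun r => (weight_pos a κ _).le
  calc ∫ r in s, weight a κ (r - β) ≤ ∫ r in Iic x ∪ Ioi y, weight a κ (r - β) :=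
        setIntegral_mono_set hint.integrableOn (h0 _) (Eventually.of_forall hs)
    _ ≤ (∫ r in Iic x, weight a κ (r - β)) + ∫ r in Ioi y, weight a κ (r - β) := by
        rw [← integral_add_measure hint.integrableOn hint.integrableOn]
        refine integral_mono_measure (Measure.restrict_union_le _ _) ?_ ?_
        · exact Eventually.of_forall fun r => (weight_pos a κ _).le
        · exact Integrable.add_measure hint.integrableOn hint.integrableOn
    _ ≤ _ := add_le_add (integral_weight_Iic ha hκ β x).2 (integral_weight_Ioi ha hκ β y).2

lemma integrableOn_weight_div (ha : 0 < a) (hκ : 0 < κ) (β : ℝ) :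
    IntegrableOn (fun r => weight a κ (r - β) / (1 + r)) (Ioi 0) := by
  refine (integrable_weight ha hκ β).integrableOn.mono' ?_ ?_
  · refine ContinuousOn.aestronglyMeasurable ?_ measurableSet_Ioi
    refine (continuous_weight_sub hκ a β).continuousOn.div (by fun_prop) fun r hr => ?_
    have : (0 : ℝ) < r := hr
    positivity
  · refine (ae_restrict_iff' measurableSet_Ioi).2 (Eventually.of_forall fun r hr => ?_)
    have hr' : (0 : ℝ) < r := hr
    rw [Real.norm_eq_abs, abs_of_pos (div_pos (weight_pos _ _ _) (by positivity))]
    exact div_le_self (weight_pos _ _ _).le (by linarith)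

/-- The mean curvature with respect to the weight is small when the centre is far away. -/
lemma integral_weight_div_le (ha : 0 < a) (hκ : 0 < κ) {β : ℝ} (hβ : 0 < β) :
    ∫ r in Ioi 0, weight a κ (r - β) / (1 + r) ≤
      Real.exp (-(a * β / 2)) / a + 2 / β * (1 / a + 1 / κ) := by
  have hint := integrableOn_weight_div (a := a) ha hκ β
  have hw := integrable_weight ha hκ β
  have hsplit : Ioi (0 : ℝ) = Ioc 0 (β / 2) ∪ Ioi (β / 2) :=
    (Ioc_union_Ioi_eq_Ioi (by positivity)).symm
  have hi1 := hint.mono_set (show Ioc 0 (β / 2) ⊆ Ioi (0 : ℝ) from Ioc_subset_Ioi_self)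
  have hi2 := hint.mono_set (show Ioi (β / 2) ⊆ Ioi (0 : ℝ) from Ioi_subset_Ioi (by positivity))
  rw [hsplit, setIntegral_union (by
    rw [Set.disjoint_left]; intro x hx hx'; exact not_lt.2 hx.2 hx') measurableSet_Ioi hi1 hi2]
  refine add_le_add ?_ ?_
  · calc ∫ r in Ioc 0 (β / 2), weight a κ (r - β) / (1 + r)
        ≤ ∫ r in Ioc 0 (β / 2), weight a κ (r - β) :=
          setIntegral_mono_on hi1 hw.integrableOn measurableSet_Ioc fun r hr =>
            div_le_self (weight_pos _ _ _).le (by linarith [hr.1])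
      _ ≤ ∫ r in Iic (β / 2), weight a κ (r - β) :=
          setIntegral_mono_set hw.integrableOn
            (Eventually.of_forall fun r => (weight_pos a κ _).le)
            (Eventually.of_forall fun r hr => hr.2)
      _ ≤ Real.exp (a * (β / 2 - β)) / a := (integral_weight_Iic ha hκ β _).2
      _ = _ := by ring_nf
  · calc ∫ r in Ioi (β / 2), weight a κ (r - β) / (1 + r)
        ≤ ∫ r in Ioi (β / 2), 2 / β * weight a κ (r - β) := by
          refine setIntegral_mono_on hi2 (hw.integrableOn.const_mul _) measurableSet_Ioi
            fun r hr => ?_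
          have hr' : β / 2 < r := hr
          rw [div_le_iff₀ (by linarith), mul_right_comm]
          refine le_mul_of_one_le_left (weight_pos _ _ _).le ?_
          rw [div_mul_eq_mul_div, one_le_div hβ]
          linarith
      _ = 2 / β * ∫ r in Ioi (β / 2), weight a κ (r - β) := integral_const_mul _ _
      _ ≤ _ := mul_le_mul_of_nonneg_left (integral_weight_le ha hκ β _) (by positivity)

end Weight

section WeightedIntegrals

variable {a κ : ℝ}

lemma integrableOn_of_le_weight (ha : 0 < a) (hκ : 0 < κ) {β K : ℝ} {F : ℝ → ℝ}
    (hF : ContinuousOn F (Ioi 0)) (hb : ∀ r > 0, |F r| ≤ K * weight a κ (r - β)) :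
    IntegrableOn F (Ioi 0) :=
  ((integrable_weight ha hκ β).integrableOn.const_mul K).mono'
    (hF.aestronglyMeasurable measurableSet_Ioi)
    ((ae_restrict_iff' measurableSet_Ioi).2 (Eventually.of_forall hb))

lemma integrableOn_weight_mul (ha : 0 < a) (hκ : 0 < κ) {β K : ℝ} {G : ℝ → ℝ}
    (hG : ContinuousOn G (Ioi 0)) (hb : ∀ r > 0, |G r| ≤ K) :
    IntegrableOn (fun r => weight a κ (r - β) * G r) (Ioi 0) := by
  refine integrableOn_of_le_weight ha hκ (β := β) (K := K)
    ((continuous_weight_sub hκ a β).continuousOn.mul hG) fun r hr => ?_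
  rw [abs_mul, abs_of_pos (weight_pos _ _ _), mul_comm]
  exact mul_le_mul_of_nonneg_right (hb r hr) (weight_pos _ _ _).le

lemma tendsto_weight_sub_atTop (ha : 0 < a) (hκ : 0 < κ) (β : ℝ) :
    Tendsto (fun r => weight a κ (r - β)) atTop (𝓝 0) := by
  refine squeeze_zero (fun r => (weight_pos _ _ _).le) (fun r => weight_le_exp_neg ha hκ _) ?_
  refine Real.tendsto_exp_atBot.comp ?_
  exact (tendsto_atTop_add_const_right _ (-β) tendsto_id).const_mul_atTop_of_neg (by linarith)

lemma integral_deriv_eq_neg (ha : 0 < a) (hκ : 0 < κ) {β K : ℝ} {g g' : ℝ → ℝ}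
    (hd : ∀ r ≥ 0, HasDerivAt g (g' r) r) (hg : ∀ r ≥ 0, |g r| ≤ K * weight a κ (r - β))
    (hc : ContinuousOn g' (Ioi 0)) (hg' : ∀ r > 0, |g' r| ≤ K * weight a κ (r - β)) :
    IntegrableOn g' (Ioi 0) ∧ ∫ r in Ioi 0, g' r = -g 0 := by
  have hi := integrableOn_of_le_weight ha hκ hc hg'
  have ht : Tendsto g atTop (𝓝 0) := by
    have h1 := (tendsto_weight_sub_atTop ha hκ β).const_mul K
    rw [mul_zero] at h1
    refine squeeze_zero_norm' ?_ h1
    filter_upwards [eventually_ge_atTop 0] with r hr using hg r hr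
  exact ⟨hi, by simpa using integral_Ioi_of_hasDerivAt_of_tendsto' hd hi ht⟩

lemma abs_weight_add_sub_le (ha : 0 < a) (hκ : 0 < κ) {x X : ℝ} (hx : |x| ≤ X) (z : ℝ) :
    |weight a κ (z + x) - weight a κ z| ≤
      (a + κ) * Real.exp ((a + κ) * X) * weight a κ z * |x| := by
  have hX : 0 ≤ X := (abs_nonneg x).trans hx
  have hball : ∀ y ∈ Icc (z - X) (z + X), ‖weightDeriv a κ y‖ ≤
      (a + κ) * Real.exp ((a + κ) * X) * weight a κ z := by
    intro y hy
    refine (abs_weightDeriv_le ha hκ y).trans ?_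
    rw [mul_assoc]
    refine mul_le_mul_of_nonneg_left ?_ (by positivity)
    have h1 := weight_add_le ha hκ z (y - z)
    rw [add_sub_cancel] at h1
    refine h1.trans (mul_le_mul_of_nonneg_right ?_ (weight_pos _ _ _).le)
    rw [Real.exp_le_exp]
    exact mul_le_mul_of_nonneg_left (abs_le.2 ⟨by linarith [hy.1], by linarith [hy.2]⟩)
      (by positivity)
  have := (convex_Icc (z - X) (z + X)).norm_image_sub_le_of_norm_hasDerivWithin_le
    (fun y _ => (hasDerivAt_weight hκ a y).hasDerivWithinAt) hball
    (⟨by linarith, by linarith⟩ : z ∈ Icc (z - X) (z + X))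
    (⟨by linarith [(abs_le.1 hx).1], by linarith [(abs_le.1 hx).2]⟩ :
      z + x ∈ Icc (z - X) (z + X))
  simpa using this

lemma hasDerivAt_weight_moving (hκ : 0 < κ) (a c β₀ r t : ℝ) :
    HasDerivAt (fun s => weight a κ (r - (β₀ + c * s)))
      (-(c * weightDeriv a κ (r - (β₀ + c * t)))) t := by
  have h1 : HasDerivAt (fun s => r - (β₀ + c * s)) (-c) t := by
    simpa using (((hasDerivAt_id t).const_mul c).const_add β₀).const_sub r
  refine ((hasDerivAt_weight hκ a _).comp t h1).congr_deriv ?_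
  ring

lemma hasDerivAt_weight_sub (hκ : 0 < κ) (a β r : ℝ) :
    HasDerivAt (fun r => weight a κ (r - β)) (weightDeriv a κ (r - β)) r :=
  (hasDerivAt_weight hκ a (r - β)).comp_sub_const r β

lemma hasDerivAt_weightDeriv_sub (hκ : 0 < κ) (a β r : ℝ) :
    HasDerivAt (fun r => weightDeriv a κ (r - β)) (weightDeriv₂ a κ (r - β)) r :=
  (hasDerivAt_weightDeriv hκ a (r - β)).comp_sub_const r β

/-- Integral over the half-line against the weight centred at `β`. -/
def wInt (a κ β : ℝ) (G : ℝ → ℝ) : ℝ := ∫ r in Ioi 0, weight a κ (r - β) * G r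

lemma hasDerivAt_wInt (ha : 0 < a) (hκ : 0 < κ) (c β₀ : ℝ) {G G' : ℝ → ℝ → ℝ} {B t : ℝ}
    (ht : 0 < t) (hG : ∀ s > 0, ContinuousOn (fun r => G r s) (Ioi 0))
    (hG' : ContinuousOn (fun r => G' r t) (Ioi 0))
    (hb : ∀ r > 0, ∀ s > 0, |G r s| ≤ B) (hb' : ∀ r > 0, ∀ s > 0, |G' r s| ≤ B)
    (hd : ∀ r > 0, ∀ s > 0, HasDerivAt (G r) (G' r s) s) :
    HasDerivAt (fun s => wInt a κ (β₀ + c * s) fun r => G r s)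
      (∫ r in Ioi 0, (-(c * weightDeriv a κ (r - (β₀ + c * t))) * G r t +
        weight a κ (r - (β₀ + c * t)) * G' r t)) t := by
  have hB : 0 ≤ B := (abs_nonneg _).trans (hb 1 one_pos t ht)
  set K : ℝ := (|c| * (a + κ) * B + B) * Real.exp ((a + κ) * |c|) with hK
  have hs : Metric.ball t 1 ∩ Ioi 0 ∈ 𝓝 t :=
    inter_mem (Metric.ball_mem_nhds t one_pos) (Ioi_mem_nhds ht)
  refine (hasDerivAt_integral_of_dominated_loc_of_deriv_le
    (bound := fun r => K * weight a κ (r - (β₀ + c * t)))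
    (F := fun s r => weight a κ (r - (β₀ + c * s)) * G r s)
    (F' := fun s r => -(c * weightDeriv a κ (r - (β₀ + c * s))) * G r s +
        weight a κ (r - (β₀ + c * s)) * G' r s) hs ?_ ?_ ?_ ?_ ?_ ?_).2
  · filter_upwards [lt_mem_nhds ht] with s hs
    exact ((continuous_weight_sub hκ a _).continuousOn.mul (hG s hs)).aestronglyMeasurable
      measurableSet_Ioi
  · exact integrableOn_weight_mul ha hκ (hG t ht) fun r hr => hb r hr t ht
  · refine ContinuousOn.aestronglyMeasurable (ContinuousOn.add (ContinuousOn.mul ?_ (hG t ht))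
      ((continuous_weight_sub hκ a _).continuousOn.mul hG')) measurableSet_Ioi
    have := continuous_weightDeriv hκ a
    fun_prop
  · refine (ae_restrict_iff' measurableSet_Ioi).2 (Eventually.of_forall fun r hr s hs => ?_)
    have hdist : |s - t| ≤ 1 := by
      have := hs.1; rw [Metric.mem_ball, Real.dist_eq] at this; exact this.le
    have hw : weight a κ (r - (β₀ + c * s)) ≤
        Real.exp ((a + κ) * |c|) * weight a κ (r - (β₀ + c * t)) := by
      have h1 := weight_add_le ha hκ (r - (β₀ + c * t)) (c * (t - s))
      rw [show r - (β₀ + c * t) + c * (t - s) = r - (β₀ + c * s) by ring] at h1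
      refine h1.trans (mul_le_mul_of_nonneg_right ?_ (weight_pos _ _ _).le)
      rw [Real.exp_le_exp, abs_mul, abs_sub_comm]
      exact mul_le_mul_of_nonneg_left (mul_le_of_le_one_right (abs_nonneg _) hdist)
        (by positivity)
    have hwd := abs_weightDeriv_le ha hκ (r - (β₀ + c * s))
    have hp := (weight_pos a κ (r - (β₀ + c * s))).le
    calc ‖-(c * weightDeriv a κ (r - (β₀ + c * s))) * G r s +
          weight a κ (r - (β₀ + c * s)) * G' r s‖
        ≤ |c| * |weightDeriv a κ (r - (β₀ + c * s))| * |G r s| +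
          weight a κ (r - (β₀ + c * s)) * |G' r s| := by
          refine (norm_add_le _ _).trans (le_of_eq ?_)
          simp only [Real.norm_eq_abs, abs_mul, abs_neg, abs_of_nonneg hp]
      _ ≤ |c| * ((a + κ) * weight a κ (r - (β₀ + c * s))) * B +
          weight a κ (r - (β₀ + c * s)) * B := by
          gcongr
          · exact hb r hr s hs.2
          · exact hb' r hr s hs.2
      _ = (|c| * (a + κ) * B + B) * weight a κ (r - (β₀ + c * s)) := by ring
      _ ≤ (|c| * (a + κ) * B + B) *
          (Real.exp ((a + κ) * |c|) * weight a κ (r - (β₀ + c * t))) := by gcongr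
      _ = _ := by rw [hK]; ring
  · exact (integrable_weight ha hκ _).integrableOn.const_mul K
  · refine (ae_restrict_iff' measurableSet_Ioi).2 (Eventually.of_forall fun r hr s hs => ?_)
    exact (hasDerivAt_weight_moving hκ a c β₀ r s).fun_mul (hd r hr s hs.2)

end WeightedIntegrals

section Functionals

variable {d : ℕ} {V : Euc n → ℝ} {u : ℝ → ℝ → Euc n} {C a κ : ℝ}

lemma IsRadialSolution.hasDerivAt_kinetic (hu : IsRadialSolution d V u) (hV : ContDiff ℝ 2 V)
    (hC : UniformlyBounded u C) (ha : 0 < a) (hκ : 0 < κ) (c β₀ : ℝ) {t : ℝ} (ht : 0 < t) :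
    HasDerivAt (fun s => wInt a κ (β₀ + c * s) fun r => ‖ur u r s‖ ^ 2 / 2)
      (∫ r in Ioi 0, (-(c * weightDeriv a κ (r - (β₀ + c * t))) * (‖ur u r t‖ ^ 2 / 2) -
        ⟪ut u r t, weightDeriv a κ (r - (β₀ + c * t)) • ur u r t +
          weight a κ (r - (β₀ + c * t)) • urr u r t⟫)) t := by
  have hC0 := hC.nonneg
  set β := β₀ + c * t with hβ
  set W : ℝ → ℝ := fun r => weight a κ (r - β) with hW
  set W' : ℝ → ℝ := fun r => weightDeriv a κ (r - β) with hW'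
  have hWpos : ∀ r, 0 < W r := fun r => weight_pos _ _ _
  have hWc : Continuous W := continuous_weight_sub hκ a β
  have hWc' : Continuous W' := (continuous_weightDeriv hκ a).comp (by fun_prop)
  have hW'le : ∀ r, |W' r| ≤ (a + κ) * W r := fun r => abs_weightDeriv_le ha hκ _
  set H : ℝ → ℝ → ℝ := fun s r =>
    (s - t)⁻¹ * (weight a κ (r - (β₀ + c * s)) - W r) * (‖ur u r s‖ ^ 2 / 2) -
      ⟪(s - t)⁻¹ • (u r s - u r t), (W' r / 2) • (ur u r s + ur u r t) +
        (W r / 2) • (urr u r s + urr u r t)⟫ with hH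
  have hHc : ∀ s > 0, Continuous (H s) := by
    intro s hs
    have h1 := continuous_weight_sub hκ a (β₀ + c * s)
    have h2 := hu.continuous_ur hs
    have h3 := hu.continuous_ur ht
    have h4 := hu.continuous_r hs
    have h5 := hu.continuous_r ht
    have h6 := hu.cont_rr s hs
    have h7 := hu.cont_rr t ht
    simp only [hH]
    fun_prop
  have hnear : ∀ᶠ s in 𝓝[≠] t, 0 < s ∧ |s - t| < 1 ∧ s ≠ t := by
    have h1 : ∀ᶠ s in 𝓝 t, 0 < s ∧ |s - t| < 1 := by
      refine (lt_mem_nhds ht).and ?_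
      have := Metric.ball_mem_nhds t one_pos
      filter_upwards [this] with s hs
      rwa [Metric.mem_ball, Real.dist_eq] at hs
    filter_upwards [nhdsWithin_le_nhds h1, self_mem_nhdsWithin] with s hs hs'
    exact ⟨hs.1, hs.2, hs'⟩
  have hslope : ∀ s : ℝ, 0 < s → s ≠ t →
      slope (fun s => wInt a κ (β₀ + c * s) fun r => ‖ur u r s‖ ^ 2 / 2) t s =
        ∫ r in Ioi 0, H s r := by
    intro s hs hst
    have hcs := hu.continuous_ur hs
    have hct := hu.continuous_ur ht
    have hbd : ∀ r > 0, ∀ x > 0, |‖ur u r x‖ ^ 2 / 2| ≤ C ^ 2 := by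
      intro r hr x hx
      have := hC.ur_le (le_of_lt hr) hx
      rw [abs_of_nonneg (by positivity)]
      nlinarith [norm_nonneg (ur u r x)]
    have hi1 : IntegrableOn (fun r => weight a κ (r - (β₀ + c * s)) * (‖ur u r s‖ ^ 2 / 2))
        (Ioi 0) := integrableOn_weight_mul ha hκ (by fun_prop) fun r hr => hbd r hr s hs
    have hi2 : IntegrableOn (fun r => W r * (‖ur u r t‖ ^ 2 / 2)) (Ioi 0) :=
      integrableOn_weight_mul ha hκ (by fun_prop) fun r hr => hbd r hr t ht
    set g : ℝ → ℝ := fun r => W r / 2 * ⟪u r s - u r t, ur u r s + ur u r t⟫ with hg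
    set g' : ℝ → ℝ := fun r => W' r / 2 * ⟪u r s - u r t, ur u r s + ur u r t⟫ +
      W r / 2 * (⟪u r s - u r t, urr u r s + urr u r t⟫ +
        ⟪ur u r s - ur u r t, ur u r s + ur u r t⟫) with hg'
    have hdg : ∀ r ≥ 0, HasDerivAt g (g' r) r := by
      intro r _
      have h1 := (hasDerivAt_weight_sub hκ a β r).div_const 2
      have h2 := ((hu.hasDerivAt_r hs r).fun_sub (hu.hasDerivAt_r ht r)).inner ℝ
        ((hu.hasDerivAt_rr hs r).fun_add (hu.hasDerivAt_rr ht r))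
      exact h1.fun_mul h2
    have hinn : ∀ x y : Euc n, ∀ A : ℝ, ‖x‖ ≤ 2 * C → ‖y‖ ≤ A → |⟪x, y⟫| ≤ 2 * C * A := by
      intro x y A hx hy
      exact (abs_real_inner_le_norm x y).trans
        (mul_le_mul hx hy (norm_nonneg _) (by positivity))
    have h2C : ∀ x y : Euc n, ‖x‖ ≤ C → ‖y‖ ≤ C → ‖x - y‖ ≤ 2 * C ∧ ‖x + y‖ ≤ 2 * C :=
      fun x y hx hy => ⟨(norm_sub_le _ _).trans (by linarith), (norm_add_le _ _).trans (by linarith)⟩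
    have hA : ∀ r ≥ 0, |⟪u r s - u r t, ur u r s + ur u r t⟫| ≤ 2 * C * (2 * C) := fun r hr =>
      hinn _ _ _ (h2C _ _ (hC.norm_le hr hs) (hC.norm_le hr ht)).1
        (h2C _ _ (hC.ur_le hr hs) (hC.ur_le hr ht)).2
    have hB : ∀ r ≥ 0, |⟪u r s - u r t, urr u r s + urr u r t⟫| ≤ 2 * C * (2 * C) := fun r hr =>
      hinn _ _ _ (h2C _ _ (hC.norm_le hr hs) (hC.norm_le hr ht)).1
        (h2C _ _ (hC.urr_le hr hs) (hC.urr_le hr ht)).2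
    have hD : ∀ r ≥ 0, |⟪ur u r s - ur u r t, ur u r s + ur u r t⟫| ≤ 2 * C * (2 * C) :=
      fun r hr => hinn _ _ _ (h2C _ _ (hC.ur_le hr hs) (hC.ur_le hr ht)).1
        (h2C _ _ (hC.ur_le hr hs) (hC.ur_le hr ht)).2
    obtain ⟨hig, hint⟩ := integral_deriv_eq_neg ha hκ (β := β)
      (K := (a + κ) * (2 * C * (2 * C)) + 2 * (2 * C * (2 * C))) hdg
      (fun r hr => by
        have hw : 0 ≤ W r := (hWpos r).le
        rw [hg, abs_mul, abs_of_nonneg (by positivity)]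
        calc W r / 2 * |⟪u r s - u r t, ur u r s + ur u r t⟫|
            ≤ W r / 2 * (2 * C * (2 * C)) := by gcongr; exact hA r hr
          _ ≤ ((a + κ) * (2 * C * (2 * C)) + 2 * (2 * C * (2 * C))) * W r := by
            have : 0 ≤ W r * (2 * C * (2 * C)) := by positivity
            have h3 : 0 ≤ (a + κ) * (W r * (2 * C * (2 * C))) := by positivity
            linarith)
      (by
        have h4 := hu.continuous_r hs
        have h5 := hu.continuous_r ht
        have h6 := hu.cont_rr s hs
        have h7 := hu.cont_rr t ht
        exact Continuous.continuousOn (by fun_prop))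
      (fun r hr => by
        have hw : 0 ≤ W r := (hWpos r).le
        have hr' : r ≥ 0 := le_of_lt hr
        calc |g' r| ≤ |W' r| / 2 * |⟪u r s - u r t, ur u r s + ur u r t⟫| +
              W r / 2 * (|⟪u r s - u r t, urr u r s + urr u r t⟫| +
              |⟪ur u r s - ur u r t, ur u r s + ur u r t⟫|) := by
              refine (abs_add_le _ _).trans (add_le_add ?_ ?_)
              · rw [abs_mul, abs_div, abs_two]
              · rw [abs_mul, abs_of_nonneg (by positivity : 0 ≤ W r / 2)]
                gcongr
                exact abs_add_le _ _
          _ ≤ ((a + κ) * W r) / 2 * (2 * C * (2 * C)) +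
              W r / 2 * (2 * C * (2 * C) + 2 * C * (2 * C)) := by
              gcongr
              · exact hW'le r
              · exact hA r hr'
              · exact hB r hr'
              · exact hD r hr'
          _ ≤ ((a + κ) * (2 * C * (2 * C)) + 2 * (2 * C * (2 * C))) * W r := by
            have : 0 ≤ W r * (2 * C * (2 * C)) := by positivity
            have h3 : 0 ≤ (a + κ) * (W r * (2 * C * (2 * C))) := by positivity
            linarith)
    have hg0 : g 0 = 0 := by simp [hg, hu.neumann s hs, hu.neumann t ht]
    rw [hg0, neg_zero] at hint
    have hmain : (wInt a κ (β₀ + c * s) fun r => ‖ur u r s‖ ^ 2 / 2) -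
        (wInt a κ (β₀ + c * t) fun r => ‖ur u r t‖ ^ 2 / 2) =
        ∫ r in Ioi 0, (weight a κ (r - (β₀ + c * s)) * (‖ur u r s‖ ^ 2 / 2) -
          W r * (‖ur u r t‖ ^ 2 / 2) - g' r) := by
      have h12 := hi1.fun_sub hi2
      rw [integral_sub h12 hig, hint, sub_zero, integral_sub hi1 hi2]
      rfl
    rw [slope_def_module, smul_eq_mul, hmain, ← integral_const_mul]
    congr 1
    ext r
    have e1 : ⟪ur u r s - ur u r t, ur u r s + ur u r t⟫ = ‖ur u r s‖ ^ 2 - ‖ur u r t‖ ^ 2 := by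
      rw [inner_sub_left, inner_add_right, inner_add_right, real_inner_self_eq_norm_sq,
        real_inner_self_eq_norm_sq, real_inner_comm]
      ring
    simp only [hH, hg', e1]
    simp only [real_inner_smul_left, real_inner_smul_right, inner_add_right]
    ring
  rw [hasDerivAt_iff_tendsto_slope]
  have hlim : Tendsto (fun s => ∫ r in Ioi 0, H s r) (𝓝[≠] t)
      (𝓝 (∫ r in Ioi 0, (-(c * W' r) * (‖ur u r t‖ ^ 2 / 2) -
        ⟪ut u r t, W' r • ur u r t + W r • urr u r t⟫))) := by
    set K : ℝ := (a + κ) * Real.exp ((a + κ) * |c|) * |c| * (C ^ 2 / 2) +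
      C * ((a + κ) / 2 * (2 * C) + 1 / 2 * (2 * C)) with hK
    refine tendsto_integral_filter_of_dominated_convergence (fun r => K * W r) ?_ ?_ ?_ ?_
    · filter_upwards [hnear] with s hs using (hHc s hs.1).aestronglyMeasurable
    · filter_upwards [hnear] with s hs
      obtain ⟨hs0, hs1, hst⟩ := hs
      refine (ae_restrict_iff' measurableSet_Ioi).2 (Eventually.of_forall fun r hr => ?_)
      have hr0 : 0 ≤ r := le_of_lt hr
      have hpos : 0 < |s - t| := abs_pos.2 (sub_ne_zero.2 hst)
      have hw : 0 ≤ W r := (hWpos r).le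
      have h1 : |(s - t)⁻¹ * (weight a κ (r - (β₀ + c * s)) - W r)| ≤
          (a + κ) * Real.exp ((a + κ) * |c|) * |c| * W r := by
        have hx : |c * (t - s)| ≤ |c| := by
          rw [abs_mul, abs_sub_comm]; exact mul_le_of_le_one_right (abs_nonneg _) hs1.le
        have h2 := abs_weight_add_sub_le ha hκ hx (r - β)
        rw [show r - β + c * (t - s) = r - (β₀ + c * s) by rw [hβ]; ring] at h2
        rw [abs_mul, abs_inv, inv_mul_le_iff₀ hpos]
        refine h2.trans (le_of_eq ?_)
        rw [abs_mul, abs_sub_comm]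
        ring
      have h3 : ‖(s - t)⁻¹ • (u r s - u r t)‖ ≤ C := by
        rw [norm_smul, norm_inv, Real.norm_eq_abs, inv_mul_le_iff₀ hpos, mul_comm]
        exact hu.lipschitz_t hC hr0 hs0 ht
      have h4 : ‖(W' r / 2) • (ur u r s + ur u r t) + (W r / 2) • (urr u r s + urr u r t)‖ ≤
          ((a + κ) / 2 * (2 * C) + 1 / 2 * (2 * C)) * W r := by
        refine (norm_add_le _ _).trans ?_
        rw [norm_smul, norm_smul, Real.norm_eq_abs, Real.norm_eq_abs, abs_div, abs_div, abs_two,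
          abs_of_nonneg hw]
        have h5 : ‖ur u r s + ur u r t‖ ≤ 2 * C :=
          (norm_add_le _ _).trans (by linarith [hC.ur_le hr0 hs0, hC.ur_le hr0 ht])
        have h6 : ‖urr u r s + urr u r t‖ ≤ 2 * C :=
          (norm_add_le _ _).trans (by linarith [hC.urr_le hr0 hs0, hC.urr_le hr0 ht])
        calc |W' r| / 2 * ‖ur u r s + ur u r t‖ + W r / 2 * ‖urr u r s + urr u r t‖
            ≤ ((a + κ) * W r) / 2 * (2 * C) + W r / 2 * (2 * C) := by
              gcongr; exact hW'le r
          _ = _ := by ring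
      have h7 : |‖ur u r s‖ ^ 2 / 2| ≤ C ^ 2 / 2 := by
        rw [abs_of_nonneg (by positivity)]
        have := hC.ur_le hr0 hs0
        gcongr
      calc ‖H s r‖ ≤ |(s - t)⁻¹ * (weight a κ (r - (β₀ + c * s)) - W r)| * |‖ur u r s‖ ^ 2 / 2| +
            ‖(s - t)⁻¹ • (u r s - u r t)‖ * ‖(W' r / 2) • (ur u r s + ur u r t) +
              (W r / 2) • (urr u r s + urr u r t)‖ := by
            refine (norm_sub_le _ _).trans (add_le_add ?_ (norm_inner_le_norm _ _))
            rw [Real.norm_eq_abs, abs_mul]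
        _ ≤ (a + κ) * Real.exp ((a + κ) * |c|) * |c| * W r * (C ^ 2 / 2) +
            C * (((a + κ) / 2 * (2 * C) + 1 / 2 * (2 * C)) * W r) := by gcongr
        _ = _ := by rw [hK]; ring
    · exact (integrable_weight ha hκ _).integrableOn.const_mul K
    · refine (ae_restrict_iff' measurableSet_Ioi).2 (Eventually.of_forall fun r hr => ?_)
      have hr0 : (0 : ℝ) < r := hr
      have l1 : Tendsto (fun s => (s - t)⁻¹ * (weight a κ (r - (β₀ + c * s)) - W r)) (𝓝[≠] t)
          (𝓝 (-(c * W' r))) := by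
        have := hasDerivAt_iff_tendsto_slope.1 (hasDerivAt_weight_moving hκ a c β₀ r t)
        simpa [slope_fun_def] using this
      have l2 : Tendsto (fun s => (s - t)⁻¹ • (u r s - u r t)) (𝓝[≠] t) (𝓝 (ut u r t)) := by
        have := hasDerivAt_iff_tendsto_slope.1 (hu.hasDerivAt_t ht r)
        simpa only [slope_fun_def, vsub_eq_sub] using this
      have l3 : Tendsto (fun s => ur u r s) (𝓝[≠] t) (𝓝 (ur u r t)) :=
        (hu.continuousAt_ur_t hC hr0.le ht).tendsto.mono_left nhdsWithin_le_nhds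
      have l4 : Tendsto (fun s => urr u r s) (𝓝[≠] t) (𝓝 (urr u r t)) :=
        (hu.continuousAt_urr_t hV hC hr0 ht).tendsto.mono_left nhdsWithin_le_nhds
      have l5 : Tendsto (fun s => (W' r / 2) • (ur u r s + ur u r t) +
          (W r / 2) • (urr u r s + urr u r t)) (𝓝[≠] t)
          (𝓝 (W' r • ur u r t + W r • urr u r t)) := by
        have := ((l3.add_const (ur u r t)).const_smul (W' r / 2)).add
          ((l4.add_const (urr u r t)).const_smul (W r / 2))
        convert this using 2
        module
      exact (l1.mul ((l3.norm.pow 2).div_const 2)).sub (l2.inner l5)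
  refine hlim.congr' ?_
  filter_upwards [hnear] with s hs using (hslope s hs.1 hs.2.2).symm

end Functionals

section FunctionalEstimates

variable {d : ℕ} {V : Euc n → ℝ} {u : ℝ → ℝ → Euc n} {C c κ : ℝ}

/-- Mass of the weight on the set where the solution is far from the origin. -/
def wSigma (a κ β : ℝ) (u : ℝ → ℝ → Euc n) (R t : ℝ) : ℝ :=
  ∫ r in Ioi 0 ∩ Sigma0 u R t, weight a κ (r - β)

/-- Weighted size of the curvature terms. -/
def wCurv (a κ β : ℝ) : ℝ := (∫ r in Ioi 0, weight a κ (r - β) / (1 + r)) + weight a κ (-β)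

/-- The weighted `L²` norm obeys a dissipation inequality outside of the escape set. -/
lemma IsRadialSolution.mass_deriv_le (hu : IsRadialSolution d V u) (hV : ContDiff ℝ 2 V)
    (hC : UniformlyBounded u C) (D : EscData n V) (h0 : (0 : Euc n) ∈ MinSet V) (hV0 : V 0 = 0)
    (hc : 0 < c) (hκ : 0 < κ) (hcκ : κ * (c + κ) ≤ D.lmin / 2) :
    ∃ K : ℝ, 0 ≤ K ∧ ∀ a, (a = c ∨ a = c + κ) → ∀ β₀ t, 0 < t → ∃ M' : ℝ,
      HasDerivAt (fun s => wInt a κ (β₀ + c * s) fun r => ‖u r s‖ ^ 2 / 2) M' t ∧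
      M' ≤ -min (D.lmin / 4) 1 *
          wInt a κ (β₀ + c * t) (fun r => ‖u r t‖ ^ 2 + ‖ur u r t‖ ^ 2) +
        K * (wSigma a κ (β₀ + c * t) u D.dEsc t + wCurv a κ (β₀ + c * t)) := by
  obtain ⟨Λ, hΛ, -, hgrad, -⟩ := exists_quadratic_bounds hV h0.1 hV0 C
  have hC0 := hC.nonneg
  have hl := D.lmin_pos
  set ν := min (D.lmin / 4) 1 with hν
  have hν1 : ν ≤ D.lmin / 4 := min_le_left _ _
  have hν2 : ν ≤ 1 := min_le_right _ _
  set k : ℝ := 2 * |(d : ℝ) - 1| * C with hk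
  have hk0 : 0 ≤ k := by positivity
  refine ⟨(D.lmin / 2 + Λ) * C ^ 2 + C * k + (2 + (c + 2 * κ)) * C ^ 2, by positivity, ?_⟩
  intro a hac β₀ t ht
  have ha : 0 < a := by rcases hac with rfl | rfl <;> positivity
  have hale : a ≤ c + κ := by rcases hac with rfl | rfl <;> linarith
  have hcu : ∀ s > 0, Continuous fun r => u r s := fun s hs => hu.continuous_r hs
  have hd := hasDerivAt_wInt ha hκ c β₀ (G := fun r s => ‖u r s‖ ^ 2 / 2)
    (G' := fun r s => ⟪u r s, ut u r s⟫) (B := C ^ 2) ht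
    (fun s hs => by have := hcu s hs; fun_prop)
    (by
      have h1 := (hcu t ht).continuousOn (s := Ioi 0)
      have h2 := hu.continuousOn_ut_r hV ht
      exact h1.inner h2)
    (fun r hr s hs => by
      rw [abs_of_nonneg (by positivity)]
      nlinarith [norm_nonneg (u r s), hC.norm_le (le_of_lt hr) hs])
    (fun r hr s hs => by
      refine (abs_real_inner_le_norm _ _).trans ?_
      rw [sq]
      exact mul_le_mul (hC.norm_le (le_of_lt hr) hs) (hC.ut_le (le_of_lt hr) hs)
        (norm_nonneg _) hC0)
    (fun r hr s hs => by
      have h1 := (hu.hasDerivAt_t hs r).norm_sq.div_const 2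
      refine h1.congr_deriv ?_
      ring)
  refine ⟨_, hd, ?_⟩
  set β := β₀ + c * t with hβ
  have hcu := hu.continuous_r ht
  have hcur := hu.continuous_ur ht
  have hcurr := hu.cont_rr t ht
  have hW := continuous_weight_sub hκ a β
  have hW1 : Continuous fun r => weightDeriv a κ (r - β) :=
    (continuous_weightDeriv hκ a).comp (by fun_prop)
  have hW2 : Continuous fun r => weightDeriv₂ a κ (r - β) :=
    (continuous_weightDeriv₂ hκ a).comp (by fun_prop)
  have hWd := abs_weightDeriv_le ha hκ
  have hsq : ∀ r ≥ 0, ‖u r t‖ ^ 2 ≤ C ^ 2 := fun r hr => by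
    have := hC.norm_le hr ht; gcongr
  have hsq' : ∀ r ≥ 0, ‖ur u r t‖ ^ 2 ≤ C ^ 2 := fun r hr => by
    have := hC.ur_le hr ht; gcongr
  have hin : ∀ r ≥ 0, |⟪u r t, ur u r t⟫| ≤ C ^ 2 := fun r hr => by
    refine (abs_real_inner_le_norm _ _).trans ?_
    rw [sq]
    exact mul_le_mul (hC.norm_le hr ht) (hC.ur_le hr ht) (norm_nonneg _) hC0
  have hin' : ∀ r ≥ 0, |⟪u r t, urr u r t⟫| ≤ C ^ 2 := fun r hr => by
    refine (abs_real_inner_le_norm _ _).trans ?_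
    rw [sq]
    exact mul_le_mul (hC.norm_le hr ht) (hC.urr_le hr ht) (norm_nonneg _) hC0
  set g : ℝ → ℝ := fun r => weight a κ (r - β) * ⟪u r t, ur u r t⟫ -
    weightDeriv a κ (r - β) * (‖u r t‖ ^ 2 / 2) with hg
  set g' : ℝ → ℝ := fun r => weight a κ (r - β) * (‖ur u r t‖ ^ 2 + ⟪u r t, urr u r t⟫) -
    weightDeriv₂ a κ (r - β) * (‖u r t‖ ^ 2 / 2) with hg'
  have hgle : ∀ r ≥ 0, |g r| ≤ (1 + (a + κ)) * C ^ 2 * weight a κ (r - β) := by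
    intro r hr
    have hw := (weight_pos a κ (r - β)).le
    calc |g r| ≤ weight a κ (r - β) * |⟪u r t, ur u r t⟫| +
          |weightDeriv a κ (r - β)| * (‖u r t‖ ^ 2 / 2) := by
          refine (abs_sub _ _).trans (le_of_eq ?_)
          rw [abs_mul, abs_mul, abs_of_nonneg hw,
            abs_of_nonneg (by positivity : 0 ≤ ‖u r t‖ ^ 2 / 2)]
      _ ≤ weight a κ (r - β) * C ^ 2 + ((a + κ) * weight a κ (r - β)) * C ^ 2 := by
          gcongr
          · exact hin r hr
          · exact hWd _
          · linarith [hsq r hr, sq_nonneg ‖u r t‖]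
      _ = _ := by ring
  obtain ⟨hig, hint⟩ := integral_deriv_eq_neg ha hκ (g := g) (g' := g') (β := β)
    (K := (1 + (a + κ)) * C ^ 2 + (2 + 2 * (a + κ) ^ 2) * C ^ 2)
    (fun r _ => by
      have h1 := (hasDerivAt_weight_sub hκ a β r).fun_mul
        ((hu.hasDerivAt_r ht r).inner ℝ (hu.hasDerivAt_rr ht r))
      have h2 := (hasDerivAt_weightDeriv_sub hκ a β r).fun_mul
        ((hu.hasDerivAt_r ht r).norm_sq.div_const 2)
      refine (h1.fun_sub h2).congr_deriv ?_
      simp only [hg', real_inner_self_eq_norm_sq]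
      ring)
    (fun r hr => (hgle r hr).trans (by
      have hw := (weight_pos a κ (r - β)).le
      gcongr
      exact le_add_of_nonneg_right (by positivity)))
    (Continuous.continuousOn (by fun_prop))
    (fun r hr => by
      have hr0 : r ≥ 0 := le_of_lt hr
      have hw := (weight_pos a κ (r - β)).le
      calc |g' r| ≤ weight a κ (r - β) * (‖ur u r t‖ ^ 2 + |⟪u r t, urr u r t⟫|) +
            |weightDeriv₂ a κ (r - β)| * (‖u r t‖ ^ 2 / 2) := by
            refine (abs_sub _ _).trans (add_le_add ?_ (le_of_eq ?_))
            · rw [abs_mul, abs_of_nonneg hw]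
              gcongr
              refine (abs_add_le _ _).trans (le_of_eq ?_)
              rw [abs_of_nonneg (sq_nonneg ‖ur u r t‖)]
            · rw [abs_mul, abs_of_nonneg (by positivity : 0 ≤ ‖u r t‖ ^ 2 / 2)]
        _ ≤ weight a κ (r - β) * (C ^ 2 + C ^ 2) +
            (2 * (a + κ) ^ 2 * weight a κ (r - β)) * C ^ 2 := by
            gcongr
            · exact hC.ur_le hr0 ht
            · exact hin' r hr0
            · exact abs_weightDeriv₂_le ha hκ _
            · linarith [hsq r hr0, sq_nonneg ‖u r t‖]
        _ ≤ _ := by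
            have : 0 ≤ (1 + (a + κ)) * C ^ 2 * weight a κ (r - β) := by positivity
            linarith)
  have hg0 : -g 0 ≤ (2 + (c + 2 * κ)) * C ^ 2 * weight a κ (-β) := by
    have h1 := hgle 0 le_rfl
    rw [zero_sub] at h1
    refine ((neg_le_abs _).trans h1).trans ?_
    have hw := (weight_pos a κ (-β)).le
    exact mul_le_mul_of_nonneg_right
      (mul_le_mul_of_nonneg_right (by linarith) (sq_nonneg C)) hw
  set I : ℝ → ℝ := fun r => -(c * weightDeriv a κ (r - β)) * (‖u r t‖ ^ 2 / 2) +
    weight a κ (r - β) * ⟪u r t, ut u r t⟫ with hI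
  have hiI : IntegrableOn I (Ioi 0) := by
    refine integrableOn_of_le_weight ha hκ (β := β) (K := c * (a + κ) * C ^ 2 + C ^ 2) ?_ ?_
    · refine ContinuousOn.add (Continuous.continuousOn (by fun_prop)) (hW.continuousOn.mul ?_)
      exact hcu.continuousOn.inner (hu.continuousOn_ut_r hV ht)
    · intro r hr
      have hr0 : r ≥ 0 := le_of_lt hr
      have hw := (weight_pos a κ (r - β)).le
      calc |I r| ≤ c * |weightDeriv a κ (r - β)| * (‖u r t‖ ^ 2 / 2) +
            weight a κ (r - β) * |⟪u r t, ut u r t⟫| := by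
            refine (abs_add_le _ _).trans (le_of_eq ?_)
            rw [abs_mul, abs_neg, abs_mul, abs_of_pos hc, abs_mul, abs_of_nonneg hw,
              abs_of_nonneg (by positivity : 0 ≤ ‖u r t‖ ^ 2 / 2)]
        _ ≤ c * ((a + κ) * weight a κ (r - β)) * C ^ 2 + weight a κ (r - β) * C ^ 2 := by
            gcongr
            · exact hWd _
            · linarith [hsq r hr0, sq_nonneg ‖u r t‖]
            · refine (abs_real_inner_le_norm _ _).trans ?_
              rw [sq]
              exact mul_le_mul (hC.norm_le hr0 ht) (hC.ut_le hr0 ht) (norm_nonneg _) hC0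
        _ = _ := by ring
  have hiN : IntegrableOn (fun r => weight a κ (r - β) * (‖u r t‖ ^ 2 + ‖ur u r t‖ ^ 2))
      (Ioi 0) := by
    refine integrableOn_weight_mul ha hκ (K := 2 * C ^ 2)
      (Continuous.continuousOn (by fun_prop)) fun r hr => ?_
    rw [abs_of_nonneg (by positivity)]
    linarith [hsq r (le_of_lt hr), hsq' r (le_of_lt hr)]
  have hmS := hu.measurableSet_Sigma0 ht D.dEsc
  have hiS : IntegrableOn ((Sigma0 u D.dEsc t).indicator fun r => weight a κ (r - β)) (Ioi 0) :=
    (integrable_weight ha hκ β).integrableOn.indicator hmS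
  have hiQ := integrableOn_weight_div ha hκ β
  have hpt : ∀ r ∈ Ioi (0 : ℝ), I r - g' r ≤
      -ν * (weight a κ (r - β) * (‖u r t‖ ^ 2 + ‖ur u r t‖ ^ 2)) +
      (D.lmin / 2 + Λ) * C ^ 2 * (Sigma0 u D.dEsc t).indicator (fun r => weight a κ (r - β)) r +
      C * k * (weight a κ (r - β) / (1 + r)) := by
    intro r hr
    have hr' : 0 < r := hr
    have hw := (weight_pos a κ (r - β)).le
    have hq := weightDeriv₂_sub_le hc hκ hac (r - β)
    have hcurv : ⟪u r t, (((d : ℝ) - 1) / r) • ur u r t⟫ ≤ C * (k / (1 + r)) := by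
      refine (real_inner_le_norm _ _).trans ?_
      exact mul_le_mul (hC.norm_le hr'.le ht) (hu.curvature_le hC ht hr') (norm_nonneg _) hC0
    have e1 : I r - g' r = 1 / 2 * ‖u r t‖ ^ 2 *
          (weightDeriv₂ a κ (r - β) - c * weightDeriv a κ (r - β)) +
        weight a κ (r - β) * (-‖ur u r t‖ ^ 2 - ⟪u r t, gradient V (u r t)⟫ +
          ⟪u r t, (((d : ℝ) - 1) / r) • ur u r t⟫) := by
      simp only [hI, hg']
      rw [hu.pde r hr' t ht, inner_add_right, inner_add_right, inner_neg_right]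
      ring
    have e2 : 1 / 2 * ‖u r t‖ ^ 2 * (weightDeriv₂ a κ (r - β) - c * weightDeriv a κ (r - β)) ≤
        weight a κ (r - β) * (D.lmin / 4 * ‖u r t‖ ^ 2) := by
      have h1 : weightDeriv₂ a κ (r - β) - c * weightDeriv a κ (r - β) ≤
          D.lmin / 2 * weight a κ (r - β) := hq.trans (by gcongr)
      have h2 := mul_le_mul_of_nonneg_left h1 (by positivity : 0 ≤ 1 / 2 * ‖u r t‖ ^ 2)
      linarith
    have e3 : D.lmin / 4 * ‖u r t‖ ^ 2 - ‖ur u r t‖ ^ 2 - ⟪u r t, gradient V (u r t)⟫ ≤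
        -ν * (‖u r t‖ ^ 2 + ‖ur u r t‖ ^ 2) +
        (D.lmin / 2 + Λ) * C ^ 2 * (Sigma0 u D.dEsc t).indicator (fun _ => 1) r := by
      have hνu : ν * ‖u r t‖ ^ 2 ≤ D.lmin / 4 * ‖u r t‖ ^ 2 := by gcongr
      have hνur : ν * ‖ur u r t‖ ^ 2 ≤ 1 * ‖ur u r t‖ ^ 2 := by gcongr
      by_cases hmem : r ∈ Sigma0 u D.dEsc t
      · rw [indicator_of_mem hmem]
        have h1 : -⟪u r t, gradient V (u r t)⟫ ≤ Λ * C ^ 2 := by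
          refine (neg_le_abs _).trans ((abs_real_inner_le_norm _ _).trans ?_)
          calc ‖u r t‖ * ‖gradient V (u r t)‖ ≤ ‖u r t‖ * (Λ * ‖u r t‖) := by
                gcongr; exact hgrad _ (hC.norm_le hr'.le ht)
            _ = Λ * ‖u r t‖ ^ 2 := by ring
            _ ≤ _ := by gcongr; exact hC.norm_le hr'.le ht
        have h2 := mul_le_mul_of_nonneg_left (hsq r hr'.le) (by positivity : 0 ≤ D.lmin / 2)
        linarith
      · rw [indicator_of_notMem hmem]
        have hsmall : ‖u r t - 0‖ ≤ D.dEsc := by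
          rw [sub_zero]
          by_contra! h
          exact hmem ⟨hr'.le, h⟩
        have h1 := D.inner_gradient_ge hV h0 hsmall
        rw [sub_zero] at h1
        linarith
    have e4 : (Sigma0 u D.dEsc t).indicator (fun r => weight a κ (r - β)) r =
        weight a κ (r - β) * (Sigma0 u D.dEsc t).indicator (fun _ => 1) r := by
      by_cases hmem : r ∈ Sigma0 u D.dEsc t <;> simp [hmem]
    rw [e1, e4]
    have h5 := mul_le_mul_of_nonneg_left (add_le_add e3 hcurv) hw
    calc _ ≤ weight a κ (r - β) * (D.lmin / 4 * ‖u r t‖ ^ 2) + weight a κ (r - β) *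
          (-‖ur u r t‖ ^ 2 - ⟪u r t, gradient V (u r t)⟫ +
            ⟪u r t, (((d : ℝ) - 1) / r) • ur u r t⟫) := by gcongr
      _ = weight a κ (r - β) * (D.lmin / 4 * ‖u r t‖ ^ 2 - ‖ur u r t‖ ^ 2 -
          ⟪u r t, gradient V (u r t)⟫ + ⟪u r t, (((d : ℝ) - 1) / r) • ur u r t⟫) := by ring
      _ ≤ _ := h5
      _ = _ := by ring
  have hiR := ((hiN.const_mul (-ν)).fun_add (hiS.const_mul ((D.lmin / 2 + Λ) * C ^ 2))).fun_add
    (hiQ.const_mul (C * k))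
  have hmono := setIntegral_mono_on (hiI.fun_sub hig) hiR measurableSet_Ioi hpt
  rw [integral_sub hiI hig, hint, integral_add ((hiN.const_mul (-ν)).fun_add
    (hiS.const_mul ((D.lmin / 2 + Λ) * C ^ 2))) (hiQ.const_mul (C * k)),
    integral_add (hiN.const_mul (-ν)) (hiS.const_mul ((D.lmin / 2 + Λ) * C ^ 2)),
    integral_const_mul, integral_const_mul, integral_const_mul, setIntegral_indicator hmS] at hmono
  unfold wInt wSigma wCurv
  set J := ∫ r in Ioi 0 ∩ Sigma0 u D.dEsc t, weight a κ (r - β)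
  set Q := ∫ r in Ioi 0, weight a κ (r - β) / (1 + r)
  have hJ : 0 ≤ J := integral_nonneg fun r => (weight_pos _ _ _).le
  have hQ : 0 ≤ Q := setIntegral_nonneg measurableSet_Ioi fun r hr => by
    have : (0 : ℝ) < r := hr
    have := weight_pos a κ (r - β)
    positivity
  have hwβ := (weight_pos a κ (-β)).le
  have p1 : 0 ≤ (D.lmin / 2 + Λ) * C ^ 2 * (Q + weight a κ (-β)) := by positivity
  have p2 : 0 ≤ C * k * (J + weight a κ (-β)) := by positivity
  have p3 : 0 ≤ (2 + (c + 2 * κ)) * C ^ 2 * (J + Q) := by positivity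
  linarith

end FunctionalEstimates

section EnergyEstimate

variable {d : ℕ} {V : Euc n → ℝ} {u : ℝ → ℝ → Euc n} {C c κ : ℝ}

/-- Dissipation inequality for the localized energy in a frame travelling at speed `c`. -/
lemma IsRadialSolution.energy_deriv_le (hu : IsRadialSolution d V u) (hV : ContDiff ℝ 2 V)
    (hC : UniformlyBounded u C) (h0 : (0 : Euc n) ∈ MinSet V) (hV0 : V 0 = 0)
    (hc : 0 < c) (hκ : 0 < κ) :
    ∃ K : ℝ, 0 ≤ K ∧ ∀ β₀ t, 0 < t → ∃ E' : ℝ,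
      HasDerivAt (fun s => wInt c κ (β₀ + c * s) fun r => ‖ur u r s‖ ^ 2 / 2 + V (u r s)) E' t ∧
      E' ≤ -(1 / 2) * wInt c κ (β₀ + c * t) (fun r => ‖ut u r t + c • ur u r t‖ ^ 2) +
        1 / 2 * (c + κ) ^ 2 * wInt (c + κ) κ (β₀ + c * t) (fun r => ‖ur u r t‖ ^ 2) +
        K * wCurv c κ (β₀ + c * t) := by
  obtain ⟨Λ, hΛ, -, hgrad, hpot⟩ := exists_quadratic_bounds hV h0.1 hV0 C
  have hC0 := hC.nonneg
  set k : ℝ := 2 * |(d : ℝ) - 1| * C with hk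
  have hk0 : 0 ≤ k := by positivity
  have hVc : Continuous V := hV.continuous
  have hck : 0 < c + κ := by positivity
  refine ⟨(1 + c) * C * k + c * ((1 + Λ) * C ^ 2), by positivity, ?_⟩
  intro β₀ t ht
  have hgC : ∀ r ≥ 0, ∀ s > 0, ‖gradient V (u r s)‖ ≤ Λ * C := fun r hr s hs =>
    (hgrad _ (hC.norm_le hr hs)).trans (mul_le_mul_of_nonneg_left (hC.norm_le hr hs) hΛ)
  have hVC : ∀ r ≥ 0, ∀ s > 0, |V (u r s)| ≤ Λ * C ^ 2 := fun r hr s hs =>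
    (hpot _ (hC.norm_le hr hs)).trans (by gcongr; exact hC.norm_le hr hs)
  have hd1 := hu.hasDerivAt_kinetic hV hC hc hκ c β₀ ht
  have hgc := (contDiff_gradient hV).continuous
  have hd2 := hasDerivAt_wInt hc hκ c β₀ (G := fun r s => V (u r s))
    (G' := fun r s => ⟪gradient V (u r s), ut u r s⟫) (B := Λ * C ^ 2) ht
    (fun s hs => (hVc.comp (hu.continuous_r hs)).continuousOn)
    ((hgc.comp (hu.continuous_r ht)).continuousOn.inner (hu.continuousOn_ut_r hV ht))
    (fun r hr s hs => hVC r (le_of_lt hr) s hs)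
    (fun r hr s hs => by
      refine (abs_real_inner_le_norm _ _).trans ?_
      calc _ ≤ (Λ * C) * C := mul_le_mul (hgC r (le_of_lt hr) s hs)
            (hC.ut_le (le_of_lt hr) hs) (norm_nonneg _) (by positivity)
        _ = _ := by ring)
    (fun r hr s hs => hasDerivAt_comp_potential hV (hu.hasDerivAt_t hs r))
  have hsum := hd1.fun_add hd2
  have hcong : (fun s => wInt c κ (β₀ + c * s) fun r => ‖ur u r s‖ ^ 2 / 2 + V (u r s)) =ᶠ[𝓝 t]
      fun s => (wInt c κ (β₀ + c * s) fun r => ‖ur u r s‖ ^ 2 / 2) +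
        wInt c κ (β₀ + c * s) fun r => V (u r s) := by
    filter_upwards [Ioi_mem_nhds ht] with s hs
    unfold wInt
    rw [← integral_add]
    · simp only [mul_add]
    · refine integrableOn_weight_mul hc hκ (K := C ^ 2) ?_ fun r hr => ?_
      · have := hu.continuous_ur hs
        exact Continuous.continuousOn (by fun_prop)
      · rw [abs_of_nonneg (by positivity)]
        nlinarith [norm_nonneg (ur u r s), hC.ur_le (le_of_lt hr) hs]
    · exact integrableOn_weight_mul hc hκ (K := Λ * C ^ 2)
        (hVc.comp (hu.continuous_r hs)).continuousOn fun r hr => hVC r (le_of_lt hr) s hs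
  refine ⟨_, hsum.congr_of_eventuallyEq hcong, ?_⟩
  set β := β₀ + c * t with hβ
  have hcu := hu.continuous_r ht
  have hcur := hu.continuous_ur ht
  have hcurr := hu.cont_rr t ht
  have hcut := hu.continuousOn_ut_r hV ht
  have hW := continuous_weight_sub hκ c β
  have hW1 : Continuous fun r => weightDeriv c κ (r - β) :=
    (continuous_weightDeriv hκ c).comp (by fun_prop)
  have hWd := abs_weightDeriv_le hc hκ
  have hsq' : ∀ r ≥ 0, ‖ur u r t‖ ^ 2 ≤ C ^ 2 := fun r hr => by
    have := hC.ur_le hr ht; gcongr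
  set w : ℝ → Euc n := fun r => ut u r t + c • ur u r t with hw
  have hwle : ∀ r ≥ 0, ‖w r‖ ≤ (1 + c) * C := fun r hr => by
    refine (norm_add_le _ _).trans ?_
    rw [norm_smul, Real.norm_of_nonneg hc.le]
    nlinarith [hC.ut_le hr ht, hC.ur_le hr ht]
  have hwc : ContinuousOn w (Ioi 0) := hcut.add (hcur.const_smul c).continuousOn
  set g : ℝ → ℝ := fun r => c * weight c κ (r - β) * (‖ur u r t‖ ^ 2 / 2 - V (u r t)) with hg
  set g' : ℝ → ℝ := fun r =>
    c * weightDeriv c κ (r - β) * (‖ur u r t‖ ^ 2 / 2 - V (u r t)) +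
    c * weight c κ (r - β) * (⟪ur u r t, urr u r t⟫ - ⟪gradient V (u r t), ur u r t⟫) with hg'
  have hkin : ∀ r ≥ 0, |‖ur u r t‖ ^ 2 / 2 - V (u r t)| ≤ (1 + Λ) * C ^ 2 := fun r hr => by
    refine (abs_sub _ _).trans ?_
    rw [abs_of_nonneg (by positivity : 0 ≤ ‖ur u r t‖ ^ 2 / 2)]
    nlinarith [hsq' r hr, hVC r hr t ht, sq_nonneg ‖ur u r t‖]
  have hprod : ∀ r ≥ 0, |⟪ur u r t, urr u r t⟫ - ⟪gradient V (u r t), ur u r t⟫| ≤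
      (1 + Λ) * C ^ 2 := fun r hr => by
    refine (abs_sub _ _).trans ?_
    have h1 := (abs_real_inner_le_norm (ur u r t) (urr u r t)).trans
      (mul_le_mul (hC.ur_le hr ht) (hC.urr_le hr ht) (norm_nonneg _) hC0)
    have h2 := (abs_real_inner_le_norm (gradient V (u r t)) (ur u r t)).trans
      (mul_le_mul (hgC r hr t ht) (hC.ur_le hr ht) (norm_nonneg _) (by positivity))
    linarith
  have hgle : ∀ r ≥ 0, |g r| ≤ c * ((1 + Λ) * C ^ 2) * weight c κ (r - β) := by
    intro r hr
    have hw := (weight_pos c κ (r - β)).le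
    simp only [hg]
    rw [abs_mul, abs_mul, abs_of_pos hc, abs_of_nonneg hw]
    calc _ ≤ c * weight c κ (r - β) * ((1 + Λ) * C ^ 2) := by gcongr; exact hkin r hr
      _ = _ := by ring
  obtain ⟨hig, hint⟩ := integral_deriv_eq_neg hc hκ (g := g) (g' := g') (β := β)
    (K := c * ((1 + Λ) * C ^ 2) * (1 + (c + κ)))
    (fun r _ => by
      have h1 := ((hasDerivAt_weight_sub hκ c β r).const_mul c).fun_mul
        (((hu.hasDerivAt_rr ht r).norm_sq.div_const 2).fun_sub
          (hasDerivAt_comp_potential hV (hu.hasDerivAt_r ht r)))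
      refine h1.congr_deriv ?_
      simp only [hg']
      ring)
    (fun r hr => (hgle r hr).trans (by
      have hw := (weight_pos c κ (r - β)).le
      refine mul_le_mul_of_nonneg_right ?_ hw
      exact le_mul_of_one_le_right (by positivity) (by linarith)))
    (Continuous.continuousOn (by fun_prop))
    (fun r hr => by
      have hr0 : r ≥ 0 := le_of_lt hr
      have hw := (weight_pos c κ (r - β)).le
      refine (abs_add_le _ _).trans ?_
      rw [abs_mul, abs_mul, abs_mul, abs_mul, abs_of_pos hc, abs_of_nonneg hw]
      calc _ ≤ c * ((c + κ) * weight c κ (r - β)) * ((1 + Λ) * C ^ 2) +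
            c * weight c κ (r - β) * ((1 + Λ) * C ^ 2) := by
            gcongr
            · exact hWd _
            · exact hkin r hr0
            · exact hprod r hr0
        _ = _ := by ring)
  have hg0 : -g 0 ≤ c * ((1 + Λ) * C ^ 2) * weight c κ (-β) := by
    have h1 := hgle 0 le_rfl
    rw [zero_sub] at h1
    exact (neg_le_abs _).trans h1
  set I₁ : ℝ → ℝ := fun r => -(c * weightDeriv c κ (r - β)) * (‖ur u r t‖ ^ 2 / 2) -
    ⟪ut u r t, weightDeriv c κ (r - β) • ur u r t + weight c κ (r - β) • urr u r t⟫ with hI₁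
  set I₂ : ℝ → ℝ := fun r => -(c * weightDeriv c κ (r - β)) * V (u r t) +
    weight c κ (r - β) * ⟪gradient V (u r t), ut u r t⟫ with hI₂
  have hiI₁ : IntegrableOn I₁ (Ioi 0) := by
    refine integrableOn_of_le_weight hc hκ (β := β)
      (K := c * (c + κ) * C ^ 2 + (c + κ) * C ^ 2 + C ^ 2) ?_ ?_
    · refine ContinuousOn.sub (Continuous.continuousOn (by fun_prop)) (hcut.inner ?_)
      exact Continuous.continuousOn ((hW1.smul hcur).add (hW.smul hcurr))
    · intro r hr
      have hr0 : r ≥ 0 := le_of_lt hr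
      have hw := (weight_pos c κ (r - β)).le
      refine (abs_sub _ _).trans ?_
      have h1 : |⟪ut u r t, weightDeriv c κ (r - β) • ur u r t +
          weight c κ (r - β) • urr u r t⟫| ≤ C * (((c + κ) * weight c κ (r - β)) * C +
            weight c κ (r - β) * C) := by
        refine (abs_real_inner_le_norm _ _).trans ?_
        refine mul_le_mul (hC.ut_le hr0 ht) ?_ (norm_nonneg _) hC0
        refine (norm_add_le _ _).trans ?_
        rw [norm_smul, norm_smul, Real.norm_of_nonneg hw]
        refine add_le_add ?_ (mul_le_mul_of_nonneg_left (hC.urr_le hr0 ht) hw)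
        exact mul_le_mul (hWd _) (hC.ur_le hr0 ht) (norm_nonneg _) (by positivity)
      have h2 : |-(c * weightDeriv c κ (r - β)) * (‖ur u r t‖ ^ 2 / 2)| ≤
          c * ((c + κ) * weight c κ (r - β)) * C ^ 2 := by
        rw [abs_mul, abs_neg, abs_mul, abs_of_pos hc,
          abs_of_nonneg (by positivity : 0 ≤ ‖ur u r t‖ ^ 2 / 2)]
        gcongr
        · exact hWd _
        · linarith [hsq' r hr0, sq_nonneg ‖ur u r t‖]
      linarith
  have hiI₂ : IntegrableOn I₂ (Ioi 0) := by
    refine integrableOn_of_le_weight hc hκ (β := β)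
      (K := c * (c + κ) * (Λ * C ^ 2) + Λ * C ^ 2) ?_ ?_
    · refine ContinuousOn.add ?_ (hW.continuousOn.mul ?_)
      · exact Continuous.continuousOn (by fun_prop)
      · exact (hgc.comp hcu).continuousOn.inner hcut
    · intro r hr
      have hr0 : r ≥ 0 := le_of_lt hr
      have hw := (weight_pos c κ (r - β)).le
      refine (abs_add_le _ _).trans ?_
      have h1 := (abs_real_inner_le_norm (gradient V (u r t)) (ut u r t)).trans
        (mul_le_mul (hgC r hr0 t ht) (hC.ut_le hr0 ht) (norm_nonneg _) (by positivity))
      rw [abs_mul, abs_neg, abs_mul, abs_of_pos hc, abs_mul, abs_of_nonneg hw]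
      calc _ ≤ c * ((c + κ) * weight c κ (r - β)) * (Λ * C ^ 2) +
            weight c κ (r - β) * (Λ * C * C) := by
            gcongr
            · exact hWd _
            · exact hVC r hr0 t ht
        _ = _ := by ring
  have hiD : IntegrableOn (fun r => weight c κ (r - β) * ‖w r‖ ^ 2) (Ioi 0) := by
    refine integrableOn_weight_mul hc hκ (K := ((1 + c) * C) ^ 2) (hwc.norm.pow 2) fun r hr => ?_
    rw [abs_of_nonneg (by positivity)]
    have := hwle r (le_of_lt hr)
    gcongr
  have hiP : IntegrableOn (fun r => weight (c + κ) κ (r - β) * ‖ur u r t‖ ^ 2) (Ioi 0) := by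
    refine integrableOn_weight_mul hck hκ (K := C ^ 2)
      (Continuous.continuousOn (by fun_prop)) fun r hr => ?_
    rw [abs_of_nonneg (by positivity)]
    exact hsq' r (le_of_lt hr)
  have hiQ := integrableOn_weight_div hc hκ β
  have hpt : ∀ r ∈ Ioi (0 : ℝ), I₁ r + I₂ r - g' r ≤
      -(1 / 2) * (weight c κ (r - β) * ‖w r‖ ^ 2) +
      1 / 2 * (c + κ) ^ 2 * (weight (c + κ) κ (r - β) * ‖ur u r t‖ ^ 2) +
      (1 + c) * C * k * (weight c κ (r - β) / (1 + r)) := by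
    intro r hr
    have hr' : 0 < r := hr
    have hwp := (weight_pos c κ (r - β)).le
    have hwp' := (weight_pos (c + κ) κ (r - β)).le
    have hle : weight (c + κ) κ (r - β) ≤ weight c κ (r - β) := by
      rw [weight_add_kappa hκ]
      exact mul_le_of_le_one_left hwp (logistic_le_one _ _)
    have hcurv : ⟪w r, (((d : ℝ) - 1) / r) • ur u r t⟫ ≤ (1 + c) * C * (k / (1 + r)) :=
      (real_inner_le_norm _ _).trans
        (mul_le_mul (hwle r hr'.le) (hu.curvature_le hC ht hr') (norm_nonneg _) (by positivity))
    have e1 : I₁ r + I₂ r - g' r = -(weight c κ (r - β) * ‖w r‖ ^ 2) +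
        (c * weight c κ (r - β) - weightDeriv c κ (r - β)) * ⟪w r, ur u r t⟫ +
        weight c κ (r - β) * ⟪w r, (((d : ℝ) - 1) / r) • ur u r t⟫ := by
      have hgr : gradient V (u r t) =
          urr u r t + (((d : ℝ) - 1) / r) • ur u r t - ut u r t := by
        rw [hu.pde r hr' t ht]; abel
      have s1 : ⟪ur u r t, ut u r t⟫ = ⟪ut u r t, ur u r t⟫ := real_inner_comm _ _
      have s2 : ⟪urr u r t, ut u r t⟫ = ⟪ut u r t, urr u r t⟫ := real_inner_comm _ _
      have s3 : ⟪urr u r t, ur u r t⟫ = ⟪ur u r t, urr u r t⟫ := real_inner_comm _ _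
      rw [← real_inner_self_eq_norm_sq (w r)]
      simp only [hI₁, hI₂, hg', hw, hgr, ← real_inner_self_eq_norm_sq (ur u r t), inner_add_left,
        inner_add_right, inner_sub_left, inner_smul_left, inner_smul_right,
        RCLike.conj_to_real, s1, s2, s3]
      ring
    rw [e1, mul_weight_sub_weightDeriv hκ]
    have e2 : ⟪w r, ur u r t⟫ * (c + κ) ≤ 1 / 2 * ‖w r‖ ^ 2 + 1 / 2 * (c + κ) ^ 2 * ‖ur u r t‖ ^ 2 := by
      have := mul_le_mul_of_nonneg_right (real_inner_le_norm (w r) (ur u r t)) hck.le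
      nlinarith [sq_nonneg (‖w r‖ - (c + κ) * ‖ur u r t‖)]
    have e3 := mul_le_mul_of_nonneg_left e2 hwp'
    have e4 := mul_le_mul_of_nonneg_right hle (by positivity : 0 ≤ 1 / 2 * ‖w r‖ ^ 2)
    have e5 := mul_le_mul_of_nonneg_left hcurv hwp
    have e6 : weight c κ (r - β) * ((1 + c) * C * (k / (1 + r))) =
      (1 + c) * C * k * (weight c κ (r - β) / (1 + r)) := by ring
    linarith
  have hiR := ((hiD.const_mul (-(1 / 2))).fun_add (hiP.const_mul (1 / 2 * (c + κ) ^ 2))).fun_add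
    (hiQ.const_mul ((1 + c) * C * k))
  have hmono := setIntegral_mono_on ((hiI₁.fun_add hiI₂).fun_sub hig) hiR measurableSet_Ioi hpt
  rw [integral_sub (hiI₁.fun_add hiI₂) hig, integral_add hiI₁ hiI₂, hint,
    integral_add ((hiD.const_mul (-(1 / 2))).fun_add (hiP.const_mul (1 / 2 * (c + κ) ^ 2)))
      (hiQ.const_mul ((1 + c) * C * k)),
    integral_add (hiD.const_mul (-(1 / 2))) (hiP.const_mul (1 / 2 * (c + κ) ^ 2)),
    integral_const_mul, integral_const_mul, integral_const_mul] at hmono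
  unfold wInt wCurv
  set Q := ∫ r in Ioi 0, weight c κ (r - β) / (1 + r)
  have hQ : 0 ≤ Q := setIntegral_nonneg measurableSet_Ioi fun r hr => by
    have : (0 : ℝ) < r := hr
    have := weight_pos c κ (r - β)
    positivity
  have hwβ := (weight_pos c κ (-β)).le
  have p1 : 0 ≤ (1 + c) * C * k * weight c κ (-β) := by positivity
  have p2 : 0 ≤ c * ((1 + Λ) * C ^ 2) * Q := by positivity
  linarith

end EnergyEstimate

section DifferentialInequalities

lemma le_of_deriv_le_affine {ν k a b : ℝ} (hν : 0 < ν) {f : ℝ → ℝ}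
    (hf : ∀ t ∈ Icc a b, ∃ f' : ℝ, HasDerivAt f f' t ∧ f' ≤ -ν * f t + k) {t : ℝ}
    (ht : t ∈ Icc a b) : f t ≤ (f a - k / ν) * Real.exp (-ν * (t - a)) + k / ν := by
  choose! f' hf' hle using hf
  have hd : ∀ s ∈ Icc a b, HasDerivAt (fun s => (f s - k / ν) * Real.exp (ν * (s - a)))
      (f' s * Real.exp (ν * (s - a)) + (f s - k / ν) * (Real.exp (ν * (s - a)) * ν)) s := by
    intro s hs
    have h1 : HasDerivAt (fun s => ν * (s - a)) ν s := by
      simpa using ((hasDerivAt_id s).sub_const a).const_mul ν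
    exact ((hf' s hs).sub_const _).fun_mul h1.exp
  have hanti : AntitoneOn (fun s => (f s - k / ν) * Real.exp (ν * (s - a))) (Icc a b) := by
    refine antitoneOn_of_deriv_nonpos (convex_Icc a b)
      (fun s hs => (hd s hs).continuousAt.continuousWithinAt)
      (fun s hs => (hd s (interior_subset hs)).differentiableAt.differentiableWithinAt) ?_
    intro s hs
    rw [(hd s (interior_subset hs)).deriv]
    have h1 := hle s (interior_subset hs)
    have h2 : f' s * Real.exp (ν * (s - a)) + (f s - k / ν) * (Real.exp (ν * (s - a)) * ν) =
        Real.exp (ν * (s - a)) * (f' s + ν * f s - k) := by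
      field_simp
      ring
    rw [h2]
    exact mul_nonpos_of_nonneg_of_nonpos (Real.exp_pos _).le (by linarith)
  have h := hanti (left_mem_Icc.2 (ht.1.trans ht.2)) ht ht.1
  simp only [sub_self, mul_zero, Real.exp_zero, mul_one] at h
  have h3 := mul_le_mul_of_nonneg_right h (Real.exp_pos (-ν * (t - a))).le
  rw [mul_assoc, ← Real.exp_add, show ν * (t - a) + -ν * (t - a) = 0 by ring, Real.exp_zero,
    mul_one] at h3
  linarith

lemma exists_le_of_deriv_le {a b : ℝ} (hab : a < b) {f A : ℝ → ℝ}
    (hf : ∀ t ∈ Icc a b, ∃ f' : ℝ, HasDerivAt f f' t ∧ f' ≤ -A t) :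
    ∃ t ∈ Ioo a b, A t ≤ (f a - f b) / (b - a) := by
  choose! f' hf' hle using hf
  obtain ⟨t, ht, he⟩ := exists_hasDerivAt_eq_slope f f' hab
    (fun s hs => (hf' s hs).continuousAt.continuousWithinAt)
    (fun s hs => hf' s (Ioo_subset_Icc_self hs))
  refine ⟨t, ht, ?_⟩
  have h1 := hle t (Ioo_subset_Icc_self ht)
  have h2 : (f a - f b) / (b - a) = -f' t := by rw [he]; ring
  linarith

lemma le_add_of_deriv_le {a b k : ℝ} (hab : a ≤ b) {f : ℝ → ℝ}
    (hf : ∀ t ∈ Icc a b, ∃ f' : ℝ, HasDerivAt f f' t ∧ f' ≤ k) :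
    f b ≤ f a + k * (b - a) := by
  rcases hab.eq_or_lt with rfl | hlt
  · simp
  obtain ⟨t, -, h⟩ := exists_le_of_deriv_le (A := fun _ => -k) hlt
    (by simpa only [neg_neg] using hf)
  rw [le_div_iff₀ (by linarith)] at h
  linarith

set_option maxHeartbeats 1000000 in
/-- A dissipation mechanism that cannot hold over long time intervals. -/
lemma exists_no_trapped {ν K c₁ ε : ℝ} (hν : 0 < ν) (hK : 0 < K) (hc₁ : 0 < c₁) (hε : 0 < ε) :
    ∃ T > 1, ∃ q > 0, ∀ B : ℝ, ∃ S > T + 1, ∀ (τ : ℝ) (M P E N Q y : ℝ → ℝ),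
      (∀ t ∈ Icc (τ - S) (τ + T), ∃ M', HasDerivAt M M' t ∧ M' ≤ -ν * N t + K * y t + q) →
      (∀ t ∈ Icc (τ - S) (τ + T), ∃ P', HasDerivAt P P' t ∧ P' ≤ -ν * Q t + q) →
      (∀ t ∈ Icc (τ - S) (τ + T), ∃ E', HasDerivAt E E' t ∧ E' ≤ -ε * y t + K * Q t + q) →
      (∀ t ∈ Icc (τ - S) (τ + T), 0 ≤ M t ∧ M t ≤ N t) →
      (∀ t ∈ Icc (τ - S) (τ + T), 0 ≤ P t ∧ P t ≤ Q t) →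
      (∀ t ∈ Icc (τ - S) (τ + T), -K * y t - q ≤ E t ∧ E t ≤ K * N t) →
      (∀ t ∈ Icc (τ - S) (τ + T), 0 ≤ y t ∧ y t ≤ K) →
      (∀ t ∈ Icc (τ - 1) τ, c₁ ≤ y t) → M (τ - S) ≤ B → P (τ - S) ≤ B → False := by
  set M₀ : ℝ := (K ^ 2 + 2) / ν with hM₀
  set N₀ : ℝ := (M₀ + K ^ 2 + 1) / ν with hN₀
  set a : ℝ := ε * ν / (2 * K) with ha
  set e : ℝ := ε / (2 * K) with he
  set k : ℝ := 1 + K / ν + e with hk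
  set G₀ : ℝ := K * N₀ + K / ν * (2 / ν) + e * N₀ with hG₀
  set G₁ : ℝ := G₀ + K ^ 2 + 1 with hG₁
  have hM₀' : 0 < M₀ := by positivity
  have hN₀' : 0 < N₀ := by positivity
  have ha' : 0 < a := by positivity
  have he' : 0 < e := by positivity
  have hk' : 0 < k := by positivity
  have hG₀' : 0 < G₀ := by positivity
  have hG₁' : 0 < G₁ := by positivity
  set α : ℝ := K * (2 / ε) * G₁ + (K + e) / a * G₁ with hα
  have hα' : 0 < α := by positivity
  set T : ℝ := α / (ε * c₁ / 8) + 2 with hT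
  have hT2 : 2 < T := by rw [hT]; linarith [div_pos hα' (by positivity : 0 < ε * c₁ / 8)]
  have hTα : α / (T - 1) ≤ ε * c₁ / 8 := by
    rw [div_le_iff₀ (by linarith)]
    have : α / (ε * c₁ / 8) * (ε * c₁ / 8) = α := by field_simp
    have h8 : 0 < ε * c₁ / 8 := by positivity
    nlinarith
  set b : ℝ := K * (2 / ε) * ((2 * T + 2) * k + k) + 1 + (K + e) / a * k + 2 * K / ν ^ 2 +
    (2 * T + 1) * k with hb
  have hb' : 0 < b := by positivity
  set q : ℝ := min 1 (ε * c₁ / 8 / b) with hq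
  have hq' : 0 < q := by positivity
  have hq1 : q ≤ 1 := min_le_left _ _
  have hqb : b * q ≤ ε * c₁ / 8 := by
    have := mul_le_mul_of_nonneg_left (min_le_right 1 (ε * c₁ / 8 / b)) hb'.le
    rwa [mul_div_cancel₀ _ hb'.ne'] at this
  clear_value q b T α G₁ G₀ k e a N₀ M₀
  refine ⟨T, by linarith, q, hq', fun B => ?_⟩
  set R : ℝ := (|B| + 1) * ν / q / ν with hR
  have hR' : 0 < R := by positivity
  refine ⟨T + 1 + R, by linarith, ?_⟩
  intro τ M P E N Q y hM hP hE hMN hPQ hEy hy hyc hMB hPB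
  set S := T + 1 + R with hS
  clear_value S R
  have hdecay : ∀ t, τ - T - 1 ≤ t → |B| * Real.exp (-ν * (t - (τ - S))) ≤ q / ν := by
    intro t ht
    have h1 : Real.exp (-ν * (t - (τ - S))) ≤ 1 / (1 + ν * R) := by
      rw [neg_mul, Real.exp_neg, ← one_div]
      refine one_div_le_one_div_of_le (by positivity) ?_
      have h2 : ν * R ≤ ν * (t - (τ - S)) := mul_le_mul_of_nonneg_left (by linarith) hν.le
      linarith [Real.add_one_le_exp (ν * (t - (τ - S)))]
    refine (mul_le_mul_of_nonneg_left h1 (abs_nonneg B)).trans ?_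
    rw [mul_one_div, div_le_div_iff₀ (by positivity) hν]
    have h3 : q * (ν * R) = (|B| + 1) * ν := by rw [hR]; field_simp
    have h4 : 0 < q := hq'
    linarith
  have hPle : ∀ t ∈ Icc (τ - T - 1) (τ + T), P t ≤ 2 * q / ν := by
    intro t ht
    have hmem : t ∈ Icc (τ - S) (τ + T) := ⟨by linarith [ht.1], ht.2⟩
    have h1 := le_of_deriv_le_affine hν (f := P) (k := q) (a := τ - S) (b := τ + T)
      (fun s hs => by
        obtain ⟨P', h1, h2⟩ := hP s hs
        refine ⟨P', h1, h2.trans ?_⟩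
        linarith [mul_le_mul_of_nonneg_left (hPQ s hs).2 hν.le]) hmem
    have h2 := hdecay t ht.1
    have h3 : P (τ - S) - q / ν ≤ |B| := by
      have := le_abs_self B
      have : 0 < q / ν := by positivity
      linarith
    have h4 := mul_le_mul_of_nonneg_right h3 (Real.exp_pos (-ν * (t - (τ - S)))).le
    have h5 : 2 * q / ν = q / ν + q / ν := by ring
    linarith
  have hMle : ∀ t ∈ Icc (τ - T - 1) (τ + T), M t ≤ M₀ := by
    intro t ht
    have hmem : t ∈ Icc (τ - S) (τ + T) := ⟨by linarith [ht.1], ht.2⟩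
    have h1 := le_of_deriv_le_affine hν (f := M) (k := K * K + q) (a := τ - S) (b := τ + T)
      (fun s hs => by
        obtain ⟨M', h1, h2⟩ := hM s hs
        refine ⟨M', h1, h2.trans ?_⟩
        have h3 := mul_le_mul_of_nonneg_left (hy s hs).2 hK.le
        linarith [mul_le_mul_of_nonneg_left (hMN s hs).2 hν.le]) hmem
    have h2 := hdecay t ht.1
    have h3 : M (τ - S) - (K * K + q) / ν ≤ |B| := by
      have := le_abs_self B
      have : 0 < (K * K + q) / ν := by positivity
      linarith
    have h4 := mul_le_mul_of_nonneg_right h3 (Real.exp_pos (-ν * (t - (τ - S)))).le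
    have h5 : M₀ = (K * K + 1) / ν + 1 / ν := by rw [hM₀]; ring
    have h6 : q / ν ≤ 1 / ν := by gcongr
    have h7 : (K * K + q) / ν ≤ (K * K + 1) / ν := by gcongr
    linarith
  obtain ⟨s₀, hs₀, hN₀s⟩ : ∃ s ∈ Ioo (τ - T - 1) (τ - T), N s ≤ N₀ := by
    obtain ⟨s, hs, h⟩ := exists_le_of_deriv_le (a := τ - T - 1) (b := τ - T) (f := M)
      (A := fun t => ν * N t - (K ^ 2 + 1)) (by linarith) (fun t ht => by
        have hmem : t ∈ Icc (τ - S) (τ + T) := ⟨by linarith [ht.1], by linarith [ht.2]⟩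
        obtain ⟨M', h1, h2⟩ := hM t hmem
        refine ⟨M', h1, h2.trans ?_⟩
        have h3 := mul_le_mul_of_nonneg_left (hy t hmem).2 hK.le
        rw [← sq] at h3
        linarith)
    refine ⟨s, hs, ?_⟩
    have h1 := hMle (τ - T - 1) ⟨by linarith, by linarith⟩
    have h2 := (hMN (τ - T) ⟨by linarith, by linarith⟩).1
    rw [show τ - T - (τ - T - 1) = 1 by ring, div_one] at h
    rw [hN₀, le_div_iff₀ hν]
    linarith
  set G : ℝ → ℝ := fun t => E t + K / ν * P t + e * M t with hG
  have hGd : ∀ t ∈ Icc (τ - S) (τ + T), ∃ G', HasDerivAt G G' t ∧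
      G' ≤ -(ε / 2) * y t - a * N t + k * q := by
    intro t ht
    obtain ⟨M', hM1, hM2⟩ := hM t ht
    obtain ⟨P', hP1, hP2⟩ := hP t ht
    obtain ⟨E', hE1, hE2⟩ := hE t ht
    refine ⟨_, (hE1.add (hP1.const_mul (K / ν))).add (hM1.const_mul e), ?_⟩
    have h1 := mul_le_mul_of_nonneg_left hP2 (by positivity : 0 ≤ K / ν)
    have h2 := mul_le_mul_of_nonneg_left hM2 he'.le
    have h3 : K / ν * (-ν * Q t + q) = -K * Q t + K / ν * q := by field_simp
    have h4 : e * (-ν * N t + K * y t + q) = -a * N t + ε / 2 * y t + e * q := by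
      rw [he, ha]; field_simp
    rw [hk]
    linarith
  have hGle : ∀ t ∈ Icc (τ - T - 1) (τ + T), G t ≤ (K + e) * N t + K / ν * (2 * q / ν) := by
    intro t ht
    have hmem : t ∈ Icc (τ - S) (τ + T) := ⟨by linarith [ht.1], ht.2⟩
    have h1 := mul_le_mul_of_nonneg_left (hPle t ht) (by positivity : 0 ≤ K / ν)
    have h2 := mul_le_mul_of_nonneg_left (hMN t hmem).2 he'.le
    have h3 := (hEy t hmem).2
    simp only [hG]
    linarith
  have hGge : ∀ t ∈ Icc (τ - S) (τ + T), -K * y t - q ≤ G t := by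
    intro t ht
    have h1 := mul_nonneg (by positivity : 0 ≤ K / ν) (hPQ t ht).1
    have h2 := mul_nonneg he'.le (hMN t ht).1
    have h3 := (hEy t ht).1
    simp only [hG]
    linarith
  have hGge' : ∀ t ∈ Icc (τ - S) (τ + T), -(K ^ 2 + 1) ≤ G t := by
    intro t ht
    have h1 := hGge t ht
    have h3 := mul_le_mul_of_nonneg_left (hy t ht).2 hK.le
    rw [← sq] at h3
    linarith
  have hGs₀ : G s₀ ≤ G₀ := by
    have h1 := hGle s₀ ⟨hs₀.1.le, by linarith [hs₀.2]⟩
    have h2 := mul_le_mul_of_nonneg_left hN₀s (by positivity : 0 ≤ K + e)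
    have h3 : K / ν * (2 * q / ν) ≤ K / ν * (2 / ν) := by
      gcongr
      linarith
    rw [hG₀]
    linarith
  have hkq : 0 < k * q := by positivity
  have hGmono : ∀ s t, τ - S ≤ s → s ≤ t → t ≤ τ + T → G t ≤ G s + k * q * (t - s) := by
    intro s t hs hst ht
    refine le_add_of_deriv_le hst fun x hx => ?_
    have hmem : x ∈ Icc (τ - S) (τ + T) := ⟨hs.trans hx.1, hx.2.trans ht⟩
    obtain ⟨G', h1, h2⟩ := hGd x hmem
    refine ⟨G', h1, h2.trans ?_⟩
    have h3 := mul_nonneg (by positivity : 0 ≤ ε / 2) (hy x hmem).1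
    have h4 := mul_nonneg ha'.le ((hMN x hmem).1.trans (hMN x hmem).2)
    linarith
  obtain ⟨s₁, hs₁, hNs₁⟩ : ∃ s ∈ Ioo s₀ (τ - 1), a * N s ≤ G₁ / (T - 1) + k * q := by
    obtain ⟨s, hs, h⟩ := exists_le_of_deriv_le (a := s₀) (b := τ - 1) (f := G)
      (A := fun t => a * N t - k * q) (by linarith [hs₀.2]) (fun t ht => by
        have hmem : t ∈ Icc (τ - S) (τ + T) :=
          ⟨by linarith [ht.1, hs₀.1], by linarith [ht.2]⟩
        obtain ⟨G', h1, h2⟩ := hGd t hmem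
        refine ⟨G', h1, h2.trans ?_⟩
        have h3 := mul_nonneg (by positivity : 0 ≤ ε / 2) (hy t hmem).1
        linarith)
    refine ⟨s, hs, ?_⟩
    have h1 := hGge' (τ - 1) ⟨by linarith, by linarith⟩
    have h2 : (G s₀ - G (τ - 1)) / (τ - 1 - s₀) ≤ G₁ / (T - 1) :=
      div_le_div₀ hG₁'.le (by rw [hG₁]; linarith) (by linarith) (by linarith [hs₀.2])
    linarith
  have hdrop : G τ ≤ G s₁ + k * q * (T + 1) - ε * c₁ / 2 := by
    have h1 := hGmono s₁ (τ - 1) (by linarith [hs₁.1, hs₀.1]) hs₁.2.le (by linarith)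
    have h2 : G τ ≤ G (τ - 1) + (-(ε / 2) * c₁ + k * q) * (τ - (τ - 1)) := by
      refine le_add_of_deriv_le (by linarith) fun x hx => ?_
      have hmem : x ∈ Icc (τ - S) (τ + T) := ⟨by linarith [hx.1], by linarith [hx.2]⟩
      obtain ⟨G', h1, h2⟩ := hGd x hmem
      refine ⟨G', h1, h2.trans ?_⟩
      have h3 := mul_le_mul_of_nonneg_left (hyc x hx) (by positivity : 0 ≤ ε / 2)
      have h4 := mul_nonneg ha'.le ((hMN x hmem).1.trans (hMN x hmem).2)
      linarith
    have h3 : k * q * (τ - 1 - s₁) ≤ k * q * T :=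
      mul_le_mul_of_nonneg_left (by linarith [hs₁.1, hs₀.1]) hkq.le
    linarith
  have hGτ : G τ ≤ G₀ + k * q * (T + 1) := by
    have h1 := hGmono s₀ τ (by linarith [hs₀.1]) (by linarith [hs₀.2]) (by linarith)
    have h3 : k * q * (τ - s₀) ≤ k * q * (T + 1) :=
      mul_le_mul_of_nonneg_left (by linarith [hs₀.1]) hkq.le
    linarith
  obtain ⟨s₂, hs₂, hys₂⟩ : ∃ s ∈ Ioo τ (τ + T),
      ε / 2 * y s ≤ G₁ / (T - 1) + (2 * T + 2) * (k * q) + k * q := by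
    obtain ⟨s, hs, h⟩ := exists_le_of_deriv_le (a := τ) (b := τ + T) (f := G)
      (A := fun t => ε / 2 * y t - k * q) (by linarith) (fun t ht => by
        have hmem : t ∈ Icc (τ - S) (τ + T) := ⟨by linarith [ht.1], ht.2⟩
        obtain ⟨G', h1, h2⟩ := hGd t hmem
        refine ⟨G', h1, h2.trans ?_⟩
        have h4 := mul_nonneg ha'.le ((hMN t hmem).1.trans (hMN t hmem).2)
        linarith)
    refine ⟨s, hs, ?_⟩
    have h1 := hGge' (τ + T) ⟨by linarith, le_rfl⟩
    have h2 : (G τ - G (τ + T)) / (τ + T - τ) ≤ G₁ / (T - 1) + (2 * T + 2) * (k * q) := by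
      have h3 : (G τ - G (τ + T)) / (τ + T - τ) ≤ (G₁ + k * q * (T + 1)) / (T - 1) :=
        div_le_div₀ (by positivity) (by rw [hG₁]; linarith) (by linarith) (by linarith)
      have h4 : k * q * (T + 1) / (T - 1) ≤ (2 * T + 2) * (k * q) := by
        rw [div_le_iff₀ (by linarith)]
        nlinarith [mul_pos hkq (by linarith : 0 < T + 1)]
      rw [add_div] at h3
      linarith
    linarith
  have hs₁' : s₁ ∈ Icc (τ - T - 1) (τ + T) := ⟨by linarith [hs₁.1, hs₀.1], by linarith [hs₁.2]⟩
  have hN₁ : N s₁ ≤ (G₁ / (T - 1) + k * q) / a := by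
    rw [le_div_iff₀ ha']
    linarith
  have hy₂ : y s₂ ≤ 2 / ε * (G₁ / (T - 1) + (2 * T + 2) * (k * q) + k * q) := by
    have h1 := mul_le_mul_of_nonneg_left hys₂ (by positivity : 0 ≤ 2 / ε)
    rwa [← mul_assoc, show 2 / ε * (ε / 2) = 1 by field_simp, one_mul] at h1
  have f1 := hGle s₁ hs₁'
  have f2 := mul_le_mul_of_nonneg_left hN₁ (by positivity : 0 ≤ K + e)
  have f3 := hGge s₂ ⟨by linarith [hs₂.1], hs₂.2.le⟩
  have f4 := mul_le_mul_of_nonneg_left hy₂ hK.le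
  have f5 := hGmono τ s₂ (by linarith) hs₂.1.le hs₂.2.le
  have f6 : k * q * (s₂ - τ) ≤ k * q * T :=
    mul_le_mul_of_nonneg_left (by linarith [hs₂.2]) hkq.le
  have f7 : ε * c₁ / 2 ≤ α / (T - 1) + b * q := by
    have e1 : α / (T - 1) + b * q =
        K * (2 / ε * (G₁ / (T - 1) + (2 * T + 2) * (k * q) + k * q)) + q +
        (K + e) * ((G₁ / (T - 1) + k * q) / a) + K / ν * (2 * q / ν) + (2 * T + 1) * (k * q) := by
      rw [hα, hb]
      ring
    rw [e1]
    linarith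
  have : 0 < ε * c₁ := by positivity
  linarith

end DifferentialInequalities

section Chain

/-- A function with bounded upward jumps that always climbs within a bounded time window is,
up to a bounded error, either increasing or decreasing. -/
lemma chain_dichotomy {g : ℝ → ℝ} {A T t₀ : ℝ} (hA : 0 ≤ A) (hT : 0 < T) (ht₀ : 0 ≤ t₀)
    (hup : ∀ t ≥ 0, ∀ s ≥ 0, g (t + s) ≤ g t + A * (s + 1))
    (hbd : ∀ b, ∃ m, ∀ t ∈ Icc 0 b, m ≤ g t)
    (hclimb : ∀ t ≥ t₀, ∃ x ≥ 0, x ∈ Icc (t - T) (t + T) ∧ g t + 1 < g x) :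
    (∃ B, ∀ t ≥ 0, ∀ s ≥ 0, g t - B ≤ g (t + s)) ∨
    (∃ B, ∀ t ≥ 0, ∀ s ≥ 0, g (t + s) ≤ g t + B) := by
  have hup' : ∀ x y, 0 ≤ x → x ≤ y → g y ≤ g x + A * (y - x + 1) := fun x y hx hxy => by
    simpa using hup x hx (y - x) (by linarith)
  -- near-maximizers on compact intervals
  have hmax : ∀ x y, 0 ≤ x → x ≤ y → ∃ z ∈ Icc x y, ∀ w ∈ Icc x y, g w ≤ g z + 1 / 2 := by
    intro x y hx hxy
    have hne : (g '' Icc x y).Nonempty := ⟨g x, x, left_mem_Icc.2 hxy, rfl⟩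
    have hba : BddAbove (g '' Icc x y) := by
      refine ⟨g x + A * (y - x + 1), ?_⟩
      rintro _ ⟨w, hw, rfl⟩
      refine (hup' x w hx hw.1).trans ?_
      have := mul_le_mul_of_nonneg_left (by linarith [hw.2] : w - x + 1 ≤ y - x + 1) hA
      linarith
    obtain ⟨_, ⟨z, hz, rfl⟩, hlt⟩ := exists_lt_of_lt_csSup hne
      (by linarith : sSup (g '' Icc x y) - 1 / 2 < sSup (g '' Icc x y))
    exact ⟨z, hz, fun w hw => by linarith [le_csSup hba (mem_image_of_mem g hw)]⟩
  by_cases hP : ∃ t ≥ t₀, ∀ x ∈ Icc (t - T) t, 0 ≤ x → g x ≤ g t + 1 / 2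
  · left
    -- one step of the chain
    have hstep : ∀ t : {t : ℝ // t₀ ≤ t ∧ ∀ x ∈ Icc (t - T) t, 0 ≤ x → g x ≤ g t + 1 / 2},
        ∃ t' : {t : ℝ // t₀ ≤ t ∧ ∀ x ∈ Icc (t - T) t, 0 ≤ x → g x ≤ g t + 1 / 2},
          t.1 < t'.1 ∧ t'.1 ≤ t.1 + T ∧ g t.1 + 1 / 2 ≤ g t'.1 := by
      rintro ⟨t, ht, hPt⟩
      obtain ⟨x, hx0, hx, hgx⟩ := hclimb t ht
      have htx : t < x := by
        by_contra! h
        linarith [hPt x ⟨hx.1, h⟩ hx0]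
      obtain ⟨z, hz, hzm⟩ := hmax t (t + T) (by linarith) (by linarith)
      have h1 := hzm x ⟨htx.le, hx.2⟩
      have hne : t ≠ z := by
        intro h
        rw [← h] at h1
        linarith
      have hgz : g t + 1 / 2 ≤ g z := by linarith
      refine ⟨⟨z, ht.trans hz.1, fun w hw hw0 => ?_⟩, lt_of_le_of_ne hz.1 hne, hz.2, hgz⟩
      rcases le_total t w with h | h
      · exact hzm w ⟨h, hw.2.trans hz.2⟩
      · linarith [hPt w ⟨by linarith [hw.1, hz.1], h⟩ hw0]
    obtain ⟨t, ht, hPt⟩ := hP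
    choose next hn1 hn2 hn3 using hstep
    set σ : ℕ → {t : ℝ // t₀ ≤ t ∧ ∀ x ∈ Icc (t - T) t, 0 ≤ x → g x ≤ g t + 1 / 2} :=
      fun k => next^[k] ⟨t, ht, hPt⟩ with hσ
    have hσs : ∀ k, σ (k + 1) = next (σ k) := fun k => by
      simp only [hσ, Function.iterate_succ_apply']
    have hσ0 : (σ 0).1 = t := rfl
    have hmono : Monotone fun k => (σ k).1 := monotone_nat_of_le_succ fun k => by
      rw [hσs]; exact (hn1 _).le
    have hgmono : Monotone fun k => g (σ k).1 := monotone_nat_of_le_succ fun k => by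
      simp only [hσs]
      linarith [hn3 (σ k)]
    have hgrow : ∀ k : ℕ, g t + k / 2 ≤ g (σ k).1 := by
      intro k
      induction k with
      | zero => simp [hσ0]
      | succ k ih => rw [hσs]; push_cast; linarith [hn3 (σ k)]
    have hunb : ∀ x : ℝ, ∃ k, x < (σ k).1 := by
      intro x
      by_contra! h
      obtain ⟨k, hk⟩ := exists_nat_gt (2 * (A * (x - t + 1)))
      have h1 := hup' t (σ k).1 (by linarith) (hmono (Nat.zero_le k))
      have h2 := mul_le_mul_of_nonneg_left (by linarith [h k] : (σ k).1 - t + 1 ≤ x - t + 1) hA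
      linarith [hgrow k]
    have hbracket : ∀ x ≥ t, ∃ k, (σ k).1 ≤ x ∧ x < (σ (k + 1)).1 := by
      intro x hx
      classical
      have hex := hunb x
      set k := Nat.find hex with hk
      have hk1 : x < (σ k).1 := Nat.find_spec hex
      have hk0 : k ≠ 0 := by
        intro h
        rw [h, hσ0] at hk1
        linarith
      obtain ⟨j, hj⟩ := Nat.exists_eq_succ_of_ne_zero hk0
      refine ⟨j, ?_, by rw [← Nat.succ_eq_add_one, ← hj]; exact hk1⟩
      by_contra! h
      have := Nat.find_min' hex h
      omega
    obtain ⟨m, hm⟩ := hbd (t + T)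
    have hlate : ∀ x ≥ t, ∀ y ≥ x, g x - 2 * A * (T + 1) ≤ g y := by
      intro x hx y hy
      obtain ⟨i, hi1, hi2⟩ := hbracket x hx
      obtain ⟨j, hj1, hj2⟩ := hbracket y (hx.trans hy)
      have hti : t ≤ (σ i).1 := hmono (Nat.zero_le i)
      have hwi : (σ (i + 1)).1 ≤ (σ i).1 + T := by rw [hσs]; exact hn2 _
      have hwj : (σ (j + 1)).1 ≤ (σ j).1 + T := by rw [hσs]; exact hn2 _
      have hij : i < j + 1 := by
        by_contra! h
        have h4 : (σ (j + 1)).1 ≤ (σ i).1 := hmono h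
        linarith
      have h1 := hup' (σ i).1 x (by linarith) hi1
      have h2 := hup' y (σ (j + 1)).1 (by linarith) hj2.le
      have h3 : g (σ i).1 ≤ g (σ (j + 1)).1 := hgmono hij.le
      have h5 := mul_le_mul_of_nonneg_left (by linarith : x - (σ i).1 + 1 ≤ T + 1) hA
      have h6 := mul_le_mul_of_nonneg_left (by linarith : (σ (j + 1)).1 - y + 1 ≤ T + 1) hA
      linarith
    have htop : ∀ x ∈ Icc 0 t, g x ≤ g 0 + A * (t + 1) := fun x hx => by
      have h1 := hup' 0 x le_rfl hx.1
      have h2 := mul_le_mul_of_nonneg_left (by linarith [hx.2] : x - 0 + 1 ≤ t + 1) hA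
      linarith
    have htm : m ≤ g t := hm t ⟨by linarith, by linarith⟩
    refine ⟨2 * A * (T + 1) + (g 0 + A * (t + 1) - m), fun x hx s hs => ?_⟩
    have hAT : 0 ≤ 2 * A * (T + 1) := by positivity
    have h0 : m ≤ g 0 + A * (t + 1) := htm.trans (htop t ⟨by linarith, le_rfl⟩)
    rcases le_total t x with h | h
    · linarith [hlate x h (x + s) (by linarith)]
    · have h1 := htop x ⟨hx, h⟩
      rcases le_total t (x + s) with h' | h'
      · linarith [hlate t le_rfl (x + s) h']
      · linarith [hm (x + s) ⟨by linarith, by linarith⟩]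
  · right
    push Not at hP
    obtain ⟨m, hm⟩ := hbd t₀
    have hlate : ∀ x ≥ t₀, ∀ y ≥ x, g y ≤ g x + A * (T + 1) + 1 / 2 := by
      intro x hx y hy
      obtain ⟨z, hz, hzm⟩ := hmax x y (by linarith) hy
      obtain ⟨w, hw, hw0, hgw⟩ := hP z (by linarith [hz.1])
      have hwx : w < x := by
        by_contra! h
        linarith [hzm w ⟨h, hw.2.trans hz.2⟩]
      have h1 := hup' x z (by linarith) hz.1
      have h2 := mul_le_mul_of_nonneg_left (by linarith [hw.1] : z - x + 1 ≤ T + 1) hA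
      linarith [hzm y ⟨hy, le_rfl⟩]
    refine ⟨A * (T + 1) + 1 / 2 + A * (t₀ + 1) + (A * (t₀ + 1)), fun x hx s hs => ?_⟩
    have hA0 : 0 ≤ A * (t₀ + 1) := by positivity
    have hAT : 0 ≤ A * (T + 1) := by positivity
    rcases le_total t₀ x with h | h
    · linarith [hlate x h (x + s) (by linarith)]
    · rcases le_total t₀ (x + s) with h' | h'
      · have h1 := hlate t₀ le_rfl (x + s) h'
        have h2 := hup' x t₀ hx h
        have h3 := mul_le_mul_of_nonneg_left (by linarith : t₀ - x + 1 ≤ t₀ + 1) hA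
        linarith
      · have h2 := hup x hx s hs
        have h3 := mul_le_mul_of_nonneg_left (by linarith : s + 1 ≤ t₀ + 1) hA
        linarith

end Chain

section Firewall

lemma integral_exp_abs {κ : ℝ} (hκ : 0 < κ) (ρ : ℝ) :
    Integrable (fun r => Real.exp (-κ * |r - ρ|)) ∧
      ∫ r, Real.exp (-κ * |r - ρ|) = 2 / κ := by
  have h1 : ∫ r, Real.exp (-κ * |r|) = 2 / κ := by
    rw [integral_comp_abs (f := fun x => Real.exp (-κ * x)), integral_exp_mul_Ioi (by linarith)]
    simp only [mul_zero, Real.exp_zero]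
    field_simp
  have h2 : Integrable fun r => Real.exp (-κ * |r|) := by
    by_contra h
    rw [integral_undef h] at h1
    have : 0 < 2 / κ := by positivity
    linarith
  exact ⟨h2.comp_sub_right ρ, by rw [integral_sub_right_eq_self (fun r => Real.exp (-κ * |r|)), h1]⟩

lemma setIntegral_exp_abs_le {κ : ℝ} (hκ : 0 < κ) (ρ L : ℝ) {s : Set ℝ} (hs : MeasurableSet s)
    (hL : ∀ r ∈ s, L ≤ |r - ρ|) :
    ∫ r in s, Real.exp (-κ * |r - ρ|) ≤ 4 / κ * Real.exp (-κ / 2 * L) := by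
  obtain ⟨hi, -⟩ := integral_exp_abs hκ ρ
  obtain ⟨hi', he'⟩ := integral_exp_abs (half_pos hκ) ρ
  calc ∫ r in s, Real.exp (-κ * |r - ρ|)
      ≤ ∫ r in s, Real.exp (-κ / 2 * L) * Real.exp (-(κ / 2) * |r - ρ|) := by
        refine setIntegral_mono_on hi.integrableOn (hi'.integrableOn.const_mul _) hs fun r hr => ?_
        rw [← Real.exp_add]
        refine Real.exp_le_exp.2 ?_
        nlinarith [hL r hr]
    _ = Real.exp (-κ / 2 * L) * ∫ r in s, Real.exp (-(κ / 2) * |r - ρ|) := integral_const_mul _ _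
    _ ≤ Real.exp (-κ / 2 * L) * (2 / (κ / 2)) := by
        rw [← he']
        refine mul_le_mul_of_nonneg_left ?_ (Real.exp_pos _).le
        exact setIntegral_le_integral hi' (Eventually.of_forall fun r => (Real.exp_pos _).le)
    _ = _ := by field_simp; ring

variable {d : ℕ} {V : Euc n → ℝ} {u : ℝ → ℝ → Euc n} {C l ρ r t : ℝ}

lemma kappa0_pos (hl : 0 < l) : 0 < kappa0 l := by unfold kappa0; positivity

lemma rsc_pos (hd : 2 ≤ d) (l : ℝ) : 0 < rsc d l := by
  have : (2 : ℝ) ≤ d := by exact_mod_cast hd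
  exact lt_max_of_lt_left (by linarith)

lemma Tpsi_nonneg (hd : 2 ≤ d) (hr : 0 ≤ r) : 0 ≤ Tpsi d l ρ r := by
  have := rsc_pos hd l
  unfold Tpsi
  split_ifs <;> positivity

lemma Tpsi_le (hd : 2 ≤ d) (hr : 0 ≤ r) : Tpsi d l ρ r ≤ Real.exp (-(kappa0 l) * |r - ρ|) := by
  have h := rsc_pos hd l
  unfold Tpsi
  split_ifs with h1
  · refine mul_le_of_le_one_right (Real.exp_pos _).le (pow_le_one₀ (by positivity) ?_)
    rwa [div_le_one h]
  · exact le_rfl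

lemma Tpsi_eq (hd : 2 ≤ d) (hr : rsc d l ≤ r) :
    Tpsi d l ρ r = Real.exp (-(kappa0 l) * |r - ρ|) := by
  have h := rsc_pos hd l
  unfold Tpsi
  split_ifs with h1
  · rw [le_antisymm h1 hr, div_self h.ne', one_pow, mul_one]
  · rfl

lemma measurable_Tpsi (d : ℕ) (l ρ : ℝ) : Measurable (Tpsi d l ρ) := by
  unfold Tpsi
  refine Measurable.ite measurableSet_Iic ?_ ?_ <;> fun_prop

lemma integrableOn_Tpsi (hd : 2 ≤ d) (hl : 0 < l) (ρ : ℝ) : IntegrableOn (Tpsi d l ρ) (Ici 0) := by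
  refine (integral_exp_abs (kappa0_pos hl) ρ).1.integrableOn.mono'
    (measurable_Tpsi d l ρ).aestronglyMeasurable ?_
  refine (ae_restrict_iff' measurableSet_Ici).2 (Eventually.of_forall fun r hr => ?_)
  rw [Real.norm_of_nonneg (Tpsi_nonneg hd hr)]
  exact Tpsi_le hd hr

/-- The weight has little mass on sets far from its centre. -/
lemma setIntegral_Tpsi_le (hd : 2 ≤ d) (hl : 0 < l) (ρ L : ℝ) {s : Set ℝ} (hs : MeasurableSet s)
    (hs0 : s ⊆ Ici 0) (hL : ∀ r ∈ s, L ≤ |r - ρ|) :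
    ∫ r in s, Tpsi d l ρ r ≤ 4 / kappa0 l * Real.exp (-(kappa0 l) / 2 * L) :=
  (setIntegral_mono_on ((integrableOn_Tpsi hd hl ρ).mono_set hs0)
    (integral_exp_abs (kappa0_pos hl) ρ).1.integrableOn hs fun _ hr => Tpsi_le hd (hs0 hr)).trans
    (setIntegral_exp_abs_le (kappa0_pos hl) ρ L hs hL)

namespace IsRadialSolution

lemma integrableOn_firewall (hu : IsRadialSolution d V u) (hd : 2 ≤ d) (hl : 0 < l)
    (hV : ContDiff ℝ 2 V) (hC : UniformlyBounded u C) (ρ : ℝ) (ht : 0 < t) :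
    IntegrableOn (fun r => Tpsi d l ρ r *
      (wV V * (‖ur u r t‖ ^ 2 / 2 + V (u r t)) + ‖u r t‖ ^ 2 / 2)) (Ioi 0) := by
  have hVc := hV.continuous
  obtain ⟨B, hB⟩ := (isCompact_closedBall (0 : Euc n) C).exists_bound_of_continuousOn
    hVc.continuousOn
  have h1 := hu.continuous_r ht
  have h2 := hu.continuous_ur ht
  have hw := wV_pos V
  refine ((integrableOn_Tpsi hd hl ρ).mono_set Ioi_subset_Ici_self).mul_bdd
    (c := wV V * (C ^ 2 / 2 + B) + C ^ 2 / 2)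
    (Continuous.aestronglyMeasurable (by fun_prop)) ?_
  refine (ae_restrict_iff' measurableSet_Ioi).2 (Eventually.of_forall fun r hr => ?_)
  have hr0 : 0 ≤ r := le_of_lt hr
  have hVB : |V (u r t)| ≤ B := hB _ (by simpa using hC.norm_le hr0 ht)
  have hp : ‖ur u r t‖ ^ 2 ≤ C ^ 2 := by have := hC.ur_le hr0 ht; gcongr
  have hx : ‖u r t‖ ^ 2 ≤ C ^ 2 := by have := hC.norm_le hr0 ht; gcongr
  have h3 : |‖ur u r t‖ ^ 2 / 2 + V (u r t)| ≤ C ^ 2 / 2 + B := by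
    refine (abs_add_le _ _).trans (add_le_add ?_ hVB)
    rw [abs_of_nonneg (by positivity)]
    linarith
  refine (abs_add_le _ _).trans (add_le_add ?_ ?_)
  · rw [abs_mul, abs_of_pos hw]
    exact mul_le_mul_of_nonneg_left h3 hw.le
  · rw [abs_of_nonneg (by positivity)]
    linarith

lemma F0_nonneg (hd : 2 ≤ d) (hV : ContDiff ℝ 2 V) (hco : HCoerc V) (D : EscData n V)
    (h0 : (0 : Euc n) ∈ MinSet V) (hV0 : V 0 = 0) (u : ℝ → ℝ → Euc n) (l ρ t : ℝ) :
    0 ≤ F0 V d l u ρ t := by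
  refine setIntegral_nonneg measurableSet_Ioi fun r hr => ?_
  refine mul_nonneg (Tpsi_nonneg hd (le_of_lt hr)) (le_trans ?_
    (firewall_integrand_ge hV hco D h0 hV0 _ _))
  have := wV_pos V
  positivity

/-- The firewall functional controls the solution pointwise. -/
lemma norm_sq_le_F0 (hu : IsRadialSolution d V u) (hd : 2 ≤ d) (hl : 0 < l)
    (hV : ContDiff ℝ 2 V) (hco : HCoerc V) (D : EscData n V) (h0 : (0 : Euc n) ∈ MinSet V)
    (hV0 : V 0 = 0) (hC : UniformlyBounded u C) (hρ : rsc d l ≤ ρ) (ht : 0 < t) :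
    min (wV V / 2) (1 / 4) * ‖u ρ t‖ ^ 2 ≤ (kappa0 l + 1) * F0 V d l u ρ t := by
  have hκ := kappa0_pos hl
  set κ := kappa0 l with hκdef
  have hρ0 : 0 < ρ := (rsc_pos hd l).trans_le hρ
  set m := min (wV V / 2) (1 / 4) with hm
  have hm0 : 0 < m := by have := wV_pos V; positivity
  have hcu := hu.continuous_r ht
  have hcur := hu.continuous_ur ht
  obtain ⟨hie, -⟩ := integral_exp_neg_sub_Ioi hκ ρ ρ
  set g : ℝ → ℝ := fun r => -(Real.exp (-κ * (r - ρ)) * ‖u r t‖ ^ 2) with hg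
  set g' : ℝ → ℝ := fun r => Real.exp (-κ * (r - ρ)) *
    (κ * ‖u r t‖ ^ 2 - 2 * ⟪u r t, ur u r t⟫) with hg'
  have hgd : ∀ r ∈ Ici ρ, HasDerivAt g (g' r) r := by
    intro r _
    have h1 : HasDerivAt (fun r => -κ * (r - ρ)) (-κ) r := by
      simpa using ((hasDerivAt_id r).sub_const ρ).const_mul (-κ)
    refine (h1.exp.fun_mul (hu.hasDerivAt_r ht r).norm_sq).fun_neg.congr_deriv ?_
    simp only [hg']
    ring
  have hbound : ∀ r ≥ ρ, |κ * ‖u r t‖ ^ 2 - 2 * ⟪u r t, ur u r t⟫| ≤ (κ + 2) * C ^ 2 := by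
    intro r hr
    have hr0 : 0 ≤ r := by linarith
    refine (abs_sub _ _).trans ?_
    rw [abs_of_nonneg (by positivity), abs_mul, abs_two]
    have h1 := (abs_real_inner_le_norm (u r t) (ur u r t)).trans
      (mul_le_mul (hC.norm_le hr0 ht) (hC.ur_le hr0 ht) (norm_nonneg _) hC.nonneg)
    have h2 : κ * ‖u r t‖ ^ 2 ≤ κ * C ^ 2 := by gcongr; exact hC.norm_le hr0 ht
    nlinarith
  have hig : IntegrableOn g' (Ioi ρ) := by
    refine hie.mul_bdd (c := (κ + 2) * C ^ 2) (Continuous.aestronglyMeasurable (by fun_prop)) ?_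
    exact (ae_restrict_iff' measurableSet_Ioi).2
      (Eventually.of_forall fun r hr => hbound r (le_of_lt hr))
  have hiG : IntegrableOn (fun r => Real.exp (-κ * (r - ρ)) *
      (‖u r t‖ ^ 2 + ‖ur u r t‖ ^ 2)) (Ioi ρ) := by
    refine hie.mul_bdd (c := C ^ 2 + C ^ 2) (Continuous.aestronglyMeasurable (by fun_prop)) ?_
    refine (ae_restrict_iff' measurableSet_Ioi).2 (Eventually.of_forall fun r hr => ?_)
    have hr0 : 0 ≤ r := hρ0.le.trans (le_of_lt hr)
    rw [Real.norm_of_nonneg (by positivity)]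
    have h1 := hC.norm_le hr0 ht
    have h2 := hC.ur_le hr0 ht
    gcongr
  have hlim : Tendsto g atTop (𝓝 0) := by
    have h1 : Tendsto (fun r => Real.exp (-κ * (r - ρ)) * C ^ 2) atTop (𝓝 (0 * C ^ 2)) := by
      refine Tendsto.mul_const _ (Real.tendsto_exp_atBot.comp ?_)
      exact (tendsto_atTop_add_const_right _ (-ρ) tendsto_id).const_mul_atTop_of_neg (by linarith)
    rw [zero_mul] at h1
    refine squeeze_zero_norm' ?_ h1
    filter_upwards [eventually_ge_atTop 0] with r hr
    simp only [hg]
    rw [norm_neg, Real.norm_of_nonneg (by positivity)]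
    gcongr
    exact hC.norm_le hr ht
  have hint := integral_Ioi_of_hasDerivAt_of_tendsto' hgd hig hlim
  have hg0 : g ρ = -‖u ρ t‖ ^ 2 := by simp [hg]
  rw [hg0, sub_neg_eq_add, zero_add] at hint
  have h1 : ‖u ρ t‖ ^ 2 ≤ (κ + 1) * ∫ r in Ioi ρ, Real.exp (-κ * (r - ρ)) *
      (‖u r t‖ ^ 2 + ‖ur u r t‖ ^ 2) := by
    rw [← hint, ← integral_const_mul]
    refine setIntegral_mono_on hig (hiG.const_mul _) measurableSet_Ioi fun r _ => ?_
    have h2 : κ * ‖u r t‖ ^ 2 - 2 * ⟪u r t, ur u r t⟫ ≤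
        (κ + 1) * (‖u r t‖ ^ 2 + ‖ur u r t‖ ^ 2) := by
      have h3 := neg_le_of_abs_le (abs_real_inner_le_norm (u r t) (ur u r t))
      nlinarith [sq_nonneg (‖u r t‖ - ‖ur u r t‖), sq_nonneg ‖ur u r t‖]
    have := mul_le_mul_of_nonneg_left h2 (Real.exp_pos (-κ * (r - ρ))).le
    simp only [hg']
    linarith
  have h2 : m * ∫ r in Ioi ρ, Real.exp (-κ * (r - ρ)) * (‖u r t‖ ^ 2 + ‖ur u r t‖ ^ 2) ≤
      F0 V d l u ρ t := by
    have hiF := hu.integrableOn_firewall hd hl hV hC ρ ht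
    have hsub : Ioi ρ ⊆ Ioi 0 := Ioi_subset_Ioi hρ0.le
    have h3 : ∫ r in Ioi ρ, Tpsi d l ρ r *
        (wV V * (‖ur u r t‖ ^ 2 / 2 + V (u r t)) + ‖u r t‖ ^ 2 / 2) ≤ F0 V d l u ρ t := by
      refine setIntegral_mono_set hiF ?_ hsub.eventuallyLE
      refine (ae_restrict_iff' measurableSet_Ioi).2 (Eventually.of_forall fun r hr => ?_)
      exact mul_nonneg (Tpsi_nonneg hd (le_of_lt hr)) (le_trans (by positivity)
        (firewall_integrand_ge hV hco D h0 hV0 _ _))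
    refine le_trans ?_ h3
    rw [← integral_const_mul]
    refine setIntegral_mono_on (hiG.const_mul _) (hiF.mono_set hsub) measurableSet_Ioi
      fun r hr => ?_
    have hr' : ρ < r := hr
    rw [Tpsi_eq hd (hρ.trans hr'.le), abs_of_pos (sub_pos.2 hr')]
    have := mul_le_mul_of_nonneg_left (firewall_integrand_ge hV hco D h0 hV0 (u r t) (ur u r t))
      (Real.exp_pos (-κ * (r - ρ))).le
    linarith
  have h3 := mul_le_mul_of_nonneg_left h1 hm0.le
  have h4 := mul_le_mul_of_nonneg_left h2 (by positivity : 0 ≤ κ + 1)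
  linarith

/-- The firewall functional is controlled by the solution in a window around its centre. -/
lemma exists_F0_le (hu : IsRadialSolution d V u) (hd : 2 ≤ d) (hl : 0 < l)
    (hV : ContDiff ℝ 2 V) (h0 : (0 : Euc n) ∈ MinSet V) (hV0 : V 0 = 0)
    (hC : UniformlyBounded u C) :
    ∃ B : ℝ, 0 < B ∧ ∀ A ρ t, 0 ≤ A → A ≤ ρ → 0 < t → F0 V d l u ρ t ≤
      B * ((∫ r in (ρ - A)..(ρ + A), (‖u r t‖ ^ 2 + ‖ur u r t‖ ^ 2)) +
        Real.exp (-(kappa0 l) / 2 * A)) := by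
  obtain ⟨Λ, hΛ, -, -, hpot⟩ := exists_quadratic_bounds hV h0.1 hV0 C
  have hκ := kappa0_pos hl
  have hw := wV_pos V
  have hw1 := wV_le_one V
  refine ⟨(1 + Λ) * (1 + 2 * C ^ 2 * (4 / kappa0 l)), by positivity, ?_⟩
  intro A ρ t hA hAρ ht
  have hcu := hu.continuous_r ht
  have hcur := hu.continuous_ur ht
  set G : ℝ → ℝ := fun r => ‖u r t‖ ^ 2 + ‖ur u r t‖ ^ 2 with hG
  have hGc : Continuous G := by fun_prop
  have hG0 : ∀ r, 0 ≤ G r := fun r => by positivity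
  have hGle : ∀ r ≥ 0, G r ≤ 2 * C ^ 2 := fun r hr => by
    have h1 : ‖u r t‖ ^ 2 ≤ C ^ 2 := by have := hC.norm_le hr ht; gcongr
    have h2 : ‖ur u r t‖ ^ 2 ≤ C ^ 2 := by have := hC.ur_le hr ht; gcongr
    simp only [hG]; linarith
  have hI : ∀ r ≥ 0, wV V * (‖ur u r t‖ ^ 2 / 2 + V (u r t)) + ‖u r t‖ ^ 2 / 2 ≤
      (1 + Λ) * G r := by
    intro r hr
    have h1 := (le_abs_self _).trans (hpot _ (hC.norm_le hr ht))
    have h2 : wV V * (‖ur u r t‖ ^ 2 / 2 + V (u r t)) ≤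
        1 * (‖ur u r t‖ ^ 2 / 2 + Λ * ‖u r t‖ ^ 2) :=
      (mul_le_mul_of_nonneg_left (by linarith) hw.le).trans
        (mul_le_mul_of_nonneg_right hw1 (by positivity))
    simp only [hG]
    nlinarith [sq_nonneg ‖ur u r t‖, sq_nonneg ‖u r t‖]
  set S : Set ℝ := Icc (ρ - A) (ρ + A) with hS
  have hmS : MeasurableSet S := measurableSet_Icc
  have hiE := (integral_exp_abs hκ ρ).1
  have hiG : Integrable (S.indicator G) := hGc.integrableOn_Icc.integrable_indicator hmS
  have hiE' : Integrable (Sᶜ.indicator fun r => Real.exp (-(kappa0 l) * |r - ρ|)) :=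
    hiE.indicator hmS.compl
  have hpt : ∀ r ∈ Ioi (0 : ℝ), Tpsi d l ρ r *
      (wV V * (‖ur u r t‖ ^ 2 / 2 + V (u r t)) + ‖u r t‖ ^ 2 / 2) ≤
      (1 + Λ) * S.indicator G r + (1 + Λ) * (2 * C ^ 2) *
        Sᶜ.indicator (fun r => Real.exp (-(kappa0 l) * |r - ρ|)) r := by
    intro r hr
    have hr0 : 0 ≤ r := le_of_lt hr
    have hT := Tpsi_nonneg (l := l) (ρ := ρ) hd hr0
    have hT' := Tpsi_le (l := l) (ρ := ρ) hd hr0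
    have h1 := mul_le_mul_of_nonneg_left (hI r hr0) hT
    have h1G : 0 ≤ (1 + Λ) * G r := mul_nonneg (by positivity) (hG0 r)
    refine h1.trans ?_
    by_cases hmem : r ∈ S
    · rw [indicator_of_mem hmem, indicator_of_notMem (by simpa using hmem)]
      have : Tpsi d l ρ r ≤ 1 := hT'.trans (Real.exp_le_one_iff.2 (by
        have := abs_nonneg (r - ρ); nlinarith))
      linarith [mul_le_of_le_one_left h1G this]
    · rw [indicator_of_notMem hmem, indicator_of_mem (by simpa using hmem)]
      have h2 := mul_le_mul_of_nonneg_left (hGle r hr0) (by positivity : 0 ≤ 1 + Λ)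
      have h3 := mul_le_mul hT' h2 h1G (Real.exp_pos _).le
      linarith
  have hmono := setIntegral_mono_on (hu.integrableOn_firewall hd hl hV hC ρ ht)
    ((hiG.const_mul (1 + Λ)).add (hiE'.const_mul ((1 + Λ) * (2 * C ^ 2)))).integrableOn
    measurableSet_Ioi hpt
  simp only [Pi.add_apply] at hmono
  rw [integral_add (hiG.const_mul _).integrableOn (hiE'.const_mul _).integrableOn,
    integral_const_mul, integral_const_mul] at hmono
  have e1 : ∫ r in Ioi 0, S.indicator G r ≤ ∫ r in (ρ - A)..(ρ + A), G r := by
    rw [intervalIntegral.integral_of_le (by linarith), ← integral_Icc_eq_integral_Ioc,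
      ← integral_indicator hmS]
    exact setIntegral_le_integral hiG (Eventually.of_forall fun r =>
      indicator_nonneg (fun r _ => hG0 r) r)
  have e2 : ∫ r in Ioi 0, Sᶜ.indicator (fun r => Real.exp (-(kappa0 l) * |r - ρ|)) r ≤
      4 / kappa0 l * Real.exp (-(kappa0 l) / 2 * A) := by
    refine (setIntegral_le_integral hiE' (Eventually.of_forall fun r =>
      indicator_nonneg (fun r _ => (Real.exp_pos _).le) r)).trans ?_
    rw [integral_indicator hmS.compl]
    refine setIntegral_exp_abs_le hκ ρ A hmS.compl fun r hr => ?_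
    by_contra! h
    rw [abs_lt] at h
    exact hr ⟨by linarith, by linarith⟩
  have h1Λ : 0 ≤ 1 + Λ := by positivity
  have f1 := mul_le_mul_of_nonneg_left e1 h1Λ
  have f2 := mul_le_mul_of_nonneg_left e2 (by positivity : 0 ≤ (1 + Λ) * (2 * C ^ 2))
  have hI0 : 0 ≤ ∫ r in (ρ - A)..(ρ + A), G r :=
    intervalIntegral.integral_nonneg (by linarith) fun r _ => hG0 r
  have p1 : 0 ≤ (1 + Λ) * (2 * C ^ 2 * (4 / kappa0 l)) * ∫ r in (ρ - A)..(ρ + A), G r := by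
    positivity
  have p2 : 0 ≤ (1 + Λ) * Real.exp (-(kappa0 l) / 2 * A) := by positivity
  refine le_trans hmono ?_
  linarith

end IsRadialSolution

end Firewall

section EscapePoint

section Hull

variable {δ L₀ x : ℝ}

lemma hull_of_neg (hx : x < 0) : hull δ L₀ x = ⊤ := by simp [hull, hx]

lemma hull_le_half (hx : 0 ≤ x) : hull δ L₀ x ≤ ((δ ^ 2 / 2 : ℝ) : EReal) := by
  unfold hull
  rw [if_neg hx.not_gt]
  split_ifs with h
  · have : 0 ≤ x / (2 * L₀) := div_nonneg hx (by linarith)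
    refine EReal.coe_le_coe_iff.2 (mul_le_of_le_one_right (by positivity) (by linarith))
  · refine EReal.coe_le_coe_iff.2 (by linarith [sq_nonneg δ])

lemma hull_of_abs_lt (hx : |L₀| < x) : hull δ L₀ x = ((δ ^ 2 / 4 : ℝ) : EReal) := by
  have h1 := abs_nonneg L₀
  have h2 := le_abs_self L₀
  rw [hull, if_neg (by linarith), if_neg (by linarith)]

lemma quarter_le_hull : ((δ ^ 2 / 4 : ℝ) : EReal) ≤ hull δ L₀ x := by
  unfold hull
  split_ifs with h1 h
  · exact le_top
  · have : x / (2 * L₀) ≤ 1 / 2 := div_le_of_le_mul₀ (by linarith) (by norm_num) (by linarith)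
    refine EReal.coe_le_coe_iff.2 ?_
    have h3 : δ ^ 2 / 2 * (1 / 2) ≤ δ ^ 2 / 2 * (1 - x / (2 * L₀)) :=
      mul_le_mul_of_nonneg_left (by linarith) (by positivity)
    linarith
  · exact le_rfl

end Hull

variable {d : ℕ} {V : Euc n → ℝ} {u : ℝ → ℝ → Euc n} {l δ L₀ : ℝ} {rHom : ℝ → ℝ} {r t : ℝ}

lemma bddBelow_rescSet : BddBelow (rescSet V d l u δ L₀ rHom t) :=
  ⟨rsc d l, fun _ h => h.1.1⟩

namespace HullBound

lemma sub_one_mem (hh : HullBound V d l u δ L₀ rHom) (ht : 0 ≤ t) :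
    rHom t - 1 ∈ rescSet V d l u δ L₀ rHom t :=
  ⟨⟨(hh t ht).1, by linarith⟩, (hh t ht).2⟩

lemma rescF_le (hh : HullBound V d l u δ L₀ rHom) (ht : 0 ≤ t) :
    rescF V d l u δ L₀ rHom t ≤ rHom t - 1 := csInf_le bddBelow_rescSet (hh.sub_one_mem ht)

lemma rsc_le_rescF (hh : HullBound V d l u δ L₀ rHom) (ht : 0 ≤ t) :
    rsc d l ≤ rescF V d l u δ L₀ rHom t := le_csInf ⟨_, hh.sub_one_mem ht⟩ fun _ h => h.1.1

lemma F0_le_half (hh : HullBound V d l u δ L₀ rHom) (ht : 0 ≤ t)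
    (hr : rescF V d l u δ L₀ rHom t < r) (hr' : r ≤ rHom t) : F0 V d l u r t ≤ δ ^ 2 / 2 := by
  obtain ⟨rl, hrl, hlt⟩ := exists_lt_of_csInf_lt ⟨_, hh.sub_one_mem ht⟩ hr
  have h := hrl.2 r ((hh.rsc_le_rescF ht).trans hr.le)
  exact EReal.coe_le_coe_iff.1
    (h.trans (max_le (hull_le_half (by linarith)) (hull_le_half (by linarith))))

lemma F0_le_quarter (hh : HullBound V d l u δ L₀ rHom) (ht : 0 ≤ t)
    (hr : rescF V d l u δ L₀ rHom t + |L₀| < r) (hr' : r < rHom t - |L₀|) :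
    F0 V d l u r t ≤ δ ^ 2 / 4 := by
  obtain ⟨rl, hrl, hlt⟩ := exists_lt_of_csInf_lt ⟨_, hh.sub_one_mem ht⟩
    (show rescF V d l u δ L₀ rHom t < r - |L₀| by linarith)
  have h := hrl.2 r (by linarith [hh.rsc_le_rescF ht, abs_nonneg L₀])
  rw [hull_of_abs_lt (by linarith), hull_of_abs_lt (by linarith), max_self] at h
  exact EReal.coe_le_coe_iff.1 h

lemma rescF_le_of_F0_le (hh : HullBound V d l u δ L₀ rHom) (ht : 0 ≤ t)
    (hr : r ∈ Icc (rsc d l) (rHom t))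
    (hF : ∀ ρ, r ≤ ρ → ρ ≤ rHom t → ρ ≤ rescF V d l u δ L₀ rHom t + (|L₀| + 1) →
      F0 V d l u ρ t ≤ δ ^ 2 / 4) :
    rescF V d l u δ L₀ rHom t ≤ r := by
  refine csInf_le bddBelow_rescSet ⟨hr, fun ρ hρ => ?_⟩
  rcases lt_or_ge ρ r with h | h
  · rw [hull_of_neg (by linarith)]; simp
  rcases lt_or_ge (rHom t) ρ with h' | h'
  · rw [hull_of_neg (x := rHom t - ρ) (by linarith)]; simp
  rcases le_or_gt ρ (rescF V d l u δ L₀ rHom t + (|L₀| + 1)) with h1 | h1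
  · exact (EReal.coe_le_coe_iff.2 (hF ρ h h' h1)).trans (quarter_le_hull.trans (le_max_left _ _))
  · obtain ⟨rl, hrl, hlt⟩ := exists_lt_of_csInf_lt ⟨_, hh.sub_one_mem ht⟩
      (show rescF V d l u δ L₀ rHom t < ρ - |L₀| by linarith)
    refine (hrl.2 ρ hρ).trans (max_le_max_right _ ?_)
    rw [hull_of_abs_lt (by linarith)]
    exact quarter_le_hull

end HullBound

lemma deltaEsc_pos {R w κ : ℝ} (hR : 0 < R) (hw : 0 < w) (hκ : 0 < κ) : 0 < deltaEsc R w κ := by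
  unfold deltaEsc; positivity

lemma deltaEsc_sq {R w κ : ℝ} (hw : 0 < w) (hκ : 0 < κ) :
    (κ + 1) * deltaEsc R w κ ^ 2 = min (w / 2) (1 / 4) * R ^ 2 := by
  unfold deltaEsc
  rw [mul_pow, Real.sq_sqrt (by positivity)]
  field_simp

namespace HHomWith

variable {cHom : ℝ}

lemma eventually_add_le (hh : HHomWith u 0 cHom rHom) :
    ∃ t₀ : ℝ, 0 < t₀ ∧ ∀ t ≥ t₀, ∀ s ≥ 0, rHom t + cHom / 2 * s ≤ rHom (t + s) ∧
      rHom (t + s) ≤ rHom t + (cHom + 1) * s := by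
  obtain ⟨hc, hd, hl, -⟩ := hh
  have h1 : ∀ᶠ t in atTop, deriv rHom t ∈ Ioo (cHom / 2) (cHom + 1) :=
    hl (Ioo_mem_nhds (by linarith) (by linarith))
  obtain ⟨t₀, ht₀⟩ := eventually_atTop.1 h1
  refine ⟨max t₀ 1, by positivity, fun t ht s hs => ?_⟩
  have ht' : t₀ ≤ t := (le_max_left _ _).trans ht
  constructor
  · have := le_add_of_deriv_le (f := fun s => -rHom s) (k := -(cHom / 2)) (a := t) (b := t + s)
      (by linarith) fun x hx => ⟨_, (hd x).hasDerivAt.neg, by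
        have := (ht₀ x (ht'.trans hx.1)).1; linarith⟩
    linarith
  · have := le_add_of_deriv_le (f := rHom) (k := cHom + 1) (a := t) (b := t + s)
      (by linarith) fun x hx => ⟨_, (hd x).hasDerivAt, (ht₀ x (ht'.trans hx.1)).2.le⟩
    linarith

lemma tendsto_atTop (hh : HHomWith u 0 cHom rHom) : Tendsto rHom atTop atTop := by
  obtain ⟨t₀, -, h⟩ := hh.eventually_add_le
  have hc := hh.1
  refine tendsto_atTop_mono' (f₁ := fun t => rHom t₀ + cHom / 2 * (t - t₀)) _ ?_ ?_
  · filter_upwards [eventually_ge_atTop t₀] with t ht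
    simpa using (h t₀ le_rfl (t - t₀) (by linarith)).1
  · exact tendsto_atTop_add_const_left _ _ ((tendsto_atTop_add_const_right _ _ tendsto_id).const_mul_atTop
      (by linarith))

end HHomWith

end EscapePoint

section EscapeDynamics

/-- The standing hypotheses on the potential, the solution, the homogeneous point `rHom` and the
firewall functional. -/
structure InvasionSetting (d : ℕ) (V : Euc n → ℝ) (D : EscData n V) (u : ℝ → ℝ → Euc n)
    (C ν K δ L₀ cHom : ℝ) (rHom : ℝ → ℝ) : Prop where
  two_le : 2 ≤ d
  contDiff : ContDiff ℝ 2 V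
  coerc : HCoerc V
  zero_mem : (0 : Euc n) ∈ MinSet V
  zero_val : V 0 = 0
  sol : IsRadialSolution d V u
  bound : UniformlyBounded u C
  hom : HHomWith u 0 cHom rHom
  mono : Monotone rHom
  nu_pos : 0 < ν
  K_pos : 0 < K
  delta_eq : δ = deltaEsc D.dEsc (wV V) (kappa0 D.lmin)
  fire : FireIneq V d D.lmin D.dEsc u ν K
  hull : HullBound V d D.lmin u δ L₀ rHom

namespace InvasionSetting

variable {d : ℕ} {V : Euc n → ℝ} {D : EscData n V} {u : ℝ → ℝ → Euc n}
  {C ν K δ L₀ cHom : ℝ} {rHom : ℝ → ℝ} {r t : ℝ}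

lemma delta_pos (h : InvasionSetting d V D u C ν K δ L₀ cHom rHom) : 0 < δ :=
  h.delta_eq ▸ deltaEsc_pos D.dEsc_pos (wV_pos V) (kappa0_pos D.lmin_pos)

lemma F0_nonneg (h : InvasionSetting d V D u C ν K δ L₀ cHom rHom) (r t : ℝ) :
    0 ≤ F0 V d D.lmin u r t :=
  IsRadialSolution.F0_nonneg h.two_le h.contDiff h.coerc D h.zero_mem h.zero_val u D.lmin r t

lemma norm_le_of_F0_le (h : InvasionSetting d V D u C ν K δ L₀ cHom rHom) (hr : rsc d D.lmin ≤ r)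
    (ht : 0 < t) (hF : F0 V d D.lmin u r t ≤ δ ^ 2 / 2) : ‖u r t‖ < D.dEsc := by
  have hw := wV_pos V
  have hκ := kappa0_pos D.lmin_pos
  have h1 := h.sol.norm_sq_le_F0 h.two_le D.lmin_pos h.contDiff h.coerc D h.zero_mem h.zero_val
    h.bound hr ht
  have h2 := deltaEsc_sq (R := D.dEsc) hw hκ
  rw [← h.delta_eq] at h2
  have h3 : (kappa0 D.lmin + 1) * F0 V d D.lmin u r t ≤ (kappa0 D.lmin + 1) * (δ ^ 2 / 2) :=
    mul_le_mul_of_nonneg_left hF (by linarith)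
  have hm : 0 < min (wV V / 2) (1 / 4) := by positivity
  have hδ := h.delta_pos
  have h4 : 0 < (kappa0 D.lmin + 1) * δ ^ 2 := by positivity
  have h5 : min (wV V / 2) (1 / 4) * ‖u r t‖ ^ 2 < min (wV V / 2) (1 / 4) * D.dEsc ^ 2 := by
    linarith
  exact lt_of_pow_lt_pow_left₀ 2 D.dEsc_pos.le (lt_of_mul_lt_mul_left h5 hm.le)

lemma exists_exp_le {κ ε : ℝ} (hκ : 0 < κ) (hε : 0 < ε) (B : ℝ) :
    ∃ A : ℝ, 0 < A ∧ B * Real.exp (-κ / 2 * A) ≤ ε := by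
  have h1 : Tendsto (fun A : ℝ => B * Real.exp (-κ / 2 * A)) atTop (𝓝 (B * 0)) :=
    (Real.tendsto_exp_atBot.comp
      (tendsto_id.const_mul_atTop_of_neg (by linarith))).const_mul B
  rw [mul_zero] at h1
  obtain ⟨A, hA, hA0⟩ := ((h1.eventually_le_const hε).and (eventually_gt_atTop 0)).exists
  exact ⟨A, hA0, hA⟩

lemma integral_mono_interval (h : InvasionSetting d V D u C ν K δ L₀ cHom rHom) (ht : 0 < t)
    {a b a' b' : ℝ} (ha : a' ≤ a) (hab : a ≤ b) (hb : b ≤ b') :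
    ∫ r in a..b, (‖u r t‖ ^ 2 + ‖ur u r t‖ ^ 2) ≤
      ∫ r in a'..b', (‖u r t‖ ^ 2 + ‖ur u r t‖ ^ 2) := by
  have hc : Continuous fun r => ‖u r t‖ ^ 2 + ‖ur u r t‖ ^ 2 :=
    ((h.sol.continuous_r ht).norm.pow 2).add ((h.sol.continuous_ur ht).norm.pow 2)
  exact intervalIntegral.integral_mono_interval ha hab hb
    (Eventually.of_forall fun r => by positivity) (hc.intervalIntegrable _ _)

/-- The firewall functional tends to `0` around the homogeneous point. -/
lemma eventually_F0_le (h : InvasionSetting d V D u C ν K δ L₀ cHom rHom) (L : ℝ) {ε : ℝ}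
    (hε : 0 < ε) :
    ∀ᶠ t in atTop, ∀ r, rHom t - L ≤ r → r ≤ rHom t → F0 V d D.lmin u r t ≤ ε := by
  obtain ⟨B, hB, hF⟩ := h.sol.exists_F0_le h.two_le D.lmin_pos h.contDiff h.zero_mem h.zero_val
    h.bound
  obtain ⟨A, hA, hAε⟩ := exists_exp_le (kappa0_pos D.lmin_pos) (half_pos hε) B
  have h1 := h.hom.2.2.2 (|L| + A) (by positivity)
  filter_upwards [h1.eventually_le_const (show 0 < ε / (2 * B) by positivity),
    h.hom.tendsto_atTop.eventually_ge_atTop (|L| + A), eventually_gt_atTop 0] with t h2 h3 ht r hr hr'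
  have hL := le_abs_self L
  refine (hF A r t hA.le (by linarith) ht).trans ?_
  have h4 : ∫ r in (r - A)..(r + A), (‖u r t‖ ^ 2 + ‖ur u r t‖ ^ 2) ≤ ε / (2 * B) := by
    refine (h.integral_mono_interval ht (a' := rHom t + -(|L| + A)) (b' := rHom t + (|L| + A))
      (by linarith) (by linarith) (by linarith [abs_nonneg L])).trans ?_
    rw [← intervalIntegral.integral_comp_add_left
      (fun r => ‖u r t‖ ^ 2 + ‖ur u r t‖ ^ 2) (rHom t)]
    simpa using h2
  have h5 := mul_le_mul_of_nonneg_left h4 hB.le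
  have h6 : B * (ε / (2 * B)) = ε / 2 := by field_simp
  linarith

lemma tendsto_sub_rescF (h : InvasionSetting d V D u C ν K δ L₀ cHom rHom) :
    Tendsto (fun t => rHom t - rescF V d D.lmin u δ L₀ rHom t) atTop atTop := by
  refine tendsto_atTop.2 fun L => ?_
  have hδ := h.delta_pos
  filter_upwards [h.eventually_F0_le |L| (show 0 < δ ^ 2 / 4 by positivity),
    h.hom.tendsto_atTop.eventually_ge_atTop (|L| + rsc d D.lmin), eventually_ge_atTop 0]
    with t h1 h2 ht
  have := h.hull.rescF_le_of_F0_le ht (r := rHom t - |L|)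
    ⟨by linarith, by linarith [abs_nonneg L]⟩ fun ρ hρ hρ' _ => h1 ρ hρ hρ'
  linarith [le_abs_self L]

/-- Around the escape point the solution is far from the homogeneous equilibrium. -/
lemma exists_le_integral (h : InvasionSetting d V D u C ν K δ L₀ cHom rHom) :
    ∃ A > 0, ∃ c₀ > 0, ∃ R, ∀ t > 0, R ≤ rescF V d D.lmin u δ L₀ rHom t →
      c₀ ≤ ∫ r in (rescF V d D.lmin u δ L₀ rHom t - A)..(rescF V d D.lmin u δ L₀ rHom t + A),
        (‖u r t‖ ^ 2 + ‖ur u r t‖ ^ 2) := by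
  obtain ⟨B, hB, hF⟩ := h.sol.exists_F0_le h.two_le D.lmin_pos h.contDiff h.zero_mem h.zero_val
    h.bound
  have hδ := h.delta_pos
  obtain ⟨A, hA, hAε⟩ := exists_exp_le (kappa0_pos D.lmin_pos)
    (show 0 < δ ^ 2 / 8 by positivity) B
  have hL := abs_nonneg L₀
  refine ⟨A + (|L₀| + 1), by positivity, δ ^ 2 / (8 * B), by positivity,
    rsc d D.lmin + A + (|L₀| + 1), fun t ht hR => ?_⟩
  by_contra! hlt
  set f := rescF V d D.lmin u δ L₀ rHom t with hf
  have hsc := rsc_pos h.two_le D.lmin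
  have h1 := h.hull.rescF_le ht.le
  have h2 := h.hull.rescF_le_of_F0_le ht.le (r := f - 1)
    ⟨by linarith, by linarith⟩ fun ρ hρ _ hρ' => by
      refine (hF A ρ t hA.le (by linarith) ht).trans ?_
      have h4 := (h.integral_mono_interval ht (a := ρ - A) (b := ρ + A)
        (a' := f - (A + (|L₀| + 1))) (b' := f + (A + (|L₀| + 1)))
        (by linarith) (by linarith) (by linarith)).trans hlt.le
      have h5 := mul_le_mul_of_nonneg_left h4 hB.le
      have h6 : B * (δ ^ 2 / (8 * B)) = δ ^ 2 / 8 := by field_simp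
      linarith
  linarith

lemma F0_deriv_le (h : InvasionSetting d V D u C ν K δ L₀ cHom rHom) {ρ L : ℝ}
    (hρ : rsc d D.lmin ≤ ρ) (ht : 0 < t) (hL : ∀ r ∈ Sigma0 u D.dEsc t, L ≤ |r - ρ|) :
    ∃ F', HasDerivAt (fun s => F0 V d D.lmin u ρ s) F' t ∧ F' ≤ -ν * F0 V d D.lmin u ρ t +
      K * (4 / kappa0 D.lmin * Real.exp (-(kappa0 D.lmin) / 2 * L)) := by
  obtain ⟨h1, h2⟩ := h.fire ρ hρ t ht
  refine ⟨_, h1.hasDerivAt, h2.trans (add_le_add_right (mul_le_mul_of_nonneg_left ?_ h.K_pos.le) _)⟩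
  exact setIntegral_Tpsi_le h.two_le D.lmin_pos ρ L (h.sol.measurableSet_Sigma0 ht _)
    (fun r hr => hr.1) hL

lemma rescF_add_le_of_le (h : InvasionSetting d V D u C ν K δ L₀ cHom rHom) :
    ∃ τ > 0, ∃ L ≥ 0, ∃ t₀ > 0, ∀ t ≥ t₀, ∀ s ∈ Icc 0 τ,
      rescF V d D.lmin u δ L₀ rHom (t + s) ≤ rescF V d D.lmin u δ L₀ rHom t + L := by
  have hδ := h.delta_pos
  have hκ := kappa0_pos D.lmin_pos
  have hν := h.nu_pos
  have hK := h.K_pos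
  have hc := h.hom.1
  have hL0 := abs_nonneg L₀
  set κ := kappa0 D.lmin with hκdef
  obtain ⟨L', hL', hexp⟩ := exists_exp_le hκ (show 0 < ν * δ ^ 2 / 4 by positivity)
    (K * (4 / κ))
  set τ := δ ^ 2 * κ / (16 * K) with hτ
  have hτ0 : 0 < τ := by positivity
  obtain ⟨t₁, ht₁, hgrow⟩ := h.hom.eventually_add_le
  obtain ⟨t₂, ht₂⟩ := eventually_atTop.1 (h.eventually_F0_le
    ((|L₀| + 1) + L' + (cHom + 1) * τ) (show 0 < δ ^ 2 / 4 by positivity))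
  refine ⟨τ, hτ0, (|L₀| + 1) + L', by positivity, max t₁ t₂, lt_max_of_lt_left ht₁,
    fun t ht s hs => ?_⟩
  have htt₁ : t₁ ≤ t := (le_max_left _ _).trans ht
  have htt₂ : t₂ ≤ t := (le_max_right _ _).trans ht
  have ht0 : 0 < t := ht₁.trans_le htt₁
  set f := rescF V d D.lmin u δ L₀ rHom t with hf
  have hfsc : rsc d D.lmin ≤ f := h.hull.rsc_le_rescF ht0.le
  rcases lt_or_ge (rHom (t + s)) (f + ((|L₀| + 1) + L')) with hlt | hge
  · have := h.hull.rescF_le (t := t + s) (by linarith [hs.1])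
    linarith
  refine h.hull.rescF_le_of_F0_le (by linarith [hs.1]) ⟨by linarith, hge⟩ fun ρ hρ hρ' _ => ?_
  rcases le_or_gt (rHom (t + s) - ((|L₀| + 1) + L' + (cHom + 1) * τ)) ρ with hin | hin
  · exact ht₂ (t + s) (by linarith [hs.1]) ρ hin hρ'
  have hgs := (hgrow t htt₁ s hs.1).2
  have hgs' : (cHom + 1) * s ≤ (cHom + 1) * τ := mul_le_mul_of_nonneg_left hs.2 (by linarith)
  have hhalf : ∀ x, |x - ρ| < L' → ∀ t' ∈ Icc t (t + s), ‖u x t'‖ < D.dEsc := by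
    intro x hx t' ht'
    obtain ⟨hx1, hx2⟩ := abs_lt.1 hx
    have hxsc : rsc d D.lmin ≤ x := by linarith
    refine h.norm_le_of_F0_le hxsc (ht0.trans_le ht'.1) ?_
    have h1 := le_add_of_deriv_le (f := fun s => F0 V d D.lmin u x s) (k := K * (4 / κ)) ht'.1
      fun t'' ht'' => by
        obtain ⟨F', hF', hle⟩ := h.F0_deriv_le (L := 0) hxsc (ht0.trans_le ht''.1)
          fun _ _ => abs_nonneg _
        refine ⟨F', hF', hle.trans ?_⟩
        have := mul_nonneg hν.le (h.F0_nonneg x t'')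
        simp only [mul_zero, Real.exp_zero, mul_one]
        linarith
    have h2 := h.hull.F0_le_quarter ht0.le (r := x) (by linarith) (by linarith)
    have h3 : K * (4 / κ) * (t' - t) ≤ K * (4 / κ) * τ :=
      mul_le_mul_of_nonneg_left (by linarith [ht'.2, hs.2]) (by positivity)
    have h4 : K * (4 / κ) * τ = δ ^ 2 / 4 := by rw [hτ]; field_simp; norm_num
    linarith
  have hfin := le_of_deriv_le_affine (f := fun s => F0 V d D.lmin u ρ s) (k := ν * δ ^ 2 / 4)
    (a := t) (b := t + s) hν (fun t' ht' => by
      obtain ⟨F', hF', hle⟩ := h.F0_deriv_le (ρ := ρ) (L := L') (by linarith) (ht0.trans_le ht'.1)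
        fun r hr => by
          by_contra! hlt
          exact lt_asymm hr.2 (hhalf r hlt t' ht')
      refine ⟨F', hF', hle.trans ?_⟩
      rw [← hκdef, ← mul_assoc]
      linarith) (t := t + s) ⟨by linarith [hs.1], le_rfl⟩
  have h2 := h.hull.F0_le_quarter ht0.le (r := ρ) (by linarith) (by linarith)
  have h3 : ν * δ ^ 2 / 4 / ν = δ ^ 2 / 4 := by field_simp
  rw [h3] at hfin
  have h4 : (F0 V d D.lmin u ρ t - δ ^ 2 / 4) * Real.exp (-ν * (t + s - t)) ≤ 0 :=
    mul_nonpos_of_nonpos_of_nonneg (by linarith) (Real.exp_pos _).le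
  linarith

end InvasionSetting

lemma le_add_mul_of_step {f : ℝ → ℝ} {τ L t₀ : ℝ} (hτ : 0 < τ) (hL : 0 ≤ L)
    (hf : ∀ t ≥ t₀, ∀ s ∈ Icc 0 τ, f (t + s) ≤ f t + L) {t s : ℝ} (ht : t₀ ≤ t) (hs : 0 ≤ s) :
    f (t + s) ≤ f t + L * (s / τ + 1) := by
  have key : ∀ N : ℕ, ∀ s, 0 ≤ s → s ≤ N * τ → f (t + s) ≤ f t + N * L := by
    intro N
    induction N with
    | zero =>
      intro s hs hs'
      obtain rfl : s = 0 := by simp at hs'; linarith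
      simp
    | succ N ih =>
      intro s hs hs'
      push_cast at hs' ⊢
      rcases le_total s (N * τ) with h | h
      · linarith [ih s hs h]
      · have h1 := ih (N * τ) (by positivity) le_rfl
        have hN : 0 ≤ (N : ℝ) * τ := by positivity
        have h2 := hf (t + N * τ) (by linarith) (s - N * τ) ⟨by linarith, by linarith⟩
        rw [show t + N * τ + (s - N * τ) = t + s by ring] at h2
        linarith
  have h1 : s / τ ≤ ⌈s / τ⌉₊ := Nat.le_ceil _
  have h2 : (⌈s / τ⌉₊ : ℝ) ≤ s / τ + 1 := (Nat.ceil_lt_add_one (by positivity)).le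
  have h3 := key ⌈s / τ⌉₊ s hs ((div_le_iff₀ hτ).1 h1)
  have h4 := mul_le_mul_of_nonneg_right h2 hL
  linarith

namespace InvasionSetting

variable {d : ℕ} {V : Euc n → ℝ} {D : EscData n V} {u : ℝ → ℝ → Euc n}
  {C ν K δ L₀ cHom : ℝ} {rHom : ℝ → ℝ} {r t : ℝ}

lemma rescF_nonneg (h : InvasionSetting d V D u C ν K δ L₀ cHom rHom) (ht : 0 ≤ t) :
    0 ≤ rescF V d D.lmin u δ L₀ rHom t :=
  (rsc_pos h.two_le D.lmin).le.trans (h.hull.rsc_le_rescF ht)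

/-- The escape point moves at most linearly in time. -/
lemma rescF_add_le (h : InvasionSetting d V D u C ν K δ L₀ cHom rHom) :
    ∃ A ≥ 0, ∀ t ≥ 0, ∀ s ≥ 0,
      rescF V d D.lmin u δ L₀ rHom (t + s) ≤ rescF V d D.lmin u δ L₀ rHom t + A * (s + 1) := by
  obtain ⟨τ, hτ, L, hL, t₀, ht₀, hstep⟩ := h.rescF_add_le_of_le
  set f := rescF V d D.lmin u δ L₀ rHom with hf
  have hM : 0 ≤ rHom t₀ := by
    have h1 := h.hull.rescF_le ht₀.le
    have h2 := h.rescF_nonneg ht₀.le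
    linarith
  have hle : ∀ t ≥ 0, t ≤ t₀ → f t ≤ rHom t₀ := fun t ht htt => by
    have h1 := h.hull.rescF_le ht
    have h2 := h.mono htt
    linarith
  have hA : ∀ s ≥ 0, L * (s / τ + 1) ≤ (L / τ + L) * (s + 1) := fun s hs => by
    have : 0 ≤ L / τ + L * s := by positivity
    have h2 : L * (s / τ) = L / τ * s := by ring
    linarith
  refine ⟨L / τ + L + rHom t₀, by positivity, fun t ht s hs => ?_⟩
  have hMs := mul_nonneg hM hs
  have hnn : 0 ≤ (L / τ + L) * (s + 1) := by positivity
  rcases le_total t₀ t with htt | htt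
  · have h1 := le_add_mul_of_step hτ hL hstep htt hs
    have h2 := hA s hs
    linarith
  rcases le_total (t + s) t₀ with hts | hts
  · have h1 := hle (t + s) (by linarith) hts
    have h2 := h.rescF_nonneg ht
    linarith
  · have h1 := le_add_mul_of_step hτ hL hstep (t := t₀) le_rfl (s := t + s - t₀) (by linarith)
    rw [add_sub_cancel] at h1
    have h2 := hA (t + s - t₀) (by linarith)
    have h3 : (L / τ + L) * (t + s - t₀ + 1) ≤ (L / τ + L) * (s + 1) :=
      mul_le_mul_of_nonneg_left (by linarith) (by positivity)
    have h4 := hle t₀ ht₀.le le_rfl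
    have h5 := h.rescF_nonneg ht
    linarith

lemma norm_le_of_rescF_lt (h : InvasionSetting d V D u C ν K δ L₀ cHom rHom) (ht : 0 < t)
    (hr : rescF V d D.lmin u δ L₀ rHom t < r) (hr' : r ≤ rHom t) : ‖u r t‖ < D.dEsc :=
  h.norm_le_of_F0_le ((h.hull.rsc_le_rescF ht.le).trans hr.le) ht (h.hull.F0_le_half ht.le hr hr')

lemma rEscF_le (h : InvasionSetting d V D u C ν K δ L₀ cHom rHom) (ht : 0 < t) :
    rEscF u 0 D.dEsc rHom t ≤ rescF V d D.lmin u δ L₀ rHom t := by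
  refine Real.sSup_le (fun r hr => ?_) (h.rescF_nonneg ht.le)
  by_contra! hlt
  have h1 := h.norm_le_of_rescF_lt ht hlt hr.1.2
  have h2 := hr.2
  rw [sub_zero] at h2
  linarith

end InvasionSetting

end EscapeDynamics

section Profiles

/-- A Barbalat-type lemma: a nonnegative Lipschitz function bounded above by the derivative of a
function bounded from above tends to `0`. -/
lemma tendsto_zero_of_le_deriv {p p' h : ℝ → ℝ} {a M Λ : ℝ}
    (hp : ∀ x ≥ a, HasDerivAt p (p' x) x) (hle : ∀ x ≥ a, h x ≤ p' x) (hh : ∀ x ≥ a, 0 ≤ h x)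
    (hM : ∀ x ≥ a, p x ≤ M) (hΛ : ∀ x ≥ a, ∀ y ≥ a, |h x - h y| ≤ Λ * |x - y|) :
    Tendsto h atTop (𝓝 0) := by
  have hgrow : ∀ k x y, a ≤ x → x ≤ y → (∀ z ∈ Icc x y, k ≤ p' z) → p x + k * (y - x) ≤ p y := by
    intro k x y hx hxy hk
    have := le_add_of_deriv_le (f := fun x => -p x) (k := -k) hxy fun z hz =>
      ⟨_, (hp z (hx.trans hz.1)).neg, by linarith [hk z hz]⟩
    linarith
  have hmono : Monotone fun x => p (max x a) := by
    intro x y hxy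
    have := hgrow 0 (max x a) (max y a) (le_max_right _ _) (max_le_max_right _ hxy)
      fun z hz => (hh z ((le_max_right _ _).trans hz.1)).trans (hle z ((le_max_right _ _).trans hz.1))
    simpa using this
  have hlim := tendsto_atTop_ciSup hmono ⟨M, by rintro _ ⟨x, rfl⟩; exact hM _ (le_max_right _ _)⟩
  set l := ⨆ x, p (max x a) with hl
  have hΛ0 : 0 ≤ Λ := by
    have := (abs_nonneg _).trans (hΛ (a + 1) (by simp) a le_rfl)
    simpa using this
  rw [Metric.tendsto_atTop]
  intro ε hε
  set η := ε / (2 * (Λ + 1)) with hη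
  have hη0 : 0 < η := by positivity
  obtain ⟨N, hN⟩ := (Metric.tendsto_atTop.1 hlim) (ε / 2 * η / 2) (by positivity)
  refine ⟨max N a, fun x hx => ?_⟩
  have hxN : N ≤ x := (le_max_left _ _).trans hx
  have hxa : a ≤ x := (le_max_right _ _).trans hx
  rw [Real.dist_eq, sub_zero, abs_of_nonneg (hh x hxa)]
  by_contra! hge
  have h1 := hgrow (ε / 2) x (x + η) hxa (by linarith) fun z hz => by
    refine le_trans ?_ (hle z (hxa.trans hz.1))
    have h2 := (le_abs_self _).trans (hΛ x hxa z (hxa.trans hz.1))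
    have h3 : Λ * |x - z| ≤ (Λ + 1) * η := by
      refine mul_le_mul (by linarith) ?_ (abs_nonneg _) (by linarith)
      rw [abs_sub_comm, abs_of_nonneg (by linarith [hz.1])]
      linarith [hz.2]
    have h4 : (Λ + 1) * η = ε / 2 := by rw [hη]; field_simp
    linarith
  have h5 := hN x hxN
  have h6 := hN (x + η) (by linarith)
  rw [Real.dist_eq] at h5 h6
  rw [max_eq_left hxa] at h5
  rw [max_eq_left (by linarith)] at h6
  have h7 := (abs_lt.1 h5).1
  have h8 := (abs_lt.1 h6).2
  rw [add_sub_cancel_left] at h1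
  linarith

/-- If a function tends to `0` and its derivative is Lipschitz, then so does the derivative. -/
lemma tendsto_deriv_zero_atBot {E : Type*} [NormedAddCommGroup E] [NormedSpace ℝ E]
    {g g' : ℝ → E} {Λ : ℝ} (hg : ∀ x, HasDerivAt g (g' x) x)
    (hΛ : ∀ x y, ‖g' x - g' y‖ ≤ Λ * |x - y|) (hlim : Tendsto g atBot (𝓝 0)) :
    Tendsto g' atBot (𝓝 0) := by
  have hΛ0 : 0 ≤ Λ := by simpa using (norm_nonneg _).trans (hΛ 1 0)
  have key : ∀ η > 0, ∀ x, η * ‖g' x‖ ≤ ‖g x‖ + ‖g (x - η)‖ + Λ * η * η := by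
    intro η hη x
    have h1 := (convex_Icc (x - η) x).norm_image_sub_le_of_norm_hasDerivWithin_le
      (f := fun y => g y - (y - x) • g' x) (f' := fun y => g' y - g' x) (C := Λ * η)
      (fun y _ => (((hg y).fun_sub (((hasDerivAt_id y).sub_const x).smul_const
        (g' x))).congr_deriv (by simp)).hasDerivWithinAt)
      (fun y hy => (hΛ y x).trans (mul_le_mul_of_nonneg_left
        (by rw [abs_le]; constructor <;> linarith [hy.1, hy.2]) hΛ0))
      (x := x - η) (y := x) ⟨le_rfl, by linarith⟩ ⟨by linarith, le_rfl⟩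
    simp only [sub_self, zero_smul, sub_zero, sub_sub_cancel, Real.norm_eq_abs, abs_of_pos hη,
      sub_sub_cancel_left] at h1
    have h2 : η • g' x = g x - g (x - η) - (g x - (g (x - η) - (-η) • g' x)) := by
      simp only [neg_smul]; abel
    calc η * ‖g' x‖ = ‖η • g' x‖ := by rw [norm_smul, Real.norm_eq_abs, abs_of_pos hη]
      _ ≤ ‖g x‖ + ‖g (x - η)‖ + ‖g x - (g (x - η) - (-η) • g' x)‖ := by
        rw [h2]
        exact (norm_sub_le _ _).trans (add_le_add_left (norm_sub_le _ _) _)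
      _ ≤ _ := by linarith
  rw [Metric.tendsto_nhds]
  intro ε hε
  set η := ε / (4 * (Λ + 1)) with hη
  have hη0 : 0 < η := by positivity
  have h1 := (Metric.tendsto_nhds.1 hlim) (η * ε / 4) (by positivity)
  have h2 : ∀ᶠ x in atBot, dist (g (x - η)) 0 < η * ε / 4 :=
    (tendsto_atBot_add_const_right atBot (-η) tendsto_id).eventually h1
  filter_upwards [h1, h2] with x h3 h4
  rw [dist_zero_right] at h3 h4 ⊢
  have h5 := key η hη0 x
  have h6 : Λ * η ≤ ε / 4 := by
    have h8 : (Λ + 1) * η = ε / 4 := by rw [hη]; field_simp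
    linarith
  have h7 := mul_le_mul_of_nonneg_right h6 hη0.le
  refine lt_of_mul_lt_mul_left (a := η) ?_ hη0.le
  have : 0 < η * ε := by positivity
  linarith

variable {V : Euc n → ℝ}

lemma exists_isolated_critical (hV : ContDiff ℝ 2 V) (hnd : HNonDeg V) {z : Euc n}
    (hz : gradient V z = 0) : ∃ r > 0, ∀ x, ‖x - z‖ ≤ r → gradient V x = 0 → x = z := by
  obtain ⟨K, -, hK⟩ := LinearMap.exists_antilipschitzWith (hess V z : Euc n →ₗ[ℝ] Euc n)
    (LinearMap.ker_eq_bot'.2 fun v hv => hnd z hz v hv)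
  have h1 := (hasFDerivAt_gradient hV z).eventually_ne (c := 0) ⟨K, hK⟩
  rw [eventually_nhdsWithin_iff, Metric.eventually_nhds_iff] at h1
  obtain ⟨r, hr, h⟩ := h1
  refine ⟨r / 2, by positivity, fun x hx hx0 => ?_⟩
  by_contra hne
  exact h (y := x) (by rw [dist_eq_norm]; linarith) hne hx0

lemma MapClusterPt.eq_of_tendsto {X α : Type*} [TopologicalSpace X] [T2Space X] {F : Filter α}
    {g : α → X} {x y : X} (hx : MapClusterPt x F g) (hy : Tendsto g F (𝓝 y)) : x = y :=
  haveI : NeBot (𝓝 x ⊓ 𝓝 y) := ClusterPt.mono hx hy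
  eq_of_nhds_neBot this

/-- A bounded curve along which the gradient tends to `0` converges to a critical point. -/
lemma exists_tendsto_critical (hV : ContDiff ℝ 2 V) (hnd : HNonDeg V) {φ : ℝ → Euc n} {C : ℝ}
    (hφ : Continuous φ) (hb : ∀ ξ, ‖φ ξ‖ ≤ C)
    (hlim : Tendsto (fun ξ => gradient V (φ ξ)) atBot (𝓝 0)) :
    ∃ z, gradient V z = 0 ∧ Tendsto φ atBot (𝓝 z) := by
  have hgc := (contDiff_gradient hV).continuous
  have hcrit : ∀ z, MapClusterPt z atBot φ → gradient V z = 0 := fun z hz =>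
    (hz.continuousAt_comp hgc.continuousAt).eq_of_tendsto hlim
  obtain ⟨z, -, hz⟩ := (isCompact_closedBall (0 : Euc n) C).exists_mapClusterPt (f := atBot) (u := φ)
    (le_principal_iff.2 (mem_map.2 (Eventually.of_forall fun ξ => by simpa using hb ξ)))
  have hz0 := hcrit z hz
  refine ⟨z, hz0, ?_⟩
  obtain ⟨r, hr, hiso⟩ := exists_isolated_critical hV hnd hz0
  rw [Metric.tendsto_nhds]
  intro ε hε
  set ε' := min (ε / 2) r with hε'
  have hε'0 : 0 < ε' := by positivity
  have hne : ∀ᶠ ξ in atBot, φ ξ ∉ Metric.sphere z ε' := by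
    by_contra hcon
    obtain ⟨y, hy, hyc⟩ := (isCompact_sphere z ε').exists_mapClusterPt_of_frequently
      (not_eventually.1 hcon |>.mono fun _ h => not_not.1 h)
    rw [mem_sphere_iff_norm] at hy
    have := hiso y (hy.trans_le (min_le_right _ _)) (hcrit y hyc)
    rw [this, sub_self, norm_zero] at hy
    exact hε'0.ne hy
  obtain ⟨ξ₀, hξ₀⟩ := eventually_atBot.1 hne
  have hfr : ∃ᶠ ξ in atBot, φ ξ ∈ Metric.ball z ε' := hz.frequently (Metric.ball_mem_nhds _ hε'0)
  obtain ⟨ξ₁, hξ₁, hle⟩ := (hfr.and_eventually (eventually_le_atBot ξ₀)).exists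
  filter_upwards [eventually_le_atBot ξ₀] with ξ hξ
  by_contra! hge
  obtain ⟨ξ₂, h2, h3⟩ := isPreconnected_Iic.intermediate_value (f := fun ξ => dist (φ ξ) z)
    hle hξ (by fun_prop) ⟨(show dist (φ ξ₁) z ≤ ε' from (Metric.mem_ball.1 hξ₁).le), by
      have := min_le_left (ε / 2) r
      show ε' ≤ dist (φ ξ) z
      linarith⟩
  exact hξ₀ ξ₂ h2 h3

lemma abs_sq_norm_sub_le {E : Type*} [NormedAddCommGroup E] {x y : E} {C : ℝ} (hx : ‖x‖ ≤ C)
    (hy : ‖y‖ ≤ C) : |‖x‖ ^ 2 - ‖y‖ ^ 2| ≤ 2 * C * ‖x - y‖ := by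
  have h1 := abs_norm_sub_norm_le x y
  rw [show ‖x‖ ^ 2 - ‖y‖ ^ 2 = (‖x‖ + ‖y‖) * (‖x‖ - ‖y‖) by ring, abs_mul,
    abs_of_nonneg (by positivity)]
  exact mul_le_mul (by linarith) h1 (abs_nonneg _) (by linarith [norm_nonneg x])

/-- A bounded nonzero entire solution of the profile equation which stays close to `0` on the
right is a front invading `0`. -/
theorem phiInv_nonempty (hV : ContDiff ℝ 2 V) (D : EscData n V) (h0 : (0 : Euc n) ∈ MinSet V)
    (hV0 : V 0 = 0) (hnd : HNonDeg V) (hob : HOnlyBist V) {c C : ℝ} (hc : 0 < c)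
    {φ ψ : ℝ → Euc n} (hφ : ∀ ξ, HasDerivAt φ (ψ ξ) ξ)
    (hψ : ∀ ξ, HasDerivAt ψ (-(c • ψ ξ) + gradient V (φ ξ)) ξ) (hbφ : ∀ ξ, ‖φ ξ‖ ≤ C)
    (hbψ : ∀ ξ, ‖ψ ξ‖ ≤ C) (hesc : ∀ ξ > 0, ‖φ ξ‖ ≤ D.dEsc) (hnt : ∃ ξ, φ ξ ≠ 0 ∨ ψ ξ ≠ 0) :
    (PhiInv V c 0).Nonempty := by
  obtain ⟨Λ, hΛ, hlip, hgr, hpot⟩ := exists_quadratic_bounds hV h0.1 hV0 C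
  have hC : 0 ≤ C := (norm_nonneg _).trans (hbφ 0)
  have hφlip : ∀ x y, ‖φ x - φ y‖ ≤ C * |x - y| := fun x y =>
    convex_univ.norm_image_sub_le_of_norm_hasDerivWithin_le
      (fun x _ => (hφ x).hasDerivWithinAt) (fun x _ => hbψ x) (mem_univ y) (mem_univ x)
  have hψlip : ∀ x y, ‖ψ x - ψ y‖ ≤ (c * C + Λ * C) * |x - y| := fun x y =>
    convex_univ.norm_image_sub_le_of_norm_hasDerivWithin_le
      (fun x _ => (hψ x).hasDerivWithinAt) (fun x _ => by
        refine (norm_add_le _ _).trans (add_le_add ?_ ?_)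
        · rw [norm_neg, norm_smul, Real.norm_eq_abs, abs_of_pos hc]
          exact mul_le_mul_of_nonneg_left (hbψ x) hc.le
        · exact (hgr _ (hbφ x)).trans (mul_le_mul_of_nonneg_left (hbφ x) hΛ))
      (mem_univ y) (mem_univ x)
  have hlam := D.lmin_pos
  have htop : Tendsto φ atTop (𝓝 0) := by
    have h1 : Tendsto (fun x => D.lmin / 2 * ‖φ x‖ ^ 2) atTop (𝓝 0) := by
      refine tendsto_zero_of_le_deriv (a := 1) (M := C * C + c * (C ^ 2 / 2))
        (Λ := D.lmin / 2 * (2 * C * C))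
        (p := fun x => ⟪φ x, ψ x⟫ + c * (‖φ x‖ ^ 2 / 2))
        (p' := fun x => ‖ψ x‖ ^ 2 + ⟪φ x, gradient V (φ x)⟫) ?_ ?_ ?_ ?_ ?_
      · intro x _
        refine (((hφ x).inner ℝ (hψ x)).add
          (((hφ x).norm_sq.div_const 2).const_mul c)).congr_deriv ?_
        simp only [inner_add_right, inner_neg_right, real_inner_smul_right,
          real_inner_self_eq_norm_sq]
        ring
      · intro x hx
        have h2 := D.inner_gradient_ge hV (m := 0) (x := φ x) h0
          (by simpa using hesc x (by linarith))
        rw [sub_zero] at h2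
        have : 0 ≤ ‖ψ x‖ ^ 2 := by positivity
        linarith
      · intro x _
        positivity
      · intro x _
        refine add_le_add ((real_inner_le_norm _ _).trans ?_) ?_
        · exact mul_le_mul (hbφ x) (hbψ x) (norm_nonneg _) hC
        · have := pow_le_pow_left₀ (norm_nonneg _) (hbφ x) 2
          gcongr
      · intro x _ y _
        rw [← mul_sub, abs_mul, abs_of_pos (by positivity), mul_assoc]
        refine mul_le_mul_of_nonneg_left ((abs_sq_norm_sub_le (hbφ x) (hbφ y)).trans ?_)
          (by positivity)
        rw [mul_assoc (2 * C)]
        exact mul_le_mul_of_nonneg_left (hφlip x y) (by positivity)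
    have h2 : Tendsto (fun x => ‖φ x‖ ^ 2) atTop (𝓝 0) := by
      have := h1.const_mul (2 / D.lmin)
      rw [mul_zero] at this
      refine this.congr fun x => ?_
      field_simp
    have h3 := h2.sqrt
    simp only [Real.sqrt_sq (norm_nonneg _), Real.sqrt_zero] at h3
    exact tendsto_zero_iff_norm_tendsto_zero.2 h3
  have hψbot : Tendsto ψ atBot (𝓝 0) := by
    have h1 : Tendsto (fun x => c * ‖ψ (-x)‖ ^ 2) atTop (𝓝 0) := by
      refine tendsto_zero_of_le_deriv (a := 0) (M := C ^ 2 / 2 + Λ * C ^ 2)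
        (Λ := c * (2 * C * (c * C + Λ * C)))
        (p := fun x => ‖ψ (-x)‖ ^ 2 / 2 - V (φ (-x)))
        (p' := fun x => c * ‖ψ (-x)‖ ^ 2) ?_ (fun _ _ => le_rfl) ?_ ?_ ?_
      · intro x _
        have hneg : HasDerivAt (fun x : ℝ => -x) (-1) x := (hasDerivAt_id x).neg
        have h2 := (((hψ (-x)).norm_sq.div_const 2).sub (hasDerivAt_comp_potential hV (hφ (-x))))
        refine (h2.comp x hneg).congr_deriv ?_
        simp only [inner_add_right, inner_neg_right, real_inner_smul_right,
          real_inner_self_eq_norm_sq, real_inner_comm (ψ (-x)) (gradient V (φ (-x)))]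
        ring
      · intro x _
        positivity
      · intro x _
        have h3 := (abs_le.1 (hpot _ (hbφ (-x)))).1
        have h4 : Λ * ‖φ (-x)‖ ^ 2 ≤ Λ * C ^ 2 := by gcongr; exact hbφ _
        have h5 : ‖ψ (-x)‖ ^ 2 ≤ C ^ 2 := by gcongr; exact hbψ _
        linarith
      · intro x _ y _
        rw [← mul_sub, abs_mul, abs_of_pos hc, mul_assoc]
        refine mul_le_mul_of_nonneg_left ((abs_sq_norm_sub_le (hbψ _) (hbψ _)).trans ?_) hc.le
        rw [mul_assoc (2 * C)]
        refine mul_le_mul_of_nonneg_left ((hψlip _ _).trans_eq ?_) (by positivity)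
        rw [abs_sub_comm, neg_sub_neg]
    have h2 : Tendsto (fun x => ‖ψ x‖ ^ 2) atBot (𝓝 0) := by
      have := (h1.comp tendsto_neg_atBot_atTop).const_mul (1 / c)
      rw [mul_zero] at this
      refine this.congr fun x => ?_
      simp only [Function.comp, neg_neg]
      field_simp
    have h3 := h2.sqrt
    simp only [Real.sqrt_sq (norm_nonneg _), Real.sqrt_zero] at h3
    exact tendsto_zero_iff_norm_tendsto_zero.2 h3
  have hψ'bot := tendsto_deriv_zero_atBot (Λ := c * (c * C + Λ * C) + Λ * C) hψ (fun x y => by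
    have h1 : -(c • ψ x) + gradient V (φ x) - (-(c • ψ y) + gradient V (φ y)) =
        -(c • (ψ x - ψ y)) + (gradient V (φ x) - gradient V (φ y)) := by
      rw [smul_sub]; abel
    rw [h1, add_mul]
    refine (norm_add_le _ _).trans (add_le_add ?_ ?_)
    · rw [norm_neg, norm_smul, Real.norm_eq_abs, abs_of_pos hc, mul_assoc]
      exact mul_le_mul_of_nonneg_left (hψlip x y) hc.le
    · rw [mul_assoc]
      exact (hlip _ _ (hbφ x) (hbφ y)).trans (mul_le_mul_of_nonneg_left (hφlip x y) hΛ)) hψbot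
  have hgrad : Tendsto (fun ξ => gradient V (φ ξ)) atBot (𝓝 0) := by
    have h1 := hψ'bot.add (hψbot.const_smul c)
    rw [smul_zero, add_zero] at h1
    refine h1.congr fun ξ => ?_
    abel
  have hφc : Continuous φ := continuous_iff_continuousAt.2 fun ξ => (hφ ξ).continuousAt
  obtain ⟨z, hz, hbot⟩ := exists_tendsto_critical hV hnd hφc hbφ hgrad
  have hd1 : deriv φ = ψ := funext fun ξ => (hφ ξ).deriv
  have hmem : φ ∈ Phi V c z 0 := by
    refine ⟨?_, fun ξ => (hφ ξ).differentiableAt, fun ξ => hd1 ▸ (hψ ξ).differentiableAt,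
      fun ξ => by rw [hd1]; exact (hψ ξ).deriv, hbot, htop⟩
    by_contra! hcon
    have hconst : φ = fun _ => φ 0 := funext fun ξ => hcon ξ 0
    have hφ0 : φ 0 = 0 := by
      rw [hconst] at htop
      exact tendsto_nhds_unique tendsto_const_nhds htop
    obtain ⟨ξ, h | h⟩ := hnt
    · exact h (by rw [hcon ξ 0, hφ0])
    · apply h
      rw [← (hφ ξ).deriv, hconst]
      simp
  exact ⟨φ, mem_iUnion₂.2 ⟨z, hob 0 h0 z hz c hc ⟨φ, hmem⟩, hmem⟩⟩

end Profiles

section Compactness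

lemma hasDerivAt_of_norm_sub_le_sq {E : Type*} [NormedAddCommGroup E] [NormedSpace ℝ E]
    {f : ℝ → E} {f' : E} {z M : ℝ} (h : ∀ s, ‖f s - f z - (s - z) • f'‖ ≤ M * |s - z| ^ 2) :
    HasDerivAt f f' z := by
  rw [hasDerivAt_iff_isLittleO]
  have h1 : (fun s => f s - f z - (s - z) • f') =O[𝓝 z] fun s => (s - z) ^ 2 :=
    Asymptotics.IsBigO.of_bound M (Eventually.of_forall fun s => by
      rw [Real.norm_eq_abs, abs_pow]; exact h s)
  refine h1.trans_isLittleO ?_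
  have h2 : Tendsto (fun s : ℝ => s - z) (𝓝 z) (𝓝 0) := by
    simpa using (tendsto_id (x := 𝓝 z)).sub_const z
  exact (Asymptotics.isLittleO_pow_id (𝕜 := ℝ) one_lt_two).comp_tendsto h2

namespace IsRadialSolution

variable {d : ℕ} {V : Euc n → ℝ} {u : ℝ → ℝ → Euc n} {C : ℝ}

lemma norm_sub_sub_smul_ur_le (hu : IsRadialSolution d V u) (hC : UniformlyBounded u C)
    {t s z : ℝ} (ht : 0 < t) (hs : 0 ≤ s) (hz : 0 ≤ z) :
    ‖u s t - u z t - (s - z) • ur u z t‖ ≤ C * |s - z| ^ 2 := by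
  have h1 := (convex_uIcc z s).norm_image_sub_le_of_norm_hasDerivWithin_le
    (f := fun y => u y t - (y - z) • ur u z t) (f' := fun y => ur u y t - ur u z t)
    (C := C * |s - z|)
    (fun y _ => (((hu.hasDerivAt_r ht y).fun_sub (((hasDerivAt_id y).sub_const z).smul_const
      (ur u z t))).congr_deriv (by simp)).hasDerivWithinAt)
    (fun y hy => (hu.lipschitz_ur hC ht ((le_min hz hs).trans hy.1) hz).trans
      (mul_le_mul_of_nonneg_left (abs_sub_left_of_mem_uIcc hy) hC.nonneg))
    (left_mem_uIcc) (right_mem_uIcc)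
  simp only [sub_self, zero_smul, sub_zero, Real.norm_eq_abs] at h1
  rw [show u s t - u z t - (s - z) • ur u z t = u s t - (s - z) • ur u z t - u z t by abel]
  exact h1.trans_eq (by ring)

/-- Expansion of `ur` around a point, in terms of the profile equation and of the dissipation. -/
lemma norm_sub_sub_smul_urr_le (hu : IsRadialSolution d V u) (hV : ContDiff ℝ 2 V)
    (hC : UniformlyBounded u C) {c Λ η : ℝ} (hc : 0 ≤ c) (hΛ0 : 0 ≤ Λ) (hη : 0 < η)
    (hΛ : ∀ x y : Euc n, ‖x‖ ≤ C → ‖y‖ ≤ C → ‖gradient V x - gradient V y‖ ≤ Λ * ‖x - y‖)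
    {t s z a b : ℝ} (ht : 0 < t) (ha : 0 < a) (hs : s ∈ Icc a b) (hz : z ∈ Icc a b) :
    ‖ur u s t - ur u z t - (s - z) • (-(c • ur u z t) + gradient V (u z t))‖ ≤
      (η + 2 * |(d : ℝ) - 1| * C / (1 + a) + (c + Λ) * C * |s - z|) * |s - z| +
        1 / η * ∫ r in a..b, ‖ut u r t + c • ur u r t‖ ^ 2 := by
  set k := -(c • ur u z t) + gradient V (u z t) with hk
  have hab : a ≤ b := hs.1.trans hs.2
  have hsub : uIoc z s ⊆ Ioc a b := fun x hx =>
    ⟨(le_min hz.1 hs.1).trans_lt hx.1, hx.2.trans (max_le hz.2 hs.2)⟩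
  have hcurr : Continuous fun r => urr u r t := hu.cont_rr t ht
  have hftc : ∫ r in z..s, (urr u r t - k) = ur u s t - ur u z t - (s - z) • k := by
    have h1 := intervalIntegral.integral_eq_sub_of_hasDerivAt
      (f := fun r => ur u r t) (f' := fun r => urr u r t) (a := z) (b := s)
      (fun x _ => hu.hasDerivAt_rr ht x) (hcurr.intervalIntegrable _ _)
    rw [intervalIntegral.integral_sub (hcurr.intervalIntegrable _ _)
      (continuous_const.intervalIntegrable _ _), h1, intervalIntegral.integral_const]
  have hwc : ContinuousOn (fun r => ‖ut u r t + c • ur u r t‖ ^ 2) (Icc a b) := by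
    have h1 : ContinuousOn (fun r => ut u r t) (Icc a b) :=
      (hu.continuousOn_ut_r hV ht).mono fun r hr => ha.trans_le hr.1
    have h2 : ContinuousOn (fun r => c • ur u r t) (Icc a b) :=
      ((hu.continuous_ur ht).const_smul c).continuousOn
    exact (h1.add h2).norm.pow 2
  have hwi : IntegrableOn (fun r => ‖ut u r t + c • ur u r t‖ ^ 2) (Ioc a b) :=
    (hwc.integrableOn_Icc).mono_set Ioc_subset_Icc_self
  set M := η + 2 * |(d : ℝ) - 1| * C / (1 + a) + (c + Λ) * C * |s - z| with hM
  have hpt : ∀ r ∈ uIoc z s, ‖urr u r t - k‖ ≤ M + 1 / η * ‖ut u r t + c • ur u r t‖ ^ 2 := by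
    intro r hr
    have hr' := hsub hr
    have hr0 : 0 < r := ha.trans hr'.1
    have hz0 : 0 < z := ha.trans_le hz.1
    have hrz : |r - z| ≤ |s - z| := abs_sub_left_of_mem_uIcc (uIoc_subset_uIcc hr)
    have h1 : urr u r t - k = (ut u r t + c • ur u r t) - (((d : ℝ) - 1) / r) • ur u r t -
        c • (ur u r t - ur u z t) + (gradient V (u r t) - gradient V (u z t)) := by
      rw [hu.pde r hr0 t ht, hk, smul_sub]; abel
    have h2 : ‖(((d : ℝ) - 1) / r) • ur u r t‖ ≤ 2 * |(d : ℝ) - 1| * C / (1 + a) := by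
      refine (hu.curvature_le hC ht hr0).trans ?_
      have := hC.nonneg
      exact div_le_div_of_nonneg_left (by positivity) (by positivity) (by linarith [hr'.1])
    have h3 : ‖c • (ur u r t - ur u z t)‖ ≤ c * (C * |s - z|) := by
      rw [norm_smul, Real.norm_eq_abs, abs_of_nonneg hc]
      exact mul_le_mul_of_nonneg_left ((hu.lipschitz_ur hC ht hr0.le hz0.le).trans
        (mul_le_mul_of_nonneg_left hrz hC.nonneg)) hc
    have h4 : ‖gradient V (u r t) - gradient V (u z t)‖ ≤ Λ * (C * |s - z|) :=
      (hΛ _ _ (hC.norm_le hr0.le ht) (hC.norm_le hz0.le ht)).trans (mul_le_mul_of_nonneg_left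
        ((hu.lipschitz_r hC ht hr0.le hz0.le).trans
          (mul_le_mul_of_nonneg_left hrz hC.nonneg)) hΛ0)
    have h5 : ‖ut u r t + c • ur u r t‖ ≤ η + 1 / η * ‖ut u r t + c • ur u r t‖ ^ 2 := by
      set W := ‖ut u r t + c • ur u r t‖
      have hW : 0 ≤ W := norm_nonneg _
      rw [one_div_mul_eq_div, ← sub_le_iff_le_add', le_div_iff₀ hη]
      nlinarith [sq_nonneg (W - η)]
    rw [h1]
    refine (norm_add_le _ _).trans ?_
    have h6 := norm_sub_le ((ut u r t + c • ur u r t) - (((d : ℝ) - 1) / r) • ur u r t)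
      (c • (ur u r t - ur u z t))
    have h7 := norm_sub_le (ut u r t + c • ur u r t) ((((d : ℝ) - 1) / r) • ur u r t)
    have h8 : (c + Λ) * C * |s - z| = c * (C * |s - z|) + Λ * (C * |s - z|) := by ring
    linarith
  rw [← hftc]
  refine intervalIntegral.norm_integral_le_integral_norm_uIoc.trans ?_
  have hvol : (volume : Measure ℝ).real (uIoc z s) = |s - z| := by
    rw [measureReal_def, Real.volume_uIoc, ENNReal.toReal_ofReal (abs_nonneg _)]
  have hfin : volume (uIoc z s) ≠ ⊤ := by rw [Real.volume_uIoc]; exact ENNReal.ofReal_ne_top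
  have hwi' := hwi.mono_set hsub
  have hci : Integrable (fun _ : ℝ => M) (volume.restrict (uIoc z s)) := integrableOn_const hfin
  calc ∫ r in uIoc z s, ‖urr u r t - k‖
      ≤ ∫ r in uIoc z s, (M + 1 / η * ‖ut u r t + c • ur u r t‖ ^ 2) := by
        refine setIntegral_mono_on ?_ (hci.add (hwi'.const_mul _))
          measurableSet_uIoc hpt
        exact (hcurr.sub continuous_const).norm.integrableOn_uIoc
    _ = M * |s - z| + 1 / η * ∫ r in uIoc z s, ‖ut u r t + c • ur u r t‖ ^ 2 := by
        rw [integral_add hci (hwi'.const_mul _), setIntegral_const, hvol,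
          integral_const_mul, smul_eq_mul, mul_comm]
    _ ≤ _ := by
        rw [intervalIntegral.integral_of_le hab]
        gcongr
        exact Eventually.of_forall fun r => by positivity

end IsRadialSolution

lemma Ultrafilter.exists_tendsto_of_norm_le {ι : Type*} (U : Ultrafilter ι) {g : ι → Euc n}
    {C : ℝ} (hg : ∀ᶠ i in U, ‖g i‖ ≤ C) : ∃ x, Tendsto g U (𝓝 x) := by
  obtain ⟨x, -, hx⟩ := (isCompact_closedBall (0 : Euc n) C).ultrafilter_le_nhds' (U.map g)
    (hg.mono fun i hi => by simpa using hi)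
  exact ⟨x, hx⟩

namespace InvasionSetting

variable {d : ℕ} {V : Euc n → ℝ} {D : EscData n V} {u : ℝ → ℝ → Euc n}
  {C ν K δ L₀ cHom : ℝ} {rHom : ℝ → ℝ}

/-- If there is no front invading `0` at speed `c`, then the dissipation in the frame travelling
at speed `c` is bounded from below around the escape point. -/
theorem exists_le_dissipation (h : InvasionSetting d V D u C ν K δ L₀ cHom rHom)
    (hnd : HNonDeg V) (hob : HOnlyBist V) {c : ℝ} (hc : 0 < c) (hempty : PhiInv V c 0 = ∅) :
    ∃ ε > 0, ∃ L > 0, ∃ R, ∃ t₀, ∀ t ≥ t₀, R ≤ rescF V d D.lmin u δ L₀ rHom t →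
      ε ≤ ∫ r in (rescF V d D.lmin u δ L₀ rHom t - L)..(rescF V d D.lmin u δ L₀ rHom t + L),
        ‖ut u r t + c • ur u r t‖ ^ 2 := by
  set f := rescF V d D.lmin u δ L₀ rHom with hf
  obtain ⟨A, hA, c₀, hc₀, R, hR⟩ := h.exists_le_integral
  rw [← hf] at hR
  by_contra! hcon
  have hseq : ∀ p : ℕ, ∃ t : ℝ, (p : ℝ) + 1 ≤ t ∧ 2 * (p : ℝ) + 2 + |R| ≤ f t ∧
      ∫ r in (f t - (p + 1))..(f t + (p + 1)), ‖ut u r t + c • ur u r t‖ ^ 2 < 1 / ((p : ℝ) + 1) := by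
    intro p
    obtain ⟨t, ht, hft, hlt⟩ := hcon (1 / ((p : ℝ) + 1)) (by positivity) (p + 1) (by positivity)
      (2 * (p : ℝ) + 2 + |R|) (p + 1)
    exact ⟨t, ht, hft, hlt⟩
  choose t ht hft hlt using hseq
  have hp0 : ∀ p : ℕ, (0 : ℝ) ≤ p := fun p => Nat.cast_nonneg p
  have ht0 : ∀ p, 0 < t p := fun p => by linarith [ht p, hp0 p]
  set U : Ultrafilter ℕ := hyperfilter ℕ with hU
  have hUle : (U : Filter ℕ) ≤ atTop := by rw [← Nat.cofinite_eq_atTop]; exact hyperfilter_le_cofinite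
  have hev : ∀ x : ℝ, ∀ᶠ p : ℕ in (U : Filter ℕ), x ≤ (p : ℝ) := fun x =>
    hUle (tendsto_natCast_atTop_atTop.eventually_ge_atTop x)
  have hinv : Tendsto (fun p : ℕ => 1 / ((p : ℝ) + 1)) U (𝓝 0) :=
    (tendsto_one_div_add_atTop_nhds_zero_nat (𝕜 := ℝ)).mono_left hUle
  have hmem : ∀ ξ : ℝ, ∀ᶠ p : ℕ in (U : Filter ℕ),
      f (t p) + ξ ∈ Icc (f (t p) - (p + 1)) (f (t p) + (p + 1)) := fun ξ =>
    (hev |ξ|).mono fun p hp => by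
      obtain ⟨h1, h2⟩ := abs_le.1 hp
      exact ⟨by linarith, by linarith⟩
  have hnn : ∀ p : ℕ, ∀ x ∈ Icc (f (t p) - (p + 1)) (f (t p) + (p + 1)), (p : ℝ) + 1 ≤ x :=
    fun p x hx => by linarith [hx.1, hft p, abs_nonneg R]
  have hpos : ∀ ξ : ℝ, ∀ᶠ p in (U : Filter ℕ), 0 ≤ f (t p) + ξ := fun ξ =>
    (hmem ξ).mono fun p hp => by linarith [hnn p _ hp, hp0 p]
  have hex1 : ∀ ξ : ℝ, ∃ x, Tendsto (fun p => u (f (t p) + ξ) (t p)) U (𝓝 x) := fun ξ =>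
    U.exists_tendsto_of_norm_le ((hpos ξ).mono fun p hp => h.bound.norm_le hp (ht0 p))
  have hex2 : ∀ ξ : ℝ, ∃ x, Tendsto (fun p => ur u (f (t p) + ξ) (t p)) U (𝓝 x) := fun ξ =>
    U.exists_tendsto_of_norm_le ((hpos ξ).mono fun p hp => h.bound.ur_le hp (ht0 p))
  choose φ hφ using hex1
  choose ψ hψ using hex2
  have hC := h.bound.nonneg
  obtain ⟨Λ, hΛ0, hΛ, -, -⟩ := exists_quadratic_bounds h.contDiff h.zero_mem.1 h.zero_val C
  have hgc := (contDiff_gradient h.contDiff).continuous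
  have hdφ : ∀ ξ, HasDerivAt φ (ψ ξ) ξ := by
    intro ξ
    refine hasDerivAt_of_norm_sub_le_sq (M := C) fun s => ?_
    have hlim : Tendsto (fun p => u (f (t p) + s) (t p) - u (f (t p) + ξ) (t p) -
        (s - ξ) • ur u (f (t p) + ξ) (t p)) U (𝓝 (φ s - φ ξ - (s - ξ) • ψ ξ)) :=
      ((hφ s).sub (hφ ξ)).sub ((hψ ξ).const_smul _)
    refine le_of_tendsto hlim.norm ?_
    filter_upwards [hpos s, hpos ξ] with p h1 h2
    have := h.sol.norm_sub_sub_smul_ur_le h.bound (ht0 p) h1 h2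
    rwa [add_sub_add_left_eq_sub] at this
  have hdψ : ∀ ξ, HasDerivAt ψ (-(c • ψ ξ) + gradient V (φ ξ)) ξ := by
    intro ξ
    refine hasDerivAt_of_norm_sub_le_sq (M := (c + Λ) * C) fun s => ?_
    have hη : ∀ η > 0, ‖ψ s - ψ ξ - (s - ξ) • (-(c • ψ ξ) + gradient V (φ ξ))‖ ≤
        (c + Λ) * C * |s - ξ| ^ 2 + η * |s - ξ| := by
      intro η hη
      have hlim : Tendsto (fun p => ur u (f (t p) + s) (t p) - ur u (f (t p) + ξ) (t p) -
          (s - ξ) • (-(c • ur u (f (t p) + ξ) (t p)) + gradient V (u (f (t p) + ξ) (t p)))) U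
          (𝓝 (ψ s - ψ ξ - (s - ξ) • (-(c • ψ ξ) + gradient V (φ ξ)))) :=
        ((hψ s).sub (hψ ξ)).sub ((((hψ ξ).const_smul c).neg.add
          ((hgc.tendsto _).comp (hφ ξ))).const_smul _)
      have hlim2 : Tendsto (fun p : ℕ => (η + 2 * |(d : ℝ) - 1| * C * (1 / ((p : ℝ) + 1)) +
          (c + Λ) * C * |s - ξ|) * |s - ξ| + 1 / η * (1 / ((p : ℝ) + 1))) U
          (𝓝 ((η + 2 * |(d : ℝ) - 1| * C * 0 + (c + Λ) * C * |s - ξ|) * |s - ξ| + 1 / η * 0)) :=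
        ((((hinv.const_mul _).const_add η).add_const _).mul_const _).add (hinv.const_mul _)
      have hle := le_of_tendsto_of_tendsto hlim.norm hlim2 (by
        filter_upwards [hmem s, hmem ξ] with p h1 h2
        have hp := hp0 p
        have ha : (p : ℝ) + 1 ≤ f (t p) - (p + 1) := by
          linarith [hft p, abs_nonneg R]
        have := h.sol.norm_sub_sub_smul_urr_le h.contDiff h.bound hc.le hΛ0 hη hΛ (ht0 p)
          (by linarith) h1 h2
        rw [add_sub_add_left_eq_sub] at this
        refine this.trans (add_le_add (mul_le_mul_of_nonneg_right ?_ (abs_nonneg _))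
          (mul_le_mul_of_nonneg_left (hlt p).le (by positivity)))
        have h3 : 2 * |(d : ℝ) - 1| * C / (1 + (f (t p) - (p + 1))) ≤
            2 * |(d : ℝ) - 1| * C * (1 / ((p : ℝ) + 1)) := by
          rw [mul_one_div]
          exact div_le_div_of_nonneg_left (by positivity) (by positivity) (by linarith)
        linarith)
      exact hle.trans_eq (by ring)
    refine le_of_forall_pos_le_add fun ε hε => ?_
    refine (hη (ε / (|s - ξ| + 1)) (by positivity)).trans ?_
    have : ε / (|s - ξ| + 1) * |s - ξ| ≤ ε := by
      rw [div_mul_eq_mul_div, div_le_iff₀ (by positivity)]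
      linarith
    linarith
  have hbφ : ∀ ξ, ‖φ ξ‖ ≤ C := fun ξ =>
    le_of_tendsto (hφ ξ).norm ((hpos ξ).mono fun p hp => h.bound.norm_le hp (ht0 p))
  have hbψ : ∀ ξ, ‖ψ ξ‖ ≤ C := fun ξ =>
    le_of_tendsto (hψ ξ).norm ((hpos ξ).mono fun p hp => h.bound.ur_le hp (ht0 p))
  have hesc : ∀ ξ > 0, ‖φ ξ‖ ≤ D.dEsc := by
    intro ξ hξ
    refine le_of_tendsto (hφ ξ).norm ?_
    have htt : Tendsto t U atTop :=
      tendsto_atTop_mono (fun p => (by linarith [ht p] : (p : ℝ) ≤ t p))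
        (tendsto_natCast_atTop_atTop.mono_left hUle)
    filter_upwards [htt.eventually (h.tendsto_sub_rescF.eventually_ge_atTop ξ)] with p hp
    rw [← hf] at hp
    exact (h.norm_le_of_rescF_lt (ht0 p) (r := f (t p) + ξ) (by rw [← hf]; linarith)
      (by linarith)).le
  have hnt : ∃ ξ, φ ξ ≠ 0 ∨ ψ ξ ≠ 0 := by
    have hpick : ∀ p : ℕ, ∃ ξ ∈ Icc (-A) A,
        c₀ / (4 * A) ≤ ‖u (f (t p) + ξ) (t p)‖ ^ 2 + ‖ur u (f (t p) + ξ) (t p)‖ ^ 2 := by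
      intro p
      by_contra! hno
      have h1 := hR (t p) (ht0 p) (by linarith [hft p, le_abs_self R, hp0 p])
      have h2 := intervalIntegral.integral_mono_on (μ := volume) (a := f (t p) - A) (b := f (t p) + A)
        (f := fun r => ‖u r (t p)‖ ^ 2 + ‖ur u r (t p)‖ ^ 2) (g := fun _ => c₀ / (4 * A))
        (by linarith)
        ((((h.sol.continuous_r (ht0 p)).norm.pow 2).add
          ((h.sol.continuous_ur (ht0 p)).norm.pow 2)).intervalIntegrable _ _)
        (continuous_const.intervalIntegrable _ _)
        fun r hr => by
          have := hno (r - f (t p)) ⟨by linarith [hr.1], by linarith [hr.2]⟩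
          rw [add_sub_cancel] at this
          exact this.le
      rw [intervalIntegral.integral_const, smul_eq_mul] at h2
      have h3 : (f (t p) + A - (f (t p) - A)) * (c₀ / (4 * A)) = c₀ / 2 := by field_simp; ring
      linarith
    choose x hx hxc using hpick
    obtain ⟨ξ, -, hξ⟩ := (isCompact_Icc (a := -A) (b := A)).ultrafilter_le_nhds' (U.map x)
      (Ultrafilter.mem_map.2 (Eventually.of_forall (f := (U : Filter ℕ)) hx))
    have hξ' : Tendsto x U (𝓝 ξ) := hξ
    have hxpos : ∀ᶠ p in (U : Filter ℕ), 0 ≤ f (t p) + x p := (hpos (-A)).mono fun p hp => by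
      linarith [(hx p).1]
    have hdiff : Tendsto (fun p => C * |x p - ξ|) U (𝓝 0) := by
      have := ((hξ'.sub_const ξ).abs).const_mul C
      simpa using this
    have hl1 : Tendsto (fun p => u (f (t p) + x p) (t p)) U (𝓝 (φ ξ)) := by
      have h1 : Tendsto (fun p => u (f (t p) + x p) (t p) - u (f (t p) + ξ) (t p)) U (𝓝 0) := by
        refine squeeze_zero_norm' ?_ hdiff
        filter_upwards [hxpos, hpos ξ] with p h1 h2
        have := h.sol.lipschitz_r h.bound (ht0 p) h1 h2
        rwa [add_sub_add_left_eq_sub] at this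
      have h2 := h1.add (hφ ξ)
      simpa using h2
    have hl2 : Tendsto (fun p => ur u (f (t p) + x p) (t p)) U (𝓝 (ψ ξ)) := by
      have h1 : Tendsto (fun p => ur u (f (t p) + x p) (t p) - ur u (f (t p) + ξ) (t p)) U
          (𝓝 0) := by
        refine squeeze_zero_norm' ?_ hdiff
        filter_upwards [hxpos, hpos ξ] with p h1 h2
        have := h.sol.lipschitz_ur h.bound (ht0 p) h1 h2
        rwa [add_sub_add_left_eq_sub] at this
      have h2 := h1.add (hψ ξ)
      simpa using h2
    have hge : c₀ / (4 * A) ≤ ‖φ ξ‖ ^ 2 + ‖ψ ξ‖ ^ 2 :=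
      ge_of_tendsto ((hl1.norm.pow 2).add (hl2.norm.pow 2)) (Eventually.of_forall hxc)
    refine ⟨ξ, ?_⟩
    by_contra! hzero
    rw [hzero.1, hzero.2] at hge
    have : 0 < c₀ / (4 * A) := by positivity
    simp at hge
    linarith
  have := phiInv_nonempty h.contDiff D h.zero_mem h.zero_val hnd hob hc hdφ hdψ hbφ hbψ hesc hnt
  rw [hempty] at this
  exact not_nonempty_empty this

end InvasionSetting

end Compactness

section Trapping

lemma wInt_nonneg {a κ β : ℝ} {G : ℝ → ℝ} (hG : ∀ r > 0, 0 ≤ G r) : 0 ≤ wInt a κ β G :=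
  setIntegral_nonneg measurableSet_Ioi fun r hr => mul_nonneg (weight_pos _ _ _).le (hG r hr)

lemma wInt_mono {a κ β B : ℝ} (ha : 0 < a) (hκ : 0 < κ) {G H : ℝ → ℝ}
    (hG : ContinuousOn G (Ioi 0)) (hH : ContinuousOn H (Ioi 0)) (hGb : ∀ r > 0, |G r| ≤ B)
    (hHb : ∀ r > 0, |H r| ≤ B) (hle : ∀ r > 0, G r ≤ H r) : wInt a κ β G ≤ wInt a κ β H :=
  setIntegral_mono_on (integrableOn_weight_mul ha hκ hG hGb) (integrableOn_weight_mul ha hκ hH hHb)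
    measurableSet_Ioi fun r hr => mul_le_mul_of_nonneg_left (hle r hr) (weight_pos _ _ _).le

lemma wInt_const_mul (a κ β k : ℝ) (G : ℝ → ℝ) :
    wInt a κ β (fun r => k * G r) = k * wInt a κ β G := by
  unfold wInt
  rw [← integral_const_mul]
  exact integral_congr_ae (Eventually.of_forall fun r => by ring)

lemma wInt_le {a κ β B : ℝ} (ha : 0 < a) (hκ : 0 < κ) (hB : 0 ≤ B) {G : ℝ → ℝ}
    (hG : ContinuousOn G (Ioi 0)) (hGb : ∀ r > 0, |G r| ≤ B) :
    wInt a κ β G ≤ B * (1 / a + 1 / κ) := by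
  have h1 := wInt_mono (β := β) ha hκ hG (H := fun _ => B) continuousOn_const hGb
    (fun _ _ => (abs_of_nonneg hB).le) fun r hr => (le_abs_self _).trans (hGb r hr)
  refine h1.trans ?_
  have h2 : wInt a κ β (fun _ => B) = B * ∫ r in Ioi 0, weight a κ (r - β) := by
    rw [wInt, ← integral_const_mul]
    exact integral_congr_ae (Eventually.of_forall fun r => by ring)
  rw [h2]
  exact mul_le_mul_of_nonneg_left (integral_weight_le ha hκ β _) hB

lemma wCurv_le {a c κ β R : ℝ} (hc : 0 < c) (hca : c ≤ a) (hκ : 0 < κ) (hR : 0 < R)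
    (hRβ : R ≤ β) :
    wCurv a κ β ≤ Real.exp (-(c * R / 2)) / c + 2 / R * (1 / c + 1 / κ) + Real.exp (-(c * R)) := by
  have ha : 0 < a := by linarith
  have hβ : 0 < β := by linarith
  have hcR : c * R ≤ a * β := mul_le_mul hca hRβ hR.le ha.le
  have h1 := integral_weight_div_le ha hκ hβ
  have h2 : weight a κ (-β) ≤ Real.exp (-(c * R)) :=
    (weight_le_exp_mul ha hκ (-β)).trans (Real.exp_le_exp.2 (by linarith))
  have h3 : Real.exp (-(a * β / 2)) / a ≤ Real.exp (-(c * R / 2)) / c :=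
    div_le_div₀ (Real.exp_pos _).le (Real.exp_le_exp.2 (by linarith)) hc hca
  have h4 : 2 / β * (1 / a + 1 / κ) ≤ 2 / R * (1 / c + 1 / κ) := by
    refine mul_le_mul (div_le_div_of_nonneg_left (by norm_num) hR hRβ) ?_ (by positivity)
      (by positivity)
    linarith [one_div_le_one_div_of_le hc hca]
  unfold wCurv
  linarith

lemma wInt_energy_le_and_ge {d : ℕ} {V : Euc n → ℝ} {u : ℝ → ℝ → Euc n} {C c κ : ℝ}
    (hu : IsRadialSolution d V u) (hV : ContDiff ℝ 2 V) (hC : UniformlyBounded u C)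
    (D : EscData n V) (h0 : (0 : Euc n) ∈ MinSet V) (hV0 : V 0 = 0) (hc : 0 < c) (hκ : 0 < κ) :
    ∃ Λ : ℝ, 0 ≤ Λ ∧ ∀ β t, 0 < t →
      -(Λ * wSigma c κ β u D.dEsc t) ≤
        wInt c κ β (fun r => ‖ur u r t‖ ^ 2 / 2 + V (u r t)) ∧
      wInt c κ β (fun r => ‖ur u r t‖ ^ 2 / 2 + V (u r t)) ≤
        Λ * wInt c κ β (fun r => ‖u r t‖ ^ 2 + ‖ur u r t‖ ^ 2) := by
  obtain ⟨Λ, hΛ, -, -, hVΛ⟩ := exists_quadratic_bounds hV h0.1 hV0 C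
  have hC0 := hC.nonneg
  refine ⟨(Λ + 1) + Λ * C ^ 2, by positivity, fun β t ht => ?_⟩
  have hcu := hu.continuous_r ht
  have hcr := hu.continuous_ur ht
  have hcE : Continuous fun r => ‖ur u r t‖ ^ 2 / 2 + V (u r t) :=
    ((hcr.norm.pow 2).div_const 2).add (hV.continuous.comp hcu)
  have hun : ∀ r > 0, ‖u r t‖ ^ 2 ≤ C ^ 2 := fun r hr =>
    pow_le_pow_left₀ (norm_nonneg _) (hC.norm_le hr.le ht) 2
  have hrn : ∀ r > 0, ‖ur u r t‖ ^ 2 ≤ C ^ 2 := fun r hr =>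
    pow_le_pow_left₀ (norm_nonneg _) (hC.ur_le hr.le ht) 2
  have hVu : ∀ r > 0, |V (u r t)| ≤ Λ * ‖u r t‖ ^ 2 := fun r hr =>
    hVΛ _ (hC.norm_le hr.le ht)
  have hVC : ∀ r > 0, |V (u r t)| ≤ Λ * C ^ 2 := fun r hr =>
    (hVu r hr).trans (mul_le_mul_of_nonneg_left (hun r hr) hΛ)
  have hEb : ∀ r > 0, |‖ur u r t‖ ^ 2 / 2 + V (u r t)| ≤ (2 + 2 * Λ) * C ^ 2 := by
    intro r hr
    have h1 := abs_le.1 (hVC r hr)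
    have h2 := hrn r hr
    have h3 : 0 ≤ ‖ur u r t‖ ^ 2 := by positivity
    rw [abs_le]
    constructor <;> nlinarith [mul_nonneg hΛ (sq_nonneg C)]
  constructor
  · have hmS := hu.measurableSet_Sigma0 ht D.dEsc
    have hint : IntegrableOn ((Sigma0 u D.dEsc t).indicator
        fun r => -(Λ * C ^ 2) * weight c κ (r - β)) (Ioi 0) :=
      (((integrable_weight hc hκ β).const_mul _).indicator hmS).integrableOn
    have h1 := setIntegral_mono_on hint
      (integrableOn_weight_mul (β := β) hc hκ hcE.continuousOn hEb) measurableSet_Ioi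
      fun r hr => by
        have hw := weight_pos c κ (r - β)
        by_cases hS : r ∈ Sigma0 u D.dEsc t
        · rw [indicator_of_mem hS, mul_comm]
          refine mul_le_mul_of_nonneg_left ?_ hw.le
          have h3 : 0 ≤ ‖ur u r t‖ ^ 2 := by positivity
          linarith [(abs_le.1 (hVC r hr)).1]
        · rw [indicator_of_notMem hS]
          refine mul_nonneg hw.le (add_nonneg (by positivity) ?_)
          rw [← hV0]
          refine D.potential_ge hV h0 ?_
          rw [sub_zero]
          by_contra! hlt
          exact hS ⟨(mem_Ioi.1 hr).le, hlt⟩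
    rw [setIntegral_indicator hmS, integral_const_mul] at h1
    have h2 : 0 ≤ wSigma c κ β u D.dEsc t :=
      integral_nonneg fun r => (weight_pos _ _ _).le
    change -(Λ * C ^ 2) * wSigma c κ β u D.dEsc t ≤ wInt c κ β _ at h1
    refine le_trans ?_ h1
    have : 0 ≤ (Λ + 1) * wSigma c κ β u D.dEsc t := by positivity
    linarith
  · have hcG : Continuous fun r => ((Λ + 1) + Λ * C ^ 2) * (‖u r t‖ ^ 2 + ‖ur u r t‖ ^ 2) :=
      ((hcu.norm.pow 2).add (hcr.norm.pow 2)).const_mul _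
    rw [← wInt_const_mul]
    refine wInt_mono (B := (2 + 2 * Λ) * C ^ 2 + ((Λ + 1) + Λ * C ^ 2) * (2 * C ^ 2)) hc hκ
      hcE.continuousOn hcG.continuousOn
      (fun r hr => (hEb r hr).trans (le_add_of_nonneg_right (by positivity)))
      (fun r hr => ?_) fun r hr => ?_
    · rw [abs_of_nonneg (by positivity)]
      have h1 := hun r hr
      have h2 := hrn r hr
      refine le_add_of_nonneg_of_le (by positivity)
        (mul_le_mul_of_nonneg_left (by linarith) (by positivity))
    · have h1 := (abs_le.1 (hVu r hr)).2
      have h2 : 0 ≤ ‖ur u r t‖ ^ 2 := by positivity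
      have h3 : 0 ≤ ‖u r t‖ ^ 2 := by positivity
      have h4 : 0 ≤ Λ * C ^ 2 * (‖u r t‖ ^ 2 + ‖ur u r t‖ ^ 2) := by positivity
      have h5 : 0 ≤ Λ * ‖ur u r t‖ ^ 2 := by positivity
      linarith

lemma wInt_ge_integral {a κ β B x y : ℝ} (ha : 0 < a) (hκ : 0 < κ) {G : ℝ → ℝ}
    (hG : ContinuousOn G (Ioi 0)) (hGb : ∀ r > 0, |G r| ≤ B) (hG0 : ∀ r > 0, 0 ≤ G r)
    (hx : 0 < x) (hxy : x ≤ y) (hy : y ≤ β) :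
    Real.exp (-((a + κ) / κ * Real.log 2)) * Real.exp (a * (x - β)) * ∫ r in x..y, G r ≤
      wInt a κ β G := by
  have hsub : Icc x y ⊆ Ioi 0 := fun r hr => hx.trans_le hr.1
  have hsub' : Ioc x y ⊆ Ioi 0 := Ioc_subset_Icc_self.trans hsub
  have hi := integrableOn_weight_mul (β := β) ha hκ hG hGb
  have h1 : ∫ r in Ioc x y, weight a κ (r - β) * G r ≤ wInt a κ β G :=
    setIntegral_mono_set hi ((ae_restrict_iff' measurableSet_Ioi).2 (Eventually.of_forall
      fun r hr => mul_nonneg (weight_pos _ _ _).le (hG0 r hr))) (LE.le.eventuallyLE hsub')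
  refine le_trans ?_ h1
  rw [intervalIntegral.integral_of_le hxy, ← integral_const_mul]
  refine setIntegral_mono_on (((hG.mono hsub).integrableOn_Icc.mono_set
    Ioc_subset_Icc_self).const_mul _) (hi.mono_set hsub') measurableSet_Ioc fun r hr => ?_
  refine mul_le_mul_of_nonneg_right ?_ (hG0 r (hsub' hr))
  refine le_trans ?_ (exp_mul_le_weight ha hκ (by linarith [hr.2] : r - β ≤ 0))
  refine mul_le_mul_of_nonneg_left (Real.exp_le_exp.2 ?_) (Real.exp_pos _).le
  exact mul_le_mul_of_nonneg_left (by linarith [hr.1]) ha.le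

namespace InvasionSetting

variable {d : ℕ} {V : Euc n → ℝ} {D : EscData n V} {u : ℝ → ℝ → Euc n}
  {C ν K δ L₀ cHom : ℝ} {rHom : ℝ → ℝ} {r t : ℝ}

lemma wSigma_le (h : InvasionSetting d V D u C ν K δ L₀ cHom rHom) {a κ β : ℝ} (ha : 0 < a)
    (hκ : 0 < κ) (ht : 0 < t) :
    wSigma a κ β u D.dEsc t ≤ Real.exp (a * (rescF V d D.lmin u δ L₀ rHom t - β)) / a +
      Real.exp (-κ * (rHom t - β)) / κ := by
  refine integral_weight_of_subset ha hκ fun r hr => ?_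
  by_contra! hno
  rw [mem_union, not_or, mem_Iic, mem_Ioi, not_le, not_lt] at hno
  exact absurd hr.2.2 (h.norm_le_of_rescF_lt ht hno.1 hno.2).le.not_gt

end InvasionSetting

lemma exists_error_le {c κ η : ℝ} (hc : 0 < c) (hκ : 0 < κ) (hη : 0 < η) (X ρ : ℝ) :
    ∃ R > 0, Real.exp ((c + κ) * X) * Real.exp (-κ * R) / κ ≤ η ∧
      Real.exp (c * X) * (Real.exp (-(c * R / 2)) / c + 2 / R * (1 / c + 1 / κ) +
        Real.exp (-(c * R))) ≤ η ∧ Real.exp (c * (ρ - R)) ≤ η := by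
  have hexp : ∀ k > 0, Tendsto (fun R : ℝ => Real.exp (-(k * R))) atTop (𝓝 0) := fun k hk =>
    Real.tendsto_exp_neg_atTop_nhds_zero.comp (tendsto_id.const_mul_atTop hk)
  have h1 : Tendsto (fun R : ℝ => Real.exp ((c + κ) * X) * Real.exp (-κ * R) / κ) atTop
      (𝓝 0) := by
    have := ((hexp κ hκ).const_mul (Real.exp ((c + κ) * X))).div_const κ
    simpa [neg_mul] using this
  have h2 : Tendsto (fun R : ℝ => Real.exp (c * X) * (Real.exp (-(c * R / 2)) / c +
      2 / R * (1 / c + 1 / κ) + Real.exp (-(c * R)))) atTop (𝓝 0) := by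
    have e1 := (hexp (c / 2) (by positivity)).div_const c
    have e2 := ((tendsto_const_nhds (x := (2 : ℝ))).div_atTop tendsto_id).mul_const (1 / c + 1 / κ)
    have := ((e1.add e2).add (hexp c hc)).const_mul (Real.exp (c * X))
    simp only [zero_div, zero_mul, add_zero, mul_zero] at this
    refine this.congr fun R => ?_
    simp only [id]
    rw [show c / 2 * R = c * R / 2 by ring]
  have h3 : Tendsto (fun R : ℝ => Real.exp (c * (ρ - R))) atTop (𝓝 0) := by
    have := (hexp c hc).const_mul (Real.exp (c * ρ))
    rw [mul_zero] at this
    refine this.congr fun R => ?_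
    rw [← Real.exp_add]
    ring_nf
  obtain ⟨R, hR, a1, a2, a3⟩ := ((eventually_gt_atTop 0).and ((h1.eventually_le_const hη).and
    ((h2.eventually_le_const hη).and (h3.eventually_le_const hη)))).exists
  exact ⟨R, hR, a1, a2, a3⟩

end Trapping

section TrappingFunctionals

namespace InvasionSetting

variable {d : ℕ} {V : Euc n → ℝ} {D : EscData n V} {u : ℝ → ℝ → Euc n}
  {C ν K δ L₀ cHom : ℝ} {rHom : ℝ → ℝ}

/-- Dissipation in a frame travelling at a speed `c` that is not the speed of a front. -/
lemma exists_le_wInt_dissipation (h : InvasionSetting d V D u C ν K δ L₀ cHom rHom)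
    (hnd : HNonDeg V) (hob : HOnlyBist V) {c κ : ℝ} (hc : 0 < c) (hκ : 0 < κ)
    (hempty : PhiInv V c 0 = ∅) :
    ∃ ε > 0, ∃ L > 0, ∃ R, ∃ t₀ > 0, ∀ t ≥ t₀, ∀ β, R ≤ rescF V d D.lmin u δ L₀ rHom t →
      rescF V d D.lmin u δ L₀ rHom t + L ≤ β →
      ε * Real.exp (c * (rescF V d D.lmin u δ L₀ rHom t - β)) ≤
        wInt c κ β (fun r => ‖ut u r t + c • ur u r t‖ ^ 2) := by
  obtain ⟨ε, hε, L, hL, R, t₀, H⟩ := h.exists_le_dissipation hnd hob hc hempty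
  set m := Real.exp (-((c + κ) / κ * Real.log 2)) with hm
  have hm0 : 0 < m := Real.exp_pos _
  refine ⟨m * Real.exp (-(c * L)) * ε, by positivity, L, hL, max R (L + 1), max t₀ 1, by positivity,
    fun t ht β hR hβ => ?_⟩
  have ht0 : 0 < t := by linarith [le_max_right t₀ 1]
  set F := rescF V d D.lmin u δ L₀ rHom t with hF
  have h1 := H t ((le_max_left _ _).trans ht) ((le_max_left _ _).trans hR)
  have h2 : L + 1 ≤ F := (le_max_right _ _).trans hR
  have hcont : ContinuousOn (fun r => ‖ut u r t + c • ur u r t‖ ^ 2) (Ioi 0) :=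
    ((h.sol.continuousOn_ut_r h.contDiff ht0).add
      ((h.sol.continuous_ur ht0).continuousOn.const_smul c)).norm.pow 2
  have hb : ∀ r > 0, |‖ut u r t + c • ur u r t‖ ^ 2| ≤ (C + c * C) ^ 2 := by
    intro r hr
    rw [abs_of_nonneg (by positivity)]
    refine pow_le_pow_left₀ (norm_nonneg _) ((norm_add_le _ _).trans ?_) 2
    rw [norm_smul, Real.norm_of_nonneg hc.le]
    exact add_le_add (h.bound.ut_le hr.le ht0)
      (mul_le_mul_of_nonneg_left (h.bound.ur_le hr.le ht0) hc.le)
  have h3 := wInt_ge_integral (κ := κ) hc hκ hcont hb (fun r _ => by positivity)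
    (by linarith : 0 < F - L) (by linarith) hβ
  refine le_trans ?_ h3
  have h4 : m * Real.exp (-(c * L)) * ε * Real.exp (c * (F - β)) =
      m * Real.exp (c * (F - L - β)) * ε := by
    rw [show c * (F - L - β) = -(c * L) + c * (F - β) by ring, Real.exp_add]
    ring
  rw [h4]
  exact mul_le_mul_of_nonneg_left h1 (by positivity)

set_option maxHeartbeats 1000000 in
/-- The functionals to which `exists_no_trapped` applies. -/
lemma exists_functionals (h : InvasionSetting d V D u C ν K δ L₀ cHom rHom)
    (hnd : HNonDeg V) (hob : HOnlyBist V) {c : ℝ} (hc : 0 < c) (hempty : PhiInv V c 0 = ∅) :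
    ∃ ν' > 0, ∃ k > 0, ∃ ε > 0, Real.exp c ≤ k ∧ ∀ q > 0, ∃ B R t₀, 0 < R ∧ 0 < t₀ ∧
      ∀ b₀ : ℝ, ∃ M P E N Q : ℝ → ℝ, ∀ t ≥ t₀, ∀ y : ℝ,
        y = Real.exp (c * (rescF V d D.lmin u δ L₀ rHom t - (b₀ + c * t))) →
        rescF V d D.lmin u δ L₀ rHom t ≤ b₀ + c * t + 1 → R ≤ b₀ + c * t →
        b₀ + c * t + R ≤ rHom t →
        (∃ M', HasDerivAt M M' t ∧ M' ≤ -ν' * N t + k * y + q) ∧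
        (∃ P', HasDerivAt P P' t ∧ P' ≤ -ν' * Q t + q) ∧
        (∃ E', HasDerivAt E E' t ∧ E' ≤ -ε * y + k * Q t + q) ∧
        (0 ≤ M t ∧ M t ≤ N t) ∧ (0 ≤ P t ∧ P t ≤ Q t) ∧
        (-k * y - q ≤ E t ∧ E t ≤ k * N t) ∧ M t ≤ B ∧ P t ≤ B := by
  have hl := D.lmin_pos
  have hC0 := h.bound.nonneg
  set κ := min 1 (D.lmin / (2 * (c + 1))) with hκdef
  have hκ : 0 < κ := by positivity
  have hcκ : κ * (c + κ) ≤ D.lmin / 2 := by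
    have h1 : κ ≤ D.lmin / (2 * (c + 1)) := min_le_right _ _
    rw [le_div_iff₀ (by positivity)] at h1
    have h2 : κ * κ ≤ κ * 1 := mul_le_mul_of_nonneg_left (min_le_left _ _) hκ.le
    linarith
  clear_value κ
  have hcκ0 : 0 < c + κ := by linarith
  obtain ⟨K₁, hK₁, hmass⟩ := h.sol.mass_deriv_le h.contDiff h.bound D h.zero_mem h.zero_val hc hκ hcκ
  obtain ⟨K₂, hK₂, henergy⟩ := h.sol.energy_deriv_le h.contDiff h.bound h.zero_mem h.zero_val hc hκ
  obtain ⟨Λ, hΛ, hEΛ⟩ := wInt_energy_le_and_ge h.sol h.contDiff h.bound D h.zero_mem h.zero_val hc hκ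
  obtain ⟨ε₀, hε₀, L, hL, ρ, t₀, ht₀, hdiss⟩ := h.exists_le_wInt_dissipation hnd hob hc hκ hempty
  set f := rescF V d D.lmin u δ L₀ rHom with hf
  set ν' := min (D.lmin / 4) 1 with hν'
  set k := K₁ / c + 1 / 2 * (c + κ) ^ 2 + Λ + Λ / c + Real.exp c + 1 with hk
  have hk0 : 0 < k := by positivity
  have hKc : 0 ≤ K₁ / c := by positivity
  have hΛc : 0 ≤ Λ / c := by positivity
  have hs : 0 ≤ (c + κ) ^ 2 := by positivity
  have hk1 : K₁ / c ≤ k := by linarith [Real.exp_pos c]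
  have hk2 : 1 / 2 * (c + κ) ^ 2 ≤ k := by linarith [Real.exp_pos c]
  have hk3 : Λ ≤ k := by linarith [Real.exp_pos c]
  have hk4 : Λ / c ≤ k := by linarith [Real.exp_pos c]
  refine ⟨ν', by positivity, k, hk0, ε₀ / 2, by positivity, by linarith, fun q hq => ?_⟩
  clear_value k ν'
  set Z := 3 * K₁ + K₂ + Λ + ε₀ + 1 with hZ
  have hZ0 : 0 < Z := by positivity
  set η := q / Z with hη
  have hη0 : 0 < η := by positivity
  have hηq : Z * η = q := by rw [hη]; field_simp
  clear_value η
  obtain ⟨X₀, hX₀, hX₀η⟩ := exists_exp_le (κ := 2 * κ) (by positivity) hη0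
    (Real.exp (c + κ) / (c + κ))
  set X := max X₀ (L + 1) with hX
  have hX1 : X₀ ≤ X := le_max_left _ _
  have hX2 : L + 1 ≤ X := le_max_right _ _
  clear_value X
  have hXη : Real.exp (c + κ) / (c + κ) * Real.exp (-κ * X) ≤ η := by
    refine le_trans (mul_le_mul_of_nonneg_left (Real.exp_le_exp.2 ?_) (by positivity)) hX₀η
    have := mul_le_mul_of_nonneg_left hX1 hκ.le
    linarith
  obtain ⟨R, hR, hRa, hRb, hRc⟩ := exists_error_le hc hκ hη0 X ρ
  set e := Real.exp (c * X) with he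
  have he0 : 0 < e := Real.exp_pos _
  refine ⟨e * (C ^ 2 / 2 * (1 / c + 1 / κ)), R, t₀, hR, ht₀, fun b₀ => ?_⟩
  refine ⟨fun t => e * wInt c κ (b₀ + X + c * t) (fun r => ‖u r t‖ ^ 2 / 2),
    fun t => e * wInt (c + κ) κ (b₀ + X + c * t) (fun r => ‖u r t‖ ^ 2 / 2),
    fun t => e * wInt c κ (b₀ + X + c * t) (fun r => ‖ur u r t‖ ^ 2 / 2 + V (u r t)),
    fun t => e * wInt c κ (b₀ + X + c * t) (fun r => ‖u r t‖ ^ 2 + ‖ur u r t‖ ^ 2),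
    fun t => e * wInt (c + κ) κ (b₀ + X + c * t) (fun r => ‖u r t‖ ^ 2 + ‖ur u r t‖ ^ 2),
    fun t ht y hy hfb hRb₀ hRh => ?_⟩
  have ht0 : 0 < t := ht₀.trans_le ht
  have hy0 : 0 < y := hy ▸ Real.exp_pos _
  set β := b₀ + X + c * t with hβ
  -- scaled source terms
  have htail : e * (Real.exp (-κ * (rHom t - β)) / κ) ≤ η := by
    refine le_trans ?_ hRa
    rw [← mul_div_assoc]
    refine div_le_div_of_nonneg_right ?_ hκ.le
    rw [he, ← Real.exp_add, ← Real.exp_add]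
    refine Real.exp_le_exp.2 ?_
    have := mul_le_mul_of_nonneg_left (by linarith : R - X ≤ rHom t - β) hκ.le
    linarith
  have hey : e * Real.exp (c * (f t - β)) = y := by
    rw [hy, he, ← Real.exp_add]
    congr 1
    rw [hβ]; ring
  have hσ1 : e * wSigma c κ β u D.dEsc t ≤ y / c + η := by
    have h1 := mul_le_mul_of_nonneg_left (h.wSigma_le (β := β) hc hκ ht0) he0.le
    rw [← hf, mul_add, ← mul_div_assoc e (Real.exp (c * (f t - β))), hey] at h1
    linarith
  have hσ2 : e * wSigma (c + κ) κ β u D.dEsc t ≤ η + η := by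
    have h1 := mul_le_mul_of_nonneg_left (h.wSigma_le (β := β) hcκ0 hκ ht0) he0.le
    rw [← hf, mul_add] at h1
    have h2 : e * (Real.exp ((c + κ) * (f t - β)) / (c + κ)) ≤
        Real.exp (c + κ) / (c + κ) * Real.exp (-κ * X) := by
      rw [← mul_div_assoc, div_mul_eq_mul_div]
      refine div_le_div_of_nonneg_right ?_ hcκ0.le
      rw [he, ← Real.exp_add, ← Real.exp_add]
      refine Real.exp_le_exp.2 ?_
      have := mul_le_mul_of_nonneg_left (by linarith : f t - β ≤ 1 - X) hcκ0.le
      linarith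
    linarith
  have hcurv : ∀ a, c ≤ a → e * wCurv a κ β ≤ η := fun a ha =>
    (mul_le_mul_of_nonneg_left (wCurv_le hc ha hκ hR (by linarith)) he0.le).trans hRb
  have hw1 := hcurv c le_rfl
  have hw2 := hcurv (c + κ) (by linarith)
  have hcu := h.sol.continuous_r ht0
  have hcr := h.sol.continuous_ur ht0
  have hun : ∀ r > 0, ‖u r t‖ ^ 2 ≤ C ^ 2 := fun r hr =>
    pow_le_pow_left₀ (norm_nonneg _) (h.bound.norm_le hr.le ht0) 2
  have hrn : ∀ r > 0, ‖ur u r t‖ ^ 2 ≤ C ^ 2 := fun r hr =>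
    pow_le_pow_left₀ (norm_nonneg _) (h.bound.ur_le hr.le ht0) 2
  have hcm : ContinuousOn (fun r => ‖u r t‖ ^ 2 / 2) (Ioi 0) :=
    ((hcu.norm.pow 2).div_const 2).continuousOn
  have hcs : ContinuousOn (fun r => ‖u r t‖ ^ 2 + ‖ur u r t‖ ^ 2) (Ioi 0) :=
    ((hcu.norm.pow 2).add (hcr.norm.pow 2)).continuousOn
  have hck : ContinuousOn (fun r => ‖ur u r t‖ ^ 2) (Ioi 0) := (hcr.norm.pow 2).continuousOn
  have hbm : ∀ r > 0, |‖u r t‖ ^ 2 / 2| ≤ C ^ 2 / 2 := fun r hr => by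
    rw [abs_of_nonneg (by positivity)]; linarith [hun r hr]
  have hbs : ∀ r > 0, |‖u r t‖ ^ 2 + ‖ur u r t‖ ^ 2| ≤ 2 * C ^ 2 := fun r hr => by
    rw [abs_of_nonneg (by positivity)]; linarith [hun r hr, hrn r hr]
  have hbk : ∀ r > 0, |‖ur u r t‖ ^ 2| ≤ 2 * C ^ 2 := fun r hr => by
    rw [abs_of_nonneg (by positivity)]; linarith [hrn r hr, sq_nonneg C]
  have hmle : ∀ a > 0, 0 ≤ e * wInt a κ β (fun r => ‖u r t‖ ^ 2 / 2) ∧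
      e * wInt a κ β (fun r => ‖u r t‖ ^ 2 / 2) ≤
        e * wInt a κ β (fun r => ‖u r t‖ ^ 2 + ‖ur u r t‖ ^ 2) := fun a ha =>
    ⟨mul_nonneg he0.le (wInt_nonneg fun r _ => by positivity),
      mul_le_mul_of_nonneg_left (wInt_mono (B := 2 * C ^ 2) ha hκ hcm hcs
        (fun r hr => (hbm r hr).trans (by linarith [sq_nonneg C])) hbs fun r _ => by
          have h1 : 0 ≤ ‖u r t‖ ^ 2 := by positivity
          have h2 : 0 ≤ ‖ur u r t‖ ^ 2 := by positivity
          linarith) he0.le⟩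
  have hyk : K₁ * (y / c) ≤ k * y := by
    have := mul_le_mul_of_nonneg_right hk1 hy0.le
    rwa [div_mul_eq_mul_div, mul_div_assoc] at this
  have hyk' : Λ * (y / c) ≤ k * y := by
    have := mul_le_mul_of_nonneg_right hk4 hy0.le
    rwa [div_mul_eq_mul_div, mul_div_assoc] at this
  have hK₁η : 0 ≤ K₁ * η := by positivity
  have hK₂η : 0 ≤ K₂ * η := by positivity
  have hΛη : 0 ≤ Λ * η := by positivity
  have hεη : 0 ≤ ε₀ * η := by positivity
  have hηq' : 3 * (K₁ * η) + K₂ * η + Λ * η + ε₀ * η + η = q := by rw [← hηq, hZ]; ring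
  refine ⟨?_, ?_, ?_, hmle c hc, hmle (c + κ) hcκ0, ⟨?_, ?_⟩, ?_, ?_⟩
  · obtain ⟨M', hM', hle⟩ := hmass c (Or.inl rfl) (b₀ + X) t ht0
    refine ⟨e * M', hM'.const_mul e, ?_⟩
    have h1 := mul_le_mul_of_nonneg_left hle he0.le
    have h2 := mul_le_mul_of_nonneg_left (add_le_add hσ1 hw1) hK₁
    rw [← hβ] at h1
    linarith
  · obtain ⟨M', hM', hle⟩ := hmass (c + κ) (Or.inr rfl) (b₀ + X) t ht0
    refine ⟨e * M', hM'.const_mul e, ?_⟩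
    have h1 := mul_le_mul_of_nonneg_left hle he0.le
    have h2 := mul_le_mul_of_nonneg_left (add_le_add hσ2 hw2) hK₁
    rw [← hβ] at h1
    linarith
  · obtain ⟨E', hE', hle⟩ := henergy (b₀ + X) t ht0
    refine ⟨e * E', hE'.const_mul e, ?_⟩
    have h1 := mul_le_mul_of_nonneg_left hle he0.le
    rw [← hβ] at h1
    have h2 := mul_le_mul_of_nonneg_left hw1 hK₂
    have hdis : ε₀ * y - ε₀ * η ≤ e * wInt c κ β (fun r => ‖ut u r t + c • ur u r t‖ ^ 2) := by
      rcases le_or_gt ρ (f t) with hρ | hρ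
      · have h3 := mul_le_mul_of_nonneg_left (hdiss t ht β hρ (by linarith)) he0.le
        have h4 : e * (ε₀ * Real.exp (c * (f t - β))) = ε₀ * y := by rw [← hey]; ring
        linarith
      · have h3 : 0 ≤ e * wInt c κ β (fun r => ‖ut u r t + c • ur u r t‖ ^ 2) :=
          mul_nonneg he0.le (wInt_nonneg fun r _ => by positivity)
        have h4 : y ≤ η := by
          refine le_trans ?_ hRc
          rw [hy]
          exact Real.exp_le_exp.2 (mul_le_mul_of_nonneg_left (by linarith) hc.le)
        have h5 := mul_le_mul_of_nonneg_left h4 hε₀.le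
        linarith
    have hkin : wInt (c + κ) κ β (fun r => ‖ur u r t‖ ^ 2) ≤
        wInt (c + κ) κ β (fun r => ‖u r t‖ ^ 2 + ‖ur u r t‖ ^ 2) :=
      wInt_mono hcκ0 hκ hck hcs hbk hbs fun r _ => le_add_of_nonneg_left (by positivity)
    have h3 : 1 / 2 * (c + κ) ^ 2 * (e * wInt (c + κ) κ β (fun r => ‖ur u r t‖ ^ 2)) ≤
        k * (e * wInt (c + κ) κ β (fun r => ‖u r t‖ ^ 2 + ‖ur u r t‖ ^ 2)) :=
      mul_le_mul hk2 (mul_le_mul_of_nonneg_left hkin he0.le)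
        (mul_nonneg he0.le (wInt_nonneg fun r _ => by positivity)) hk0.le
    linarith
  · have h1 := mul_le_mul_of_nonneg_left (hEΛ β t ht0).1 he0.le
    have h2 := mul_le_mul_of_nonneg_left hσ1 hΛ
    linarith
  · have h1 := mul_le_mul_of_nonneg_left (hEΛ β t ht0).2 he0.le
    have h2 : 0 ≤ e * wInt c κ β (fun r => ‖u r t‖ ^ 2 + ‖ur u r t‖ ^ 2) :=
      mul_nonneg he0.le (wInt_nonneg fun r _ => by positivity)
    have h3 := mul_le_mul_of_nonneg_right hk3 h2
    linarith
  · exact mul_le_mul_of_nonneg_left (wInt_le hc hκ (by positivity) hcm hbm) he0.le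
  · refine mul_le_mul_of_nonneg_left ((wInt_le hcκ0 hκ (by positivity) hcm hbm).trans
      (mul_le_mul_of_nonneg_left ?_ (by positivity))) he0.le
    have := one_div_le_one_div_of_le hc (by linarith : c ≤ c + κ)
    linarith

end InvasionSetting

end TrappingFunctionals

section MeanSpeeds

lemma limsup_div_le_of_le_linear {g : ℝ → ℝ} {c B : ℝ} (hg : ∀ s > 0, g s ≤ c * s + B)
    (hco : IsCoboundedUnder (· ≤ ·) atTop fun s => g s / s) :
    limsup (fun s => g s / s) atTop ≤ c := by
  have hlim : Tendsto (fun s : ℝ => c + B / s) atTop (𝓝 c) := by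
    simpa using (tendsto_const_nhds (x := B)).div_atTop tendsto_id |>.const_add c
  rw [← hlim.limsup_eq]
  refine limsup_le_limsup ?_ hco hlim.isBoundedUnder_le
  filter_upwards [eventually_gt_atTop 0] with s hs
  rw [div_le_iff₀ hs, add_mul, div_mul_cancel₀ _ hs.ne']
  exact hg s hs

lemma le_limsup_div_of_linear_le {g : ℝ → ℝ} {c B : ℝ} (hg : ∀ s > 0, c * s - B ≤ g s)
    (hb : IsBoundedUnder (· ≤ ·) atTop fun s => g s / s) :
    c ≤ limsup (fun s => g s / s) atTop := by
  have hlim : Tendsto (fun s : ℝ => c - B / s) atTop (𝓝 c) := by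
    simpa using (tendsto_const_nhds (x := B)).div_atTop tendsto_id |>.const_sub c
  rw [← hlim.limsup_eq]
  refine limsup_le_limsup ?_ hlim.isCoboundedUnder_le hb
  filter_upwards [eventually_gt_atTop 0] with s hs
  rw [le_div_iff₀ hs, sub_mul, div_mul_cancel₀ _ hs.ne']
  exact hg s hs

lemma tendsto_div_of_linear_bounds {g : ℝ → ℝ} {l : ℝ}
    (hlow : ∀ a < l, ∃ c > a, ∃ B, ∀ s > 0, c * s - B ≤ g s)
    (hupp : ∀ b > l, ∃ c < b, ∃ B, ∀ s > 0, g s ≤ c * s + B) :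
    Tendsto (fun s => g s / s) atTop (𝓝 l) := by
  rw [tendsto_order]
  constructor
  · intro a ha
    obtain ⟨c, hc, B, hB⟩ := hlow a ha
    have hlim : Tendsto (fun s : ℝ => c - B / s) atTop (𝓝 c) := by
      simpa using (tendsto_const_nhds (x := B)).div_atTop tendsto_id |>.const_sub c
    filter_upwards [hlim.eventually_const_lt hc, eventually_gt_atTop 0] with s h1 hs
    refine h1.trans_le ?_
    rw [le_div_iff₀ hs, sub_mul, div_mul_cancel₀ _ hs.ne']
    exact hB s hs
  · intro b hb
    obtain ⟨c, hc, B, hB⟩ := hupp b hb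
    have hlim : Tendsto (fun s : ℝ => c + B / s) atTop (𝓝 c) := by
      simpa using (tendsto_const_nhds (x := B)).div_atTop tendsto_id |>.const_add c
    filter_upwards [hlim.eventually_lt_const hc, eventually_gt_atTop 0] with s h1 hs
    refine lt_of_le_of_lt ?_ h1
    rw [div_le_iff₀ hs, add_mul, div_mul_cancel₀ _ hs.ne']
    exact hB s hs

/-- If, for a dense set of speeds, all increments lie on one side of that speed up to a bounded
error, then all mean speeds coincide. -/
lemma mean_speeds_eq {f : ℝ → ℝ} {A : ℝ} (hf : ∀ t ≥ 0, 0 ≤ f t)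
    (hup : ∀ t ≥ 0, ∀ s ≥ 0, f (t + s) ≤ f t + A * (s + 1))
    (hpos : 0 < limsup (fun t => f t / t) atTop)
    (hdich : ∀ a b, 0 < a → a < b → ∃ c ∈ Ioo a b,
      (∃ B, ∀ t ≥ 0, ∀ s ≥ 0, c * s - B ≤ f (t + s) - f t) ∨
      (∃ B, ∀ t ≥ 0, ∀ s ≥ 0, f (t + s) - f t ≤ c * s + B)) :
    cunderF f = cbarF f ∧ liminf (fun t => f t / t) atTop = cbarF f ∧
      limsup (fun t => f t / t) atTop = cbarF f := by
  set l := limsup (fun t => f t / t) atTop with hl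
  have hupp0 : ∀ s > 0, f s ≤ A * s + (f 0 + A) := fun s hs => by
    have := hup 0 le_rfl s hs.le
    rw [zero_add] at this
    linarith
  have hbdd : IsBoundedUnder (· ≤ ·) atTop fun s => f s / s := by
    refine isBoundedUnder_of_eventually_le (a := A + |f 0 + A|) ?_
    filter_upwards [eventually_ge_atTop 1] with s hs
    rw [div_le_iff₀ (by linarith)]
    have h1 := hupp0 s (by linarith)
    have h2 : |f 0 + A| * 1 ≤ |f 0 + A| * s := mul_le_mul_of_nonneg_left hs (abs_nonneg _)
    linarith [le_abs_self (f 0 + A)]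
  have hcob : IsCoboundedUnder (· ≤ ·) atTop fun s => f s / s := by
    refine IsBoundedUnder.isCoboundedUnder_le
      (isBoundedUnder_of_eventually_ge (a := 0) ?_)
    filter_upwards [eventually_gt_atTop 0] with s hs
    exact div_nonneg (hf s hs.le) hs.le
  have hlow : ∀ a < l, ∃ c > a, ∃ B, ∀ t ≥ 0, ∀ s ≥ 0, c * s - B ≤ f (t + s) - f t := by
    intro a ha
    obtain ⟨c, hc, hB | ⟨B, hB⟩⟩ := hdich ((max a 0 + l) / 2) l
      (by linarith [le_max_right a 0]) (by linarith [max_lt ha hpos])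
    · exact ⟨c, by linarith [hc.1, max_lt ha hpos, le_max_left a 0], hB⟩
    · have := limsup_div_le_of_le_linear (g := f) (c := c) (B := f 0 + B) (fun s hs => by
        have := hB 0 le_rfl s hs.le
        rw [zero_add] at this
        linarith) hcob
      exact absurd this (not_le.2 hc.2)
  have hupp : ∀ b > l, ∃ c < b, ∃ B, ∀ t ≥ 0, ∀ s ≥ 0, f (t + s) - f t ≤ c * s + B := by
    intro b hb
    obtain ⟨c, hc, ⟨B, hB⟩ | hB⟩ := hdich l b hpos hb
    · have := le_limsup_div_of_linear_le (g := f) (c := c) (B := B - f 0) (fun s hs => by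
        have := hB 0 le_rfl s hs.le
        rw [zero_add] at this
        linarith) hbdd
      exact absurd this (not_le.2 hc.1)
    · exact ⟨c, hc.2, hB⟩
  have hne : ∀ s, {x : ℝ | ∃ t ≥ (0 : ℝ), x = f (t + s) - f t}.Nonempty := fun s =>
    ⟨_, 0, le_rfl, rfl⟩
  have hlimf : Tendsto (fun s => f s / s) atTop (𝓝 l) := by
    refine tendsto_div_of_linear_bounds (fun a ha => ?_) fun b hb => ?_
    · obtain ⟨c, hc, B, hB⟩ := hlow a ha
      refine ⟨c, hc, B - f 0, fun s hs => ?_⟩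
      have := hB 0 le_rfl s hs.le
      rw [zero_add] at this
      linarith
    · obtain ⟨c, hc, B, hB⟩ := hupp b hb
      refine ⟨c, hc, B + f 0, fun s hs => ?_⟩
      have := hB 0 le_rfl s hs.le
      rw [zero_add] at this
      linarith
  have hlimU : Tendsto (fun s => sSup {x : ℝ | ∃ t ≥ (0 : ℝ), x = f (t + s) - f t} / s) atTop
      (𝓝 l) := by
    refine tendsto_div_of_linear_bounds (fun a ha => ?_) fun b hb => ?_
    · obtain ⟨c, hc, B, hB⟩ := hlow a ha
      refine ⟨c, hc, B, fun s hs => (hB 0 le_rfl s hs.le).trans (le_csSup ?_ ⟨0, le_rfl, rfl⟩)⟩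
      refine ⟨A * (s + 1), ?_⟩
      rintro _ ⟨t, ht, rfl⟩
      linarith [hup t ht s hs.le]
    · obtain ⟨c, hc, B, hB⟩ := hupp b hb
      refine ⟨c, hc, B, fun s hs => csSup_le (hne s) ?_⟩
      rintro _ ⟨t, ht, rfl⟩
      exact hB t ht s hs.le
  have hlimL : Tendsto (fun s => sInf {x : ℝ | ∃ t ≥ (0 : ℝ), x = f (t + s) - f t} / s) atTop
      (𝓝 l) := by
    refine tendsto_div_of_linear_bounds (fun a ha => ?_) fun b hb => ?_
    · obtain ⟨c, hc, B, hB⟩ := hlow a ha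
      refine ⟨c, hc, B, fun s hs => le_csInf (hne s) ?_⟩
      rintro _ ⟨t, ht, rfl⟩
      exact hB t ht s hs.le
    · obtain ⟨c, hc, B, hB⟩ := hupp b hb
      obtain ⟨c', -, B', hB'⟩ := hlow 0 hpos
      refine ⟨c, hc, B, fun s hs => le_trans (csInf_le ?_ ⟨0, le_rfl, rfl⟩)
        (hB 0 le_rfl s hs.le)⟩
      refine ⟨c' * s - B', ?_⟩
      rintro _ ⟨t, ht, rfl⟩
      exact hB' t ht s hs.le
  have e1 : cbarF f = l := hlimU.limsup_eq
  have e2 : cunderF f = l := hlimL.liminf_eq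
  rw [e1, e2]
  exact ⟨rfl, hlimf.liminf_eq, rfl⟩

namespace InvasionSetting

variable {d : ℕ} {V : Euc n → ℝ} {D : EscData n V} {u : ℝ → ℝ → Euc n}
  {C ν K δ L₀ cHom : ℝ} {rHom : ℝ → ℝ}

set_option maxHeartbeats 1000000 in
/-- In a frame travelling at a speed that is not the speed of a front, the escape point cannot stay
close to its maximum over long time intervals. -/
lemma exists_climb (h : InvasionSetting d V D u C ν K δ L₀ cHom rHom)
    (hnd : HNonDeg V) (hob : HOnlyBist V) {c : ℝ} (hc : 0 < c) (hempty : PhiInv V c 0 = ∅) :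
    ∃ T > 0, ∃ t₀ ≥ 0, ∀ τ ≥ t₀, ∃ x ≥ 0, x ∈ Icc (τ - T) (τ + T) ∧
      rescF V d D.lmin u δ L₀ rHom τ - c * τ + 1 < rescF V d D.lmin u δ L₀ rHom x - c * x := by
  obtain ⟨ν', hν', k, hk, ε, hε, hck, hfun⟩ := h.exists_functionals hnd hob hc hempty
  obtain ⟨A, hA, hup⟩ := h.rescF_add_le
  obtain ⟨t₁, ht₁, hhom⟩ := h.hom.eventually_add_le
  set f := rescF V d D.lmin u δ L₀ rHom with hf
  obtain ⟨T, hT, q, hq, hno⟩ := exists_no_trapped (c₁ := Real.exp (c * (-(2 * A)))) hν' hk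
    (Real.exp_pos _) hε
  obtain ⟨B, R, t₀, hR, ht₀, hfun⟩ := hfun q hq
  obtain ⟨S, hS, hno⟩ := hno B
  obtain ⟨t₂, ht₂⟩ := eventually_atTop.1 (h.tendsto_sub_rescF.eventually_ge_atTop
    (R + c * T + (cHom + 1) * S))
  rw [← hf] at ht₂
  set W := S + T + (R + 2) / c with hW
  have hWc : c * W = c * S + c * T + R + 2 := by rw [hW]; field_simp; ring
  have hRc : 0 < (R + 2) / c := by positivity
  clear_value W
  refine ⟨W, by linarith, max (max (t₀ + S) (t₁ + S)) (max t₂ W),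
    (by linarith : (0 : ℝ) ≤ W).trans ((le_max_right _ _).trans (le_max_right _ _)), fun τ hτ => ?_⟩
  have hτ0 : t₀ + S ≤ τ := (le_max_left _ _).trans ((le_max_left _ _).trans hτ)
  have hτ1 : t₁ + S ≤ τ := (le_max_right _ _).trans ((le_max_left _ _).trans hτ)
  have hτ2 : t₂ ≤ τ := (le_max_left _ _).trans ((le_max_right _ _).trans hτ)
  have hτW : W ≤ τ := (le_max_right _ _).trans ((le_max_right _ _).trans hτ)
  by_contra! hcon
  have hfτ : c * S + R ≤ f τ := by
    have h1 := hcon (τ - W) (by linarith) ⟨le_rfl, by linarith⟩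
    have h2 : 0 ≤ f (τ - W) := h.rescF_nonneg (by linarith)
    have h3 : 0 ≤ c * T := by nlinarith
    linarith
  obtain ⟨M, P, E, N, Q, H⟩ := hfun (f τ - c * τ)
  have hall : ∀ t ∈ Icc (τ - S) (τ + T), t₀ ≤ t ∧ f t ≤ f τ - c * τ + c * t + 1 ∧
      R ≤ f τ - c * τ + c * t ∧ f τ - c * τ + c * t + R ≤ rHom t := by
    intro t ht
    have ht0 : 0 ≤ t := by linarith [ht.1]
    have h1 := hcon t ht0 ⟨by linarith [ht.1], by linarith [ht.2]⟩
    have h2 := mul_le_mul_of_nonneg_left ht.1 hc.le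
    have h3 := mul_le_mul_of_nonneg_left ht.2 hc.le
    have h4 := (hhom (τ - S) (by linarith) S (by linarith)).2
    rw [sub_add_cancel] at h4
    have h5 := h.mono ht.1
    have h6 := ht₂ τ hτ2
    exact ⟨by linarith [ht.1], by linarith, by linarith, by linarith⟩
  have key := fun t (ht : t ∈ Icc (τ - S) (τ + T)) =>
    H t (hall t ht).1 _ rfl (hall t ht).2.1 (hall t ht).2.2.1 (hall t ht).2.2.2
  have hmem : τ - S ∈ Icc (τ - S) (τ + T) := ⟨le_rfl, by linarith⟩
  refine hno τ M P E N Q (fun t => Real.exp (c * (f t - (f τ - c * τ + c * t))))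
    (fun t ht => (key t ht).1) (fun t ht => (key t ht).2.1) (fun t ht => (key t ht).2.2.1)
    (fun t ht => (key t ht).2.2.2.1) (fun t ht => (key t ht).2.2.2.2.1)
    (fun t ht => (key t ht).2.2.2.2.2.1) (fun t ht => ⟨(Real.exp_pos _).le, ?_⟩)
    (fun t ht => ?_) (key _ hmem).2.2.2.2.2.2.1 (key _ hmem).2.2.2.2.2.2.2
  · refine le_trans (Real.exp_le_exp.2 ?_) hck
    have := mul_le_mul_of_nonneg_left
      (by linarith [(hall t ht).2.1] : f t - (f τ - c * τ + c * t) ≤ 1) hc.le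
    linarith
  · refine Real.exp_le_exp.2 (mul_le_mul_of_nonneg_left ?_ hc.le)
    have h1 := hup t (by linarith [ht.1]) (τ - t) (by linarith [ht.2])
    rw [add_sub_cancel] at h1
    have h2 := mul_le_mul_of_nonneg_left (by linarith [ht.1] : τ - t + 1 ≤ 2) hA
    have h3 := mul_le_mul_of_nonneg_left ht.2 hc.le
    linarith

/-- The increments of the escape point lie on one side of every speed that is not the speed of a
front. -/
lemma rescF_sub_dichotomy (h : InvasionSetting d V D u C ν K δ L₀ cHom rHom)
    (hnd : HNonDeg V) (hob : HOnlyBist V) {c : ℝ} (hc : 0 < c) (hempty : PhiInv V c 0 = ∅) :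
    (∃ B, ∀ t ≥ 0, ∀ s ≥ 0, c * s - B ≤
      rescF V d D.lmin u δ L₀ rHom (t + s) - rescF V d D.lmin u δ L₀ rHom t) ∨
    (∃ B, ∀ t ≥ 0, ∀ s ≥ 0,
      rescF V d D.lmin u δ L₀ rHom (t + s) - rescF V d D.lmin u δ L₀ rHom t ≤ c * s + B) := by
  obtain ⟨T, hT, t₀, ht₀, hclimb⟩ := h.exists_climb hnd hob hc hempty
  obtain ⟨A, hA, hup⟩ := h.rescF_add_le
  have hdich := chain_dichotomy (g := fun t => rescF V d D.lmin u δ L₀ rHom t - c * t) hA hT ht₀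
    (fun t ht s hs => by
      have h1 := hup t ht s hs
      have h2 : 0 ≤ c * s := by positivity
      linarith)
    (fun b => ⟨-(c * b), fun t ht => by
      have h1 : 0 ≤ rescF V d D.lmin u δ L₀ rHom t := h.rescF_nonneg ht.1
      have h2 := mul_le_mul_of_nonneg_left ht.2 hc.le
      linarith⟩)
    hclimb
  refine hdich.imp ?_ ?_ <;>
  · rintro ⟨B, hB⟩
    exact ⟨B, fun t ht s hs => by linarith [hB t ht s hs]⟩

lemma cEscV_le_limsup (h : InvasionSetting d V D u C ν K δ L₀ cHom rHom) :
    cEscV u 0 D.dEsc rHom ≤ limsup (fun t => rescF V d D.lmin u δ L₀ rHom t / t) atTop := by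
  obtain ⟨A, hA, hup⟩ := h.rescF_add_le
  refine limsup_le_limsup ?_ ?_ ?_
  · filter_upwards [eventually_gt_atTop 0] with t ht
    exact div_le_div_of_nonneg_right (h.rEscF_le ht) ht.le
  · refine IsBoundedUnder.isCoboundedUnder_le (isBoundedUnder_of_eventually_ge (a := 0) ?_)
    filter_upwards [eventually_gt_atTop 0] with t ht
    exact div_nonneg (Real.sSup_nonneg fun r hr => hr.1.1) ht.le
  · refine isBoundedUnder_of_eventually_le (a := rescF V d D.lmin u δ L₀ rHom 0 + 2 * A) ?_
    filter_upwards [eventually_ge_atTop 1] with t ht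
    rw [div_le_iff₀ (by linarith)]
    have h1 := hup 0 le_rfl t (by linarith)
    rw [zero_add] at h1
    have h2 := mul_le_mul_of_nonneg_left ht (h.rescF_nonneg le_rfl)
    have h3 := mul_le_mul_of_nonneg_left ht hA
    linarith

end InvasionSetting

lemma HDiscVel.exists_phiInv_eq_empty {V : Euc n → ℝ} (hV : HDiscVel V) {m : Euc n}
    (hm : m ∈ MinSet V) {a b : ℝ} (ha : 0 < a) (hab : a < b) :
    ∃ c ∈ Ioo a b, PhiInv V c m = ∅ := by
  by_contra! hno
  have hsub : Ioo a b ⊆ interior {c : ℝ | 0 ≤ c ∧ (PhiInv V c m).Nonempty} :=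
    interior_maximal (fun c hc => ⟨(ha.trans hc.1).le, hno c hc⟩) isOpen_Ioo
  rw [hV m hm] at hsub
  obtain ⟨c, hc⟩ := nonempty_Ioo.2 hab
  exact hsub hc

end MeanSpeeds

/-- mean invasion speed, further control. -/
theorem stmt15 {n d k : ℕ} (hn : 1 ≤ n) (hd : 2 ≤ d) (hk : 2 ≤ k)
    (V : Euc n → ℝ) (hV : ContDiff ℝ (k : ℕ∞) V) (hcoerc : HCoerc V)
    (D : EscData n V) (hgen : HGen V D.dEsc)
    (h0 : (0 : Euc n) ∈ MinSet V) (hV0 : V 0 = 0)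
    (u : ℝ → ℝ → Euc n) (hu : IsRadialSolution d V u)
    (cHom : ℝ) (rHom : ℝ → ℝ) (hhom : HHomWith u 0 cHom rHom)
    (hrHom' : ∀ t : ℝ, 0 ≤ deriv rHom t)
    (hinv : 0 < cEscV u 0 D.dEsc rHom)
    (ν K δ L₀ cno : ℝ) (hν : 0 < ν) (hK : 0 < K)
    (hδ : δ = deltaEsc D.dEsc (wV V) (kappa0 D.lmin))
    (hL : L₀ = L0c (kappa0 D.lmin) ν K δ)
    (hcno : cno = cNoEsc (kappa0 D.lmin) K L₀ δ)
    (hfire : FireIneq V d D.lmin D.dEsc u ν K)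
    (hhull : HullBound V d D.lmin u δ L₀ rHom) :
    cunderF (rescF V d D.lmin u δ L₀ rHom) = cbarF (rescF V d D.lmin u δ L₀ rHom) ∧
      liminf (fun t => rescF V d D.lmin u δ L₀ rHom t / t) atTop =
        cbarF (rescF V d D.lmin u δ L₀ rHom) ∧
      limsup (fun t => rescF V d D.lmin u δ L₀ rHom t / t) atTop =
        cbarF (rescF V d D.lmin u δ L₀ rHom) := by
  obtain ⟨C, hC⟩ := hu.bounded
  obtain ⟨hnd, hob, hdv, -⟩ := hgen
  have h : InvasionSetting d V D u C ν K δ L₀ cHom rHom :=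
    { two_le := hd
      contDiff := hV.of_le (WithTop.coe_le_coe.2 (Nat.cast_le.2 hk))
      coerc := hcoerc
      zero_mem := h0
      zero_val := hV0
      sol := hu
      bound := hC
      hom := hhom
      mono := monotone_of_deriv_nonneg hhom.2.1 hrHom'
      nu_pos := hν
      K_pos := hK
      delta_eq := hδ
      fire := hfire
      hull := hhull }
  obtain ⟨A, -, hup⟩ := h.rescF_add_le
  refine mean_speeds_eq (fun t ht => h.rescF_nonneg ht) hup (hinv.trans_le h.cEscV_le_limsup)
    fun a b ha hab => ?_
  obtain ⟨c, hc, hempty⟩ := hdv.exists_phiInv_eq_empty h0 ha hab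
  exact ⟨c, hc, h.rescF_sub_dichotomy hnd hob (ha.trans hc.1) hempty⟩
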